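/- Let V be a nonzero irreducible W(n)_μ-module that is cuspidal, i.e. V is the direct sum of the eigenspaces V_λ = {v ∈ V : e_0·v = λv} (λ ∈ ℂ) of e_0 and there is a constant N with dim V_λ ≤ N for all λ. Then V is isomorphic to exactly one of: (1) a tensor field module T_μ(a,b) with a ∉ Γ_μ or b ∉ {0,1}; (2) the quotient T̄_μ(0,0) = T_μ(0,0)/ℂv_0; (3) the one-dimensional trivial module. -/

import Mathlib

/-- The index lattice `ℤⁿ` (as functions `Fin n → ℤ`). -/
abbrev Zn (n : ℕ) := Fin n → ℤ

/-- Underlying vector space of the solenoidal Witt algebra `W(n)_μ`: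
finitely supported functions `ℤⁿ → ℂ`, with basis `e_α = single α 1`. -/
abbrev Wn (n : ℕ) := Zn n →₀ ℂ

/-- `μ·α = μ₁α₁ + ⋯ + μₙαₙ`. -/
noncomputable def mdot {n : ℕ} (μ : Fin n → ℂ) (α : Zn n) : ℂ :=
  ∑ i, μ i * (α i : ℂ)

/-- `μ` is generic: `μ·α ≠ 0` for every nonzero `α ∈ ℤⁿ`. -/
def Generic {n : ℕ} (μ : Fin n → ℂ) : Prop :=
  ∀ α : Zn n, α ≠ 0 → mdot μ α ≠ 0

/-- The basis vector `e_α` of `W(n)_μ`. -/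
noncomputable def ew {n : ℕ} (α : Zn n) : Wn n := Finsupp.single α 1

/-- Underlying space of the tensor-field modules `T_μ(a,b)`: the free `ℂ`-module
with basis `{v_β : β ∈ ℤⁿ}`. -/
abbrev Tn (n : ℕ) := Zn n →₀ ℂ

/-- The basis vector `v_β` of `T_μ(a,b)`. -/
noncomputable def vv {n : ℕ} (β : Zn n) : Tn n := Finsupp.single β 1

open Polynomial in
/-- The block matrix of the linear system satisfied by three consecutive values of a sequence
that obeys the first-order and the second-order difference equations. -/
noncomputable def blockSystem {ι : Type} [Fintype ι] [DecidableEq ι]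
    (CL HL CR HR : Matrix ι ι ℂ) : Matrix (Fin 3 × ι) (Fin 3 × ι) ℂ[X] :=
  let F1 : Matrix ι ι ℂ → ℂ[X] → Matrix ι ι ℂ[X] := fun A p =>
    (p * (p - 1)) • (1 : Matrix ι ι ℂ[X]) - A.map C
  let F2 : Matrix ι ι ℂ → Matrix ι ι ℂ → ℂ[X] → Matrix ι ι ℂ[X] := fun A B p =>
    (p * (p - 1) * (p - 2)) • (1 : Matrix ι ι ℂ[X]) - (3 * p) • A.map C + B.map C
  Matrix.of fun i j => (match i.1, j.1 with
    | 0, 0 => F1 CL (X + 2)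
    | 0, 1 => -F1 CR X
    | 0, 2 => 0
    | 1, 0 => 0
    | 1, 1 => F1 CL (X + 1)
    | 1, 2 => -F1 CR (X - 1)
    | 2, 0 => F2 CL HL (X + 2)
    | 2, 1 => 0
    | 2, 2 => -F2 CR HR X) i.2 j.2

open Polynomial in
lemma blockSystem_mulVec {ι : Type} [Fintype ι] [DecidableEq ι]
    (CL HL CR HR : Matrix ι ι ℂ) (v : Fin 3 × ι → ℂ[X]) (b : ι) :
    (blockSystem CL HL CR HR).mulVec v (0, b) =
        ((X + 2) * (X + 1) * v (0, b) - ∑ c, C (CL b c) * v (0, c))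
          - (X * (X - 1) * v (1, b) - ∑ c, C (CR b c) * v (1, c)) ∧
    (blockSystem CL HL CR HR).mulVec v (1, b) =
        ((X + 1) * X * v (1, b) - ∑ c, C (CL b c) * v (1, c))
          - ((X - 1) * (X - 2) * v (2, b) - ∑ c, C (CR b c) * v (2, c)) ∧
    (blockSystem CL HL CR HR).mulVec v (2, b) =
        ((X + 2) * (X + 1) * X * v (0, b) - 3 * (X + 2) * ∑ c, C (CL b c) * v (0, c)
          + ∑ c, C (HL b c) * v (0, c))
          - (X * (X - 1) * (X - 2) * v (2, b) - 3 * X * ∑ c, C (CR b c) * v (2, c)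
          + ∑ c, C (HR b c) * v (2, c)) := by
  refine ⟨?_, ?_, ?_⟩ <;>
  simp [blockSystem, Matrix.mulVec, dotProduct, Fintype.sum_prod_type, Fin.sum_univ_three,
    Matrix.one_apply, sub_mul, add_mul, mul_assoc, Finset.sum_add_distrib, Finset.sum_sub_distrib,
    Finset.mul_sum, ite_mul, mul_ite] <;> ring_nf

open Polynomial in
lemma blockSystem_injective {ι : Type} [Fintype ι] [DecidableEq ι]
    (CL HL CR HR : Matrix ι ι ℂ) (v : Fin 3 × ι → ℂ[X])
    (hv : (blockSystem CL HL CR HR).mulVec v = 0) : v = 0 := by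
  classical
  set N := Finset.univ.sup fun j => (v j).natDegree with hN
  have hdeg : ∀ j k, N < k → (v j).coeff k = 0 := fun j k hk =>
    coeff_eq_zero_of_natDegree_lt (lt_of_le_of_lt
      (Finset.le_sup (f := fun j => (v j).natDegree) (Finset.mem_univ j)) hk)
  have hsum : ∀ (A : Matrix ι ι ℂ) (i : Fin 3) (b : ι) k, N < k →
      (∑ c, C (A b c) * v (i, c)).coeff k = 0 := by
    intro A i b k hk
    simp [finsetSum_coeff, hdeg _ _ hk]
  have key : ∀ j, (v j).coeff N = 0 := by
    have h3 : ∀ b, (v (0, b)).coeff N = 0 ∧ (v (1, b)).coeff N = 0 ∧ (v (2, b)).coeff N = 0 := by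
      intro b
      obtain ⟨e0, e1, e2⟩ := blockSystem_mulVec CL HL CR HR v b
      rw [hv] at e0 e1 e2
      simp only [Pi.zero_apply] at e0 e1 e2
      have t : ∀ p : ℂ[X], p.coeff (N + 1) = 0 → (X * p).coeff (N + 2) = 0 := by
        intro p hp; rw [coeff_X_mul, hp]
      have s0 := fun i A => hsum A i b (N + 1) (by omega)
      have s1 := fun i A => hsum A i b (N + 2) (by omega)
      have s2 := fun i A => hsum A i b (N + 3) (by omega)
      have d1 := fun j => hdeg j (N + 1) (by omega)
      have d2 := fun j => hdeg j (N + 2) (by omega)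
      have d3 := fun j => hdeg j (N + 3) (by omega)
      have x1 : ∀ p : ℂ[X], ((X + 2) * (X + 1) * p) = X * (X * p) + C 3 * (X * p) + C 2 * p := by
        intro p; simp only [map_ofNat]; ring
      have x2 : ∀ p : ℂ[X], (X * (X - 1) * p) = X * (X * p) - X * p := by intro p; ring
      have x3 : ∀ p : ℂ[X], ((X + 1) * X * p) = X * (X * p) + X * p := by intro p; ring
      have x4 : ∀ p : ℂ[X], ((X - 1) * (X - 2) * p) = X * (X * p) - C 3 * (X * p) + C 2 * p := by
        intro p; simp only [map_ofNat]; ring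
      have x5 : ∀ p q : ℂ[X], ((X + 2) * (X + 1) * X * p - 3 * (X + 2) * q) =
          X * (X * (X * p)) + C 3 * (X * (X * p)) + C 2 * (X * p) - C 3 * (X * q) - C 6 * q := by
        intro p q; simp only [map_ofNat]; ring
      have x6 : ∀ p q : ℂ[X], (X * (X - 1) * (X - 2) * p - 3 * X * q) =
          X * (X * (X * p)) - C 3 * (X * (X * p)) + C 2 * (X * p) - C 3 * (X * q) := by
        intro p q; simp only [map_ofNat]; ring
      rw [x1, x2] at e0
      rw [x3, x4] at e1
      rw [x5, x6] at e2
      have a0 := congrArg (fun p => coeff p (N + 2)) e0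
      have a1 := congrArg (fun p => coeff p (N + 2)) e1
      have b0 := congrArg (fun p => coeff p (N + 1)) e0
      have b1 := congrArg (fun p => coeff p (N + 1)) e1
      have b2 := congrArg (fun p => coeff p (N + 2)) e2
      simp only [coeff_sub, coeff_add, coeff_X_mul, coeff_C_mul, coeff_zero, s0, s1, d1, d2,
        mul_zero] at a0 a1 b0 b1 b2
      have hB : (v (1, b)).coeff N = 0 := by linear_combination (1/2) * (b2 - b0 - b1)
      refine ⟨?_, hB, ?_⟩
      · linear_combination hB - a0
      · linear_combination hB + a1
    rintro ⟨i, b⟩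
    obtain ⟨h0, h1, h2⟩ := h3 b
    fin_cases i
    exacts [h0, h1, h2]
  by_contra hne
  obtain ⟨j, hj⟩ : ∃ j, v j ≠ 0 := by
    by_contra h; push Not at h; exact hne (funext h)
  obtain ⟨j', -, hj'⟩ := Finset.exists_mem_eq_sup (Finset.univ) ⟨j, Finset.mem_univ j⟩
    fun j => (v j).natDegree
  have h0 : v j' = 0 := by
    rw [← leadingCoeff_eq_zero, leadingCoeff, ← hj']; exact key j'
  have hN0 : N = 0 := by rw [hN, hj', h0, natDegree_zero]
  have : (v j).natDegree = 0 := by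
    have := Finset.le_sup (f := fun j => (v j).natDegree) (Finset.mem_univ j)
    omega
  apply hj
  rw [eq_C_of_natDegree_eq_zero this, ← hN0, key, C_0]

open Polynomial in
lemma rational_of_difference_eqs {W : Type} [AddCommGroup W] [Module ℂ W] [FiniteDimensional ℂ W]
    (CL HL CR HR : Module.End ℂ W) (y0 : ℂ) (u : ℕ → W) (k0 : ℕ) (r1 r2 : W)
    (h1 : ∀ k ≥ k0, ∀ x : ℂ, x = y0 + (k + 1 : ℕ) →
      ((x + 2) * (x + 1)) • u (k + 1) - CL (u (k + 1)) - ((x * (x - 1)) • u k - CR (u k)) = r1)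
    (h2 : ∀ k ≥ k0, ∀ x : ℂ, x = y0 + (k + 2 : ℕ) →
      (((x + 2) * (x + 1) * x) • u (k + 2) - (3 * (x + 2)) • CL (u (k + 2)) + HL (u (k + 2))) -
      ((x * (x - 1) * (x - 2)) • u k - (3 * x) • CR (u k) + HR (u k)) = x • r2) :
    ∃ D : ℂ[X], D ≠ 0 ∧ ∀ θ : W →ₗ[ℂ] ℂ, ∃ U : ℂ[X],
      (∀ k ≥ k0 + 2, D.eval (y0 + k) * θ (u k) = U.eval (y0 + k)) ∧
      (r1 = 0 → r2 = 0 → U = 0) := by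
  classical
  let b := Module.finBasis ℂ W
  let mx : Module.End ℂ W → Matrix _ _ ℂ := fun A => LinearMap.toMatrix b b A
  have hmx : ∀ A w c, ∑ d, mx A c d * b.repr w d = b.repr (A w) c := by
    intro A w c
    have := congrFun (LinearMap.toMatrix_mulVec_repr b b A w) c
    exact this
  set M := blockSystem (mx CL) (mx HL) (mx CR) (mx HR) with hM
  have hdet : M.det ≠ 0 := by
    intro h
    obtain ⟨v, hv, hv'⟩ := Matrix.exists_mulVec_eq_zero_iff.2 h
    exact hv (blockSystem_injective _ _ _ _ v hv')
  let R : Fin 3 × Fin (Module.finrank ℂ W) → ℂ[X] := fun j =>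
    if j.1 = 2 then X * C (b.repr r2 j.2) else C (b.repr r1 j.2)
  refine ⟨M.det, hdet, fun θ => ⟨∑ c, C (θ (b c)) * (M.adjugate.mulVec R) (0, c), ?_, ?_⟩⟩
  · intro k hk
    obtain ⟨k, rfl⟩ : ∃ l, k = l + 2 := ⟨k - 2, by omega⟩
    set x : ℂ := y0 + (k + 2 : ℕ) with hx
    let v : Fin 3 × Fin (Module.finrank ℂ W) → ℂ[X] := fun j =>
      C (b.repr (if j.1 = 0 then u (k + 2) else if j.1 = 1 then u (k + 1) else u k) j.2)
    have hv : ∀ j, eval x (M.mulVec v j) = eval x (R j) := by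
      rintro ⟨i, c⟩
      obtain ⟨e0, e1, e2⟩ := blockSystem_mulVec (mx CL) (mx HL) (mx CR) (mx HR) v c
      rw [← hM] at e0 e1 e2
      fin_cases i
      · have := congrArg (fun w => b.repr w c) (h1 (k + 1) (by omega) x (by rw [hx]))
        simp only [map_sub, map_smul, Finsupp.sub_apply, Finsupp.smul_apply, smul_eq_mul] at this
        simp only [Fin.zero_eta, e0]
        simp [v, R, eval_finsetSum, hmx]
        linear_combination this
      · have := congrArg (fun w => b.repr w c) (h1 k (by omega) (x - 1) (by
          rw [hx]; push_cast; ring))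
        simp only [map_sub, map_smul, Finsupp.sub_apply, Finsupp.smul_apply, smul_eq_mul] at this
        simp only [Fin.mk_one, e1]
        simp [v, R, eval_finsetSum, hmx]
        linear_combination this
      · have := congrArg (fun w => b.repr w c) (h2 k (by omega) x hx)
        simp only [map_sub, map_add, map_smul, Finsupp.sub_apply, Finsupp.add_apply,
          Finsupp.smul_apply, smul_eq_mul] at this
        simp only [Fin.reduceFinMk, e2]
        simp [v, R, eval_finsetSum, hmx]
        linear_combination this
    have hadj : M.adjugate.mulVec (M.mulVec v) = M.det • v := by
      rw [Matrix.mulVec_mulVec, Matrix.adjugate_mul, Matrix.smul_mulVec, Matrix.one_mulVec]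
    have hθ : θ (u (k + 2)) = ∑ c, θ (b c) * b.repr (u (k + 2)) c := by
      conv_lhs => rw [← b.sum_repr (u (k + 2)), map_sum]
      exact Finset.sum_congr rfl fun c _ => by rw [map_smul, smul_eq_mul, mul_comm]
    rw [hθ, Finset.mul_sum, eval_finsetSum]
    refine Finset.sum_congr rfl fun c _ => ?_
    have e : eval x ((M.adjugate.mulVec R) (0, c)) = eval x (M.det) * b.repr (u (k + 2)) c := by
      have := congrArg (eval x) (congrFun hadj (0, c))
      simp only [Matrix.mulVec, dotProduct, eval_finsetSum, eval_mul, Pi.smul_apply, smul_eq_mul]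
        at this ⊢
      rw [show eval x (v (0, c)) = b.repr (u (k + 2)) c by simp [v]] at this
      rw [← this]
      refine Finset.sum_congr rfl fun j _ => ?_
      rw [← hv j, Matrix.mulVec, dotProduct, eval_finsetSum]
      simp only [eval_mul]
    rw [eval_mul, e, eval_C]; ring
  · rintro rfl rfl
    have : R = 0 := by
      funext j; simp [R]
    rw [this]; simp

/-- A map `ℂ → W` whose composition with every linear functional is a polynomial function. -/
def IsPolyMap {W : Type} [AddCommGroup W] [Module ℂ W] (f : ℂ → W) : Prop :=
  ∀ θ : W →ₗ[ℂ] ℂ, ∃ p : Polynomial ℂ, ∀ x, θ (f x) = p.eval x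

section IsPolyMap

variable {W W' : Type} [AddCommGroup W] [Module ℂ W] [AddCommGroup W'] [Module ℂ W']

lemma IsPolyMap.const (w : W) : IsPolyMap fun _ => w := fun θ => ⟨Polynomial.C (θ w), by simp⟩

lemma IsPolyMap.add {f g : ℂ → W} (hf : IsPolyMap f) (hg : IsPolyMap g) :
    IsPolyMap fun x => f x + g x := fun θ => by
  obtain ⟨p, hp⟩ := hf θ
  obtain ⟨q, hq⟩ := hg θ
  exact ⟨p + q, fun x => by simp [hp, hq]⟩

lemma IsPolyMap.sub {f g : ℂ → W} (hf : IsPolyMap f) (hg : IsPolyMap g) :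
    IsPolyMap fun x => f x - g x := fun θ => by
  obtain ⟨p, hp⟩ := hf θ
  obtain ⟨q, hq⟩ := hg θ
  exact ⟨p - q, fun x => by simp [hp, hq]⟩

lemma IsPolyMap.smul {f : ℂ → W} (hf : IsPolyMap f) {a : ℂ → ℂ} (q : Polynomial ℂ)
    (hq : ∀ x, a x = q.eval x) : IsPolyMap fun x => a x • f x := fun θ => by
  obtain ⟨p, hp⟩ := hf θ
  exact ⟨q * p, fun x => by simp [hp, hq]⟩

lemma IsPolyMap.map {f : ℂ → W} (hf : IsPolyMap f) (A : W →ₗ[ℂ] W') :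
    IsPolyMap fun x => A (f x) := fun θ => hf (θ.comp A)

lemma IsPolyMap.shift {f : ℂ → W} (hf : IsPolyMap f) (c : ℂ) :
    IsPolyMap fun x => f (x + c) := fun θ => by
  obtain ⟨p, hp⟩ := hf θ
  exact ⟨p.comp (Polynomial.X + Polynomial.C c), fun x => by simp [hp]⟩

lemma IsPolyMap.sum {ι : Type} (s : Finset ι) {f : ι → ℂ → W} (hf : ∀ i, IsPolyMap (f i)) :
    IsPolyMap fun x => ∑ i ∈ s, f i x := fun θ => by
  choose p hp using fun i => hf i θ
  exact ⟨∑ i ∈ s, p i, fun x => by simp [hp, Polynomial.eval_finsetSum]⟩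

lemma eval_eq_zero_of_eventually {p : Polynomial ℂ} {y0 : ℂ} {k1 : ℕ}
    (h : ∀ k ≥ k1, p.eval (y0 + (k : ℕ)) = 0) : p = 0 := by
  apply Polynomial.eq_zero_of_infinite_isRoot
  refine Set.Infinite.mono (s := (fun k : ℕ => y0 + (k : ℂ)) '' Set.Ici k1) ?_ ?_
  · rintro _ ⟨k, hk, rfl⟩
    exact h k hk
  · refine (Set.Ici_infinite k1).image ?_
    intro a _ b _ hab
    simpa using hab

lemma IsPolyMap.eq_zero [FiniteDimensional ℂ W] {f : ℂ → W} (hf : IsPolyMap f) {y0 : ℂ} {k1 : ℕ}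
    (h : ∀ k ≥ k1, f (y0 + (k : ℕ)) = 0) (x : ℂ) : f x = 0 := by
  rw [← Module.forall_dual_apply_eq_zero_iff ℂ]
  intro θ
  obtain ⟨p, hp⟩ := hf θ
  rw [hp, eval_eq_zero_of_eventually (p := p) (y0 := y0) (k1 := k1)]
  · simp
  · intro k hk
    rw [← hp, h k hk, map_zero]

lemma IsPolyMap.of_coord [FiniteDimensional ℂ W] (U : Fin (Module.finrank ℂ W) → Polynomial ℂ) :
    IsPolyMap fun x => ∑ i, (U i).eval x • Module.finBasis ℂ W i :=
  IsPolyMap.sum _ fun i => (IsPolyMap.const _).smul (U i) fun _ => rfl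

open Polynomial in
lemma exists_reduced_fraction [FiniteDimensional ℂ W] (y0 : ℂ) (u : ℕ → W) (D₀ : ℂ[X])
    (hD₀ : D₀ ≠ 0) (h : ∀ θ : W →ₗ[ℂ] ℂ, ∃ U : ℂ[X], ∃ k1 : ℕ, ∀ k ≥ k1,
      D₀.eval (y0 + (k : ℕ)) * θ (u k) = U.eval (y0 + (k : ℕ))) :
    ∃ D : ℂ[X], D ≠ 0 ∧ ∃ P : ℂ → W, IsPolyMap P ∧ (∃ k1 : ℕ, ∀ k ≥ k1,
      D.eval (y0 + (k : ℕ)) • u k = P (y0 + (k : ℕ))) ∧ ∀ ζ, D.IsRoot ζ → P ζ ≠ 0 := by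
  classical
  let Q : ℕ → Prop := fun d => ∃ D : ℂ[X], D ≠ 0 ∧ D.natDegree = d ∧ ∃ P : ℂ → W, IsPolyMap P ∧
    ∃ k1 : ℕ, ∀ k ≥ k1, D.eval (y0 + (k : ℕ)) • u k = P (y0 + (k : ℕ))
  let b := Module.finBasis ℂ W
  have hQ : ∃ d, Q d := by
    choose U k1 hU using h
    refine ⟨_, D₀, hD₀, rfl, _, IsPolyMap.of_coord fun i => U (b.coord i),
      Finset.univ.sup fun i => k1 (b.coord i), fun k hk => ?_⟩
    conv_lhs => rw [← b.sum_repr (u k), Finset.smul_sum]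
    refine Finset.sum_congr rfl fun i _ => ?_
    rw [smul_smul, ← hU (b.coord i) k ((Finset.le_sup (f := fun i => k1 (b.coord i))
      (Finset.mem_univ i)).trans hk)]
    rfl
  obtain ⟨D, hD, hdeg, P, hP, k1, hk1⟩ := Nat.find_spec hQ
  refine ⟨D, hD, P, hP, ⟨k1, hk1⟩, fun ζ hζ hz => ?_⟩
  obtain ⟨D', rfl⟩ := dvd_iff_isRoot.2 hζ
  have hD' : D' ≠ 0 := right_ne_zero_of_mul hD
  choose U hU using fun i => hP (b.coord i)
  have hUd : ∀ i, ∃ U', U i = (X - C ζ) * U' := fun i => by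
    apply dvd_iff_isRoot.2
    rw [IsRoot, ← hU i, hz, map_zero]
  choose U' hU' using hUd
  obtain ⟨k2, hk2⟩ : ∃ k2 : ℕ, ∀ k ≥ k2, y0 + (k : ℕ) ≠ ζ := by
    by_cases hh : ∃ m : ℕ, y0 + (m : ℕ) = ζ
    · obtain ⟨m, rfl⟩ := hh
      refine ⟨m + 1, fun k hk hk' => ?_⟩
      have : k = m := by simpa using hk'
      omega
    · exact ⟨0, fun k _ hk => hh ⟨k, hk⟩⟩
  refine Nat.find_min hQ (m := D'.natDegree) ?_ ⟨D', hD', rfl, _, IsPolyMap.of_coord U',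
    max k1 k2, fun k hk => ?_⟩
  · rw [← hdeg, natDegree_mul (X_sub_C_ne_zero ζ) hD', natDegree_X_sub_C]; omega
  · have h2 := sub_ne_zero.2 (hk2 k (le_of_max_le_right hk))
    apply smul_right_injective W h2
    have e := hk1 k (le_of_max_le_left hk)
    simp only [eval_mul, eval_sub, eval_X, eval_C] at e
    simp only [smul_smul, e, Finset.smul_sum]
    conv_lhs => rw [← b.sum_repr (P _)]
    refine Finset.sum_congr rfl fun i _ => ?_
    congr 1
    have := hU i (y0 + (k : ℕ))
    rw [hU', eval_mul] at this
    simpa using this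

end IsPolyMap

open Polynomial in
lemma coeff_comp_X_sub_one {N : ℕ} (U : ℂ[X]) (hU : U.natDegree ≤ N) :
    (U.comp (X - 1)).coeff N = U.coeff N ∧
    (X * U.comp (X - 1)).coeff N = (X * U).coeff N - N * U.coeff N := by
  have hc : ∀ n k, ((X - 1 : ℂ[X]) ^ n).coeff k = (-1) ^ (n - k) * (n.choose k : ℂ) := by
    intro n k
    have := coeff_X_add_C_pow (-1 : ℂ) n k
    simpa [sub_eq_add_neg] using this
  refine induction_with_natDegree_le (motive := fun U : ℂ[X] => (U.comp (X - 1)).coeff N = U.coeff N ∧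
    (X * U.comp (X - 1)).coeff N = (X * U).coeff N - N * U.coeff N) N ?_ ?_ ?_ U hU
  · simp
  · intro n r _ hn
    simp only [mul_comp, C_comp, pow_comp, X_comp, coeff_C_mul, hc, coeff_X_pow]
    constructor
    · rcases hn.lt_or_eq with h | rfl
      · simp [Nat.choose_eq_zero_of_lt h, h.ne']
      · simp
    · rcases N with _ | M
      · simp
      · rw [coeff_X_mul, coeff_X_mul]
        simp only [coeff_C_mul, hc, coeff_X_pow]
        rcases hn.lt_or_eq with h | rfl
        · rcases (Nat.lt_succ_iff.1 h).lt_or_eq with h' | rfl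
          · simp [Nat.choose_eq_zero_of_lt h', h'.ne', h.ne']
          · simp
        · simp [Nat.choose_succ_self_right]; ring
  · rintro f g _ _ ⟨h1, h2⟩ ⟨h3, h4⟩
    simp only [add_comp, mul_add, coeff_add, h1, h2, h3, h4]
    exact ⟨trivial, by ring⟩

section annihilation

open Polynomial

variable {E : Type} [AddCommGroup E] [Module ℂ E] [FiniteDimensional ℂ E]

lemma polynomial_solution_false [Nontrivial E] (K : Module.End ℂ E) (P : ℂ → Module.End ℂ E)
    (hP : IsPolyMap P) (d : ℂ) (hd : d ≠ 0)
    (h : ∀ x : ℂ, ((x + 2) * (x + 1)) • P x - K * P x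
      - ((x * (x - 1)) • P (x - 1) - P (x - 1) * K) = d • 1) : False := by
  classical
  let b := Module.finBasis ℂ (Module.End ℂ E)
  choose U hU using fun i => hP (b.coord i)
  have hPx : ∀ x, P x = ∑ j, (U j).eval x • b j := by
    intro x
    conv_lhs => rw [← b.sum_repr (P x)]
    exact Finset.sum_congr rfl fun j _ => by rw [← hU]; rfl
  set N := Finset.univ.sup fun j => (U j).natDegree with hN
  have hle : ∀ j, (U j).natDegree ≤ N := fun j =>
    Finset.le_sup (f := fun j => (U j).natDegree) (Finset.mem_univ j)
  have hdeg : ∀ j k, N < k → (U j).coeff k = 0 := fun j k hk =>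
    coeff_eq_zero_of_natDegree_lt (lt_of_le_of_lt (hle j) hk)
  have hdeg' : ∀ j k, N < k → ((U j).comp (X - 1)).coeff k = 0 := fun j k hk => by
    apply coeff_eq_zero_of_natDegree_lt
    rw [natDegree_comp]
    have : (X - 1 : ℂ[X]).natDegree = 1 := by simpa using natDegree_X_sub_C (1 : ℂ)
    rw [this, mul_one]
    exact lt_of_le_of_lt (hle j) hk
  have key : ∀ i, (U i).coeff N = 0 := by
    intro i
    have e : X * (X * U i) + C 3 * (X * U i) + C 2 * U i
        - ∑ j, C (b.coord i (K * b j)) * U j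
        - (X * (X * (U i).comp (X - 1)) - X * (U i).comp (X - 1)
        - ∑ j, C (b.coord i (b j * K)) * (U j).comp (X - 1)) = C (d * b.coord i 1) := by
      apply Polynomial.funext
      intro x
      have e1 := congrArg (b.coord i) (h x)
      have e2 : b.coord i (K * P x) = ∑ j, b.coord i (K * b j) * (U j).eval x := by
        rw [hPx, Finset.mul_sum, map_sum]
        exact Finset.sum_congr rfl fun j _ => by
          rw [mul_smul_comm, map_smul, smul_eq_mul, mul_comm]
      have e3 : b.coord i (P (x - 1) * K) =
          ∑ j, b.coord i (b j * K) * (U j).eval (x - 1) := by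
        rw [hPx, Finset.sum_mul, map_sum]
        exact Finset.sum_congr rfl fun j _ => by
          rw [smul_mul_assoc, map_smul, smul_eq_mul, mul_comm]
      simp only [map_sub, map_smul, smul_eq_mul, e2, e3, hU] at e1
      simp only [eval_sub, eval_add, eval_mul, eval_X, eval_C, eval_comp, eval_finsetSum, eval_one]
      linear_combination e1
    have e1 := congrArg (fun p => coeff p (N + 1)) e
    obtain ⟨c1, c2⟩ := coeff_comp_X_sub_one (U i) (hle i)
    simp only [coeff_sub, coeff_add, coeff_X_mul, coeff_C_mul, finsetSum_coeff, coeff_C_succ,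
      hdeg _ _ (Nat.lt_succ_self N), hdeg' _ _ (Nat.lt_succ_self N), c1, c2] at e1
    simp only [mul_zero, Finset.sum_const_zero] at e1
    have e2 : ((N : ℂ) + 4) * (U i).coeff N = 0 := by linear_combination e1
    refine (mul_eq_zero.1 e2).resolve_left ?_
    exact_mod_cast (by omega : N + 4 ≠ 0)
  have hz : ∀ i, U i = 0 := by
    intro i
    obtain ⟨j', -, hj'⟩ := Finset.exists_mem_eq_sup (Finset.univ) ⟨i, Finset.mem_univ i⟩
      fun j => (U j).natDegree
    have h0 : U j' = 0 := by
      rw [← leadingCoeff_eq_zero, leadingCoeff, ← hj']; exact key j'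
    have hN0 : N = 0 := by rw [hN, hj', h0, natDegree_zero]
    have : (U i).natDegree = 0 := by have := hle i; omega
    rw [eq_C_of_natDegree_eq_zero this, ← hN0, key, C_0]
  have hP0 : ∀ x, P x = 0 := fun x => by simp [hPx, hz]
  have := h 0
  simp only [hP0, mul_zero, zero_mul, smul_zero, sub_zero] at this
  exact (smul_ne_zero hd one_ne_zero) this.symm

lemma exists_common_eigenvector [Nontrivial E] (K H : Module.End ℂ E) (G : ℕ → Module.End ℂ E)
    (y0 : ℂ) (k0 : ℕ)
    (h1 : ∀ k ≥ k0, ∀ x : ℂ, x = y0 + (k + 1 : ℕ) →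
      ((x + 2) * (x + 1)) • G (k + 1) - K * G (k + 1)
        - ((x * (x - 1)) • G k - G k * K) = (3 : ℂ) • 1)
    (h2 : ∀ k ≥ k0, ∀ x : ℂ, x = y0 + (k + 2 : ℕ) →
      (((x + 2) * (x + 1) * x) • G (k + 2) - (3 * (x + 2)) • (K * G (k + 2)) + H * G (k + 2)) -
      ((x * (x - 1) * (x - 2)) • G k - (3 * x) • (G k * K) + G k * H) = x • (4 : ℂ) • 1) :
    ∃ b : ℂ, ∃ w : E, w ≠ 0 ∧ K w = (b ^ 2 - b) • w ∧
      H w = (-2 * b * (b - 1) * (b - 2)) • w := by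
  obtain ⟨D₀, hD₀, hr⟩ := rational_of_difference_eqs (LinearMap.mulLeft ℂ K) (LinearMap.mulLeft ℂ H)
    (LinearMap.mulRight ℂ K) (LinearMap.mulRight ℂ H) y0 G k0 _ _ h1 h2
  obtain ⟨D, hD, P, hP, ⟨k1, hk1⟩, hroot⟩ := exists_reduced_fraction y0 G D₀ hD₀ fun θ => by
    obtain ⟨U, hU, -⟩ := hr θ
    exact ⟨U, _, hU⟩
  have pid1 : ∀ x, (D.eval (x - 1) * ((x + 2) * (x + 1))) • P x - D.eval (x - 1) • (K * P x)
      - ((D.eval x * (x * (x - 1))) • P (x - 1) - D.eval x • (P (x - 1) * K))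
      = (D.eval x * D.eval (x - 1)) • (3 : ℂ) • 1 := by
    intro x
    rw [← sub_eq_zero]
    have hP' := hP.shift (-1)
    simp only [← sub_eq_add_neg] at hP'
    refine IsPolyMap.eq_zero (y0 := y0) (k1 := max (k0 + 1) (k1 + 1)) (f := fun x =>
      (D.eval (x - 1) * ((x + 2) * (x + 1))) • P x - D.eval (x - 1) • (LinearMap.mulLeft ℂ K (P x))
      - ((D.eval x * (x * (x - 1))) • P (x - 1) - D.eval x • (LinearMap.mulRight ℂ K (P (x - 1))))
      - (D.eval x * D.eval (x - 1)) • (3 : ℂ) • 1) ?_ ?_ x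
    · refine (((hP.smul (D.comp (X - 1) * ((X + 2) * (X + 1))) ?_).sub
        ((hP.map _).smul (D.comp (X - 1)) ?_)).sub ((hP'.smul (D * (X * (X - 1))) ?_).sub
        ((hP'.map _).smul D ?_))).sub ((IsPolyMap.const _).smul (D * D.comp (X - 1)) ?_) <;>
        intro x <;> simp
    · intro k hk
      obtain ⟨k, rfl⟩ : ∃ l, k = l + 1 := ⟨k - 1, by omega⟩
      have e := h1 k (by omega) _ rfl
      have ea := (hk1 (k + 1) (by omega)).symm
      have eb : P (y0 + (k + 1 : ℕ) - 1) = D.eval (y0 + (k : ℕ)) • G k := by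
        rw [show y0 + (k + 1 : ℕ) - 1 = y0 + (k : ℕ) by push_cast; ring]
        exact (hk1 k (by omega)).symm
      simp only [LinearMap.mulLeft_apply, LinearMap.mulRight_apply]
      rw [← e, ea, eb, show y0 + (k + 1 : ℕ) - 1 = y0 + (k : ℕ) by push_cast; ring]
      simp only [mul_smul_comm, smul_mul_assoc]
      module
  have pid2 : ∀ x, ((D.eval (x - 2) * ((x + 2) * (x + 1) * x)) • P x
      - (D.eval (x - 2) * (3 * (x + 2))) • (K * P x) + D.eval (x - 2) • (H * P x))
      - ((D.eval x * (x * (x - 1) * (x - 2))) • P (x - 2)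
      - (D.eval x * (3 * x)) • (P (x - 2) * K) + D.eval x • (P (x - 2) * H))
      = (D.eval x * D.eval (x - 2) * x) • (4 : ℂ) • 1 := by
    intro x
    rw [← sub_eq_zero]
    have hP' := hP.shift (-2)
    simp only [← sub_eq_add_neg] at hP'
    refine IsPolyMap.eq_zero (y0 := y0) (k1 := max (k0 + 2) (k1 + 2)) (f := fun x =>
      ((D.eval (x - 2) * ((x + 2) * (x + 1) * x)) • P x
      - (D.eval (x - 2) * (3 * (x + 2))) • (LinearMap.mulLeft ℂ K (P x))
      + D.eval (x - 2) • (LinearMap.mulLeft ℂ H (P x)))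
      - ((D.eval x * (x * (x - 1) * (x - 2))) • P (x - 2)
      - (D.eval x * (3 * x)) • (LinearMap.mulRight ℂ K (P (x - 2)))
      + D.eval x • (LinearMap.mulRight ℂ H (P (x - 2))))
      - (D.eval x * D.eval (x - 2) * x) • (4 : ℂ) • 1) ?_ ?_ x
    · refine ((((hP.smul (D.comp (X - 2) * ((X + 2) * (X + 1) * X)) ?_).sub
        ((hP.map _).smul (D.comp (X - 2) * (3 * (X + 2))) ?_)).add
        ((hP.map _).smul (D.comp (X - 2)) ?_)).sub
        (((hP'.smul (D * (X * (X - 1) * (X - 2))) ?_).sub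
        ((hP'.map _).smul (D * (3 * X)) ?_)).add ((hP'.map _).smul D ?_))).sub
        ((IsPolyMap.const _).smul (D * D.comp (X - 2) * X) ?_) <;>
        intro x <;> simp
    · intro k hk
      obtain ⟨k, rfl⟩ : ∃ l, k = l + 2 := ⟨k - 2, by omega⟩
      have e := h2 k (by omega) _ rfl
      have ea := (hk1 (k + 2) (by omega)).symm
      have eb : P (y0 + (k + 2 : ℕ) - 2) = D.eval (y0 + (k : ℕ)) • G k := by
        rw [show y0 + (k + 2 : ℕ) - 2 = y0 + (k : ℕ) by push_cast; ring]
        exact (hk1 k (by omega)).symm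
      simp only [LinearMap.mulLeft_apply, LinearMap.mulRight_apply]
      rw [mul_smul _ (y0 + (k + 2 : ℕ)), ← e, ea, eb,
        show y0 + (k + 2 : ℕ) - 2 = y0 + (k : ℕ) by push_cast; ring]
      simp only [mul_smul_comm, smul_mul_assoc]
      module
  have hnc : ∃ ζ, D.IsRoot ζ := by
    apply IsAlgClosed.exists_root
    intro hdeg
    obtain ⟨d, hd, rfl⟩ : ∃ d : ℂ, d ≠ 0 ∧ D = C d := by
      rw [eq_C_of_degree_eq_zero hdeg] at hD ⊢
      exact ⟨_, fun h => hD (by rw [h, C_0]), rfl⟩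
    refine polynomial_solution_false K P hP (d * 3) (by simpa using hd) fun x => ?_
    have := pid1 x
    simp only [eval_C] at this
    apply smul_right_injective _ hd
    simp only
    rw [show d • (d * 3) • (1 : Module.End ℂ E) = (d * d) • (3 : ℂ) • 1 by module, ← this]
    module
  obtain ⟨ζ, hζ, hmin⟩ := Finset.exists_min_image D.roots.toFinset Complex.re (by
    obtain ⟨ζ, hζ⟩ := hnc
    exact ⟨ζ, by simpa [hD] using hζ⟩)
  have hζ' : D.IsRoot ζ := by simpa [hD] using hζ
  have hne : ∀ m : ℂ, 0 < m.re → D.eval (ζ - m) ≠ 0 := by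
    intro m hm h0
    have := hmin (ζ - m) (by simpa [hD] using h0)
    rw [Complex.sub_re] at this
    linarith
  have q1 := pid1 ζ
  have q2 := pid2 ζ
  rw [hζ'.eq_zero] at q1 q2
  obtain ⟨e, he⟩ : ∃ e, P ζ e ≠ 0 := by
    by_contra h; push Not at h
    exact hroot ζ hζ' (LinearMap.ext h)
  have n1 := hne 1 (by simp)
  have n2 := hne 2 (by simp)
  have k1 : K (P ζ e) = ((ζ + 2) * (ζ + 1)) • P ζ e := by
    have := LinearMap.congr_fun q1 e
    simp only [LinearMap.sub_apply, LinearMap.smul_apply, Module.End.mul_apply, zero_mul,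
      zero_smul, sub_zero, LinearMap.zero_apply, mul_smul] at this
    rw [← smul_sub] at this
    have := (smul_eq_zero.1 this).resolve_left n1
    rw [mul_smul]
    exact (sub_eq_zero.1 this).symm
  have k2 : H (P ζ e) = (3 * (ζ + 2) * ((ζ + 2) * (ζ + 1)) - (ζ + 2) * (ζ + 1) * ζ) • P ζ e := by
    have := LinearMap.congr_fun q2 e
    simp only [LinearMap.sub_apply, LinearMap.add_apply, LinearMap.smul_apply,
      Module.End.mul_apply, zero_mul, add_zero,
      zero_smul, sub_zero, LinearMap.zero_apply, k1] at this
    rw [show (eval (ζ - 2) D * ((ζ + 2) * (ζ + 1) * ζ)) • (P ζ) e -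
        (eval (ζ - 2) D * (3 * (ζ + 2))) • ((ζ + 2) * (ζ + 1)) • (P ζ) e +
        eval (ζ - 2) D • H ((P ζ) e) = eval (ζ - 2) D • (H (P ζ e) -
        (3 * (ζ + 2) * ((ζ + 2) * (ζ + 1)) - (ζ + 2) * (ζ + 1) * ζ) • P ζ e) by module] at this
    exact sub_eq_zero.1 ((smul_eq_zero.1 this).resolve_left n2)
  exact ⟨-1 - ζ, P ζ e, he, by rw [k1]; congr 1; ring, by rw [k2]; congr 1; ring⟩

end annihilation

section germ

open Polynomial

lemma exists_eval_natCast_ne_zero {p : ℂ[X]} (hp : p ≠ 0) :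
    ∃ k1 : ℕ, ∀ k ≥ k1, p.eval (k : ℂ) ≠ 0 := by
  have hfin : {k : ℕ | p.eval (k : ℂ) = 0}.Finite := by
    refine Set.Finite.of_finite_image (f := fun k : ℕ => (k : ℂ)) ?_ Nat.cast_injective.injOn
    refine (p.roots.toFinset.finite_toSet).subset ?_
    rintro _ ⟨k, hk, rfl⟩
    simpa [hp] using hk
  obtain ⟨m, hm⟩ := hfin.bddAbove
  refine ⟨m + 1, fun k hk h0 => ?_⟩
  have := hm h0
  omega

lemma funext_of_eventually {p q : ℂ[X]} {k1 : ℕ} (h : ∀ k ≥ k1, p.eval (k : ℂ) = q.eval (k : ℂ)) :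
    p = q := by
  rw [← sub_eq_zero]
  refine eval_eq_zero_of_eventually (y0 := 0) (k1 := k1) fun k hk => ?_
  rw [zero_add, eval_sub, h k hk, sub_self]

lemma germ_rational (b c : ℂ) (d : ℕ → ℂ) (s1 : ℕ)
    (h : ∀ r ≥ s1, ∀ s ≥ s1, ((s : ℂ) - r) * d (r + s) =
      (c + s + b * r) * d s - (c + r + b * s) * d r) (hcb : c ≠ 0 ∨ b ≠ -1) :
    ∃ D : ℂ[X], D ≠ 0 ∧ ∃ U : ℂ[X], ∃ k1 : ℕ, ∀ k ≥ k1, D.eval (k : ℂ) * d k = U.eval (k : ℂ) := by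
  obtain ⟨r, hr, hr1⟩ : ∃ r : ℕ, r ≥ s1 ∧ 1 ≤ r := ⟨s1 + 1, by omega, by omega⟩
  set D : ℂ[X] := (X - C (r : ℂ) - C (r : ℂ)) * (C c + X + C (r : ℂ) + C b * C (r : ℂ))
    * (C c + X + C b * C (r : ℂ)) - X * (X - C (r : ℂ)) * (C c + X + C b * C ((r : ℂ) + r)) with hD
  refine ⟨D, ?_, (X - C (r : ℂ) - C (r : ℂ)) * (C c + X + C (r : ℂ) + C b * C (r : ℂ))
    * ((C c + C (r : ℂ) + C b * X) * C (d r)) + (X - C (r : ℂ) - C (r : ℂ)) * (X - C (r : ℂ))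
    * ((C c + C (r : ℂ) + C b * (X + C (r : ℂ))) * C (d r))
    - X * (X - C (r : ℂ)) * ((C c + C ((r : ℂ) + r) + C b * X) * C (d (r + r))), s1, ?_⟩
  · intro h0
    have hr0 : (r : ℂ) ≠ 0 := by exact_mod_cast (by omega : r ≠ 0)
    have e := fun x : ℂ => congrArg (eval x) h0
    simp only [hD, eval_sub, eval_add, eval_mul, eval_X, eval_C, eval_zero] at e
    have e0 := e 0
    have e1 := e 1
    have e2 := e (-1)
    have hc : c = 0 := by linear_combination (1/2) * e1 + (1/2) * e2 - e0
    subst hc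
    have hb : (b + 1) ≠ 0 := fun hb => by
      rcases hcb with h | h
      · exact h rfl
      · exact h (by linear_combination hb)
    have e3 : (r : ℂ) * r * (b + 1) * (b - 2) = 0 := by linear_combination (1/2) * e1 - (1/2) * e2
    have hb2 : b = 2 := by
      have : (r : ℂ) * r * (b + 1) ≠ 0 := by positivity
      linear_combination (mul_eq_zero.1 e3).resolve_left this
    subst hb2
    have : (r : ℂ) ^ 3 = 0 := by linear_combination (-1/12) * e0
    exact hr0 (by simpa using this)
  · intro s hs
    have a1 := h r hr s hs
    have a2 := h r hr (r + s) (by omega)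
    have a3 := h (r + r) (by omega) s hs
    rw [show r + (r + s) = r + r + s by ring] at a2
    push_cast at a1 a2 a3
    simp only [hD, eval_sub, eval_add, eval_mul, eval_X, eval_C]
    linear_combination (-((s:ℂ) - r - r) * (c + s + r + b * r)) * a1
      - (((s:ℂ) - r - r) * (s - r)) * a2 + ((s:ℂ) * (s - r)) * a3

lemma germ_polynomial (b c : ℂ) (d : ℕ → ℂ) (s1 : ℕ)
    (h : ∀ r ≥ s1, ∀ s ≥ s1, ((s : ℂ) - r) * d (r + s) =
      (c + s + b * r) * d s - (c + r + b * s) * d r) :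
    ∃ P : ℂ[X], ∃ k1 : ℕ, ∀ k ≥ k1, d k = P.eval (k : ℂ) := by
  by_cases hcb : c ≠ 0 ∨ b ≠ -1
  · obtain ⟨D₀, hD₀, U, k2, hU⟩ := germ_rational b c d s1 h hcb
    obtain ⟨D, hD, P, hP, ⟨k1, hk1⟩, hroot⟩ := exists_reduced_fraction 0 d D₀ hD₀ fun θ =>
      ⟨C (θ 1) * U, k2, fun k hk => by
        have : θ (d k) = d k * θ 1 := by
          conv_lhs => rw [← mul_one (d k), ← smul_eq_mul, map_smul]
          rfl
        rw [zero_add, eval_mul, ← hU k hk, this, eval_C]; ring⟩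
    obtain ⟨p, hp⟩ := hP LinearMap.id
    simp only [LinearMap.id_apply, zero_add, smul_eq_mul] at hp hk1
    by_cases hdeg : D.degree = 0
    · obtain ⟨q, hq, rfl⟩ : ∃ q : ℂ, q ≠ 0 ∧ D = C q := by
        rw [eq_C_of_degree_eq_zero hdeg] at hD ⊢
        exact ⟨_, fun h => hD (by rw [h, C_0]), rfl⟩
      refine ⟨C q⁻¹ * p, k1, fun k hk => ?_⟩
      rw [eval_mul, ← hp, ← hk1 k hk, eval_C, eval_C]
      field_simp
    · exfalso
      obtain ⟨ζ, hζ⟩ := IsAlgClosed.exists_root D hdeg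
      apply hroot ζ hζ
      obtain ⟨k3, hk3⟩ := exists_eval_natCast_ne_zero hD
      obtain ⟨k4, hk4⟩ := exists_eval_natCast_ne_zero (p := D.comp (C ζ - X)) (by
        intro h0
        apply hD
        have : D = (D.comp (C ζ - X)).comp (C ζ - X) := by
          rw [comp_assoc]; simp
        rw [this, h0, zero_comp])
      obtain ⟨k5, hk5⟩ := exists_eval_natCast_ne_zero (p := C ζ - 2 * X) (by
        intro h0
        have e1 := congrArg (eval 0) h0
        have e2 := congrArg (eval 1) h0
        simp at e1 e2
        rw [e1] at e2; simp at e2)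
      obtain ⟨r, hr⟩ : ∃ r, r = s1 + k1 + k3 + k4 + k5 := ⟨_, rfl⟩
      have key : (X - C (r : ℂ)) * p.comp (X + C (r : ℂ)) * D =
          (C c + X + C b * C (r : ℂ)) * p * D.comp (X + C (r : ℂ)) -
          (C c + C (r : ℂ) + C b * X) * C (d r) * D * D.comp (X + C (r : ℂ)) := by
        apply funext_of_eventually (k1 := r)
        intro s hs
        have e := h r (by omega) s (by omega)
        have f1 := hk1 s (by omega)
        have f2 := hk1 (r + s) (by omega)
        rw [hp] at f1 f2
        push_cast at f2
        simp only [eval_sub, eval_add, eval_mul, eval_X, eval_C, eval_comp]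
        rw [add_comm (s : ℂ) r, ← f1, ← f2]
        linear_combination (eval (s : ℂ) D * eval ((r : ℂ) + s) D) * e
      have := congrArg (eval (ζ - r)) key
      simp only [eval_sub, eval_add, eval_mul, eval_X, eval_C, eval_comp, sub_add_cancel,
        hζ.eq_zero, mul_zero, sub_zero] at this
      have n1 := hk4 r (by omega)
      have n2 := hk5 r (by omega)
      simp only [eval_comp, eval_sub, eval_C, eval_X, eval_mul, eval_ofNat] at n1 n2
      rw [hp]
      refine (mul_eq_zero.1 ((mul_eq_zero.1 this).resolve_right n1)).resolve_left ?_
      intro h0; exact n2 (by linear_combination h0)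
  · push Not at hcb
    obtain ⟨rfl, rfl⟩ := hcb
    have hadd : ∀ r ≥ s1, ∀ s ≥ s1, r ≠ s → d (r + s) = d r + d s := by
      intro r hr s hs hrs
      have : ((s : ℂ) - r) ≠ 0 := sub_ne_zero.2 (by exact_mod_cast hrs.symm)
      apply mul_left_cancel₀ this
      rw [h r hr s hs]; ring
    set m := s1 + 2 with hm
    have hstep : ∀ s ≥ m, d (s + 1) - d s = d (s1 + 1) - d s1 := by
      intro s hs
      have a1 := hadd s1 le_rfl (s + 1) (by omega) (by omega)
      have a2 := hadd (s1 + 1) (by omega) s (by omega) (by omega)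
      rw [show s1 + 1 + s = s1 + (s + 1) by ring] at a2
      linear_combination a2 - a1
    refine ⟨C (d m) + C (d (s1 + 1) - d s1) * (X - C (m : ℂ)), m, fun k hk => ?_⟩
    induction k, hk using Nat.le_induction with
    | base => simp
    | succ k hk ih =>
      have := hstep k hk
      simp only [eval_add, eval_mul, eval_sub, eval_X, eval_C] at ih ⊢
      push_cast
      linear_combination this + ih

lemma germ_degree (b c : ℂ) (P : ℂ[X]) (s1 : ℕ)
    (h : ∀ r ≥ s1, ∀ s ≥ s1, ((s : ℂ) - r) * P.eval ((r : ℂ) + s) =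
      (c + s + b * r) * P.eval (s : ℂ) - (c + r + b * s) * P.eval (r : ℂ)) :
    P.natDegree ≤ 5 := by
  have h1 : ∀ r ≥ s1, ∀ s : ℂ, (s - r) * P.eval (s + r) =
      (c + s + b * r) * P.eval s - (c + r + b * s) * P.eval (r : ℂ) := by
    intro r hr s
    have : (X - C (r : ℂ)) * P.comp (X + C (r : ℂ)) = (C c + X + C b * C (r : ℂ)) * P
        - (C c + C (r : ℂ) + C b * X) * C (P.eval (r : ℂ)) := by
      apply funext_of_eventually (k1 := s1)
      intro s hs
      have := h r hr s hs
      simp only [eval_sub, eval_add, eval_mul, eval_X, eval_C, eval_comp]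
      rw [add_comm (s : ℂ) r]; exact this
    have := congrArg (eval s) this
    simpa only [eval_sub, eval_add, eval_mul, eval_X, eval_C, eval_comp] using this
  have h2 : ∀ r s : ℂ, (s - r) * P.eval (s + r) =
      (c + s + b * r) * P.eval s - (c + r + b * s) * P.eval r := by
    intro r s
    have : (C s - X) * P.comp (C s + X) = (C c + C s + C b * X) * C (P.eval s)
        - (C c + X + C b * C s) * P := by
      apply funext_of_eventually (k1 := s1)
      intro r hr
      have := h1 r hr s
      simpa only [eval_sub, eval_add, eval_mul, eval_X, eval_C, eval_comp] using this
    have := congrArg (eval r) this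
    simpa only [eval_sub, eval_add, eval_mul, eval_X, eval_C, eval_comp] using this
  by_cases hc : c = 0
  · subst hc
    by_contra! hk
    set k := P.natDegree with hkdef
    have hlam : ∀ t : ℂ, (1 - t) * (1 + t) ^ k = (1 + b * t) - (t + b) * t ^ k := by
      intro t
      have : C (1 - t) * (X * P.comp (C (1 + t) * X)) =
          C (1 + b * t) * (X * P) - C (t + b) * (X * P.comp (C t * X)) := by
        apply Polynomial.funext
        intro x
        have := h2 (t * x) x
        simp only [eval_sub, eval_mul, eval_X, eval_C, eval_comp]
        rw [show (1 + t) * x = x + t * x by ring]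
        linear_combination this
      have := congrArg (fun p => coeff p (k + 1)) this
      simp only [coeff_sub, coeff_C_mul, coeff_X_mul, comp_C_mul_X_coeff] at this
      have hP : P.coeff k ≠ 0 := by
        rw [hkdef, coeff_natDegree, leadingCoeff_ne_zero]
        intro h0; rw [h0, natDegree_zero] at hkdef; omega
      apply mul_right_cancel₀ hP
      linear_combination this
    have l2 := hlam 2
    have l3 := hlam 3
    have e : (9 : ℂ) ^ k + 6 ^ k + 4 * 4 ^ k + 5 * 2 ^ k = 2 * 8 ^ k + 8 * 3 ^ k + 1 := by
      have p9 : (9 : ℂ) ^ k = 3 ^ k * 3 ^ k := by rw [← mul_pow]; norm_num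
      have p8 : (8 : ℂ) ^ k = 2 ^ k * 4 ^ k := by rw [← mul_pow]; norm_num
      have p6 : (6 : ℂ) ^ k = 2 ^ k * 3 ^ k := by rw [← mul_pow]; norm_num
      have p4 : (4 : ℂ) ^ k = 2 ^ k * 2 ^ k := by rw [← mul_pow]; norm_num
      norm_num at l2 l3
      rw [p9, p8, p6]
      rw [p4] at l3 ⊢
      linear_combination (3 - (3 : ℂ) ^ k) * l2 + ((2 : ℂ) ^ k - 2) * l3
    have e' : 9 ^ k + 6 ^ k + 4 * 4 ^ k + 5 * 2 ^ k = 2 * 8 ^ k + 8 * 3 ^ k + 1 := by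
      exact_mod_cast e
    have i1 : 2 * 8 ^ k ≤ 9 ^ k := by
      clear_value k
      clear hkdef hlam l2 l3 e e'
      induction k, hk using Nat.le_induction with
      | base => norm_num
      | succ k hk ih => rw [pow_succ, pow_succ]; omega
    have i2 : 8 * 3 ^ k ≤ 6 ^ k := by
      rw [show 6 = 2 * 3 by norm_num, mul_pow]
      gcongr
      calc 8 = 2 ^ 3 := by norm_num
        _ ≤ 2 ^ k := Nat.pow_le_pow_right (by norm_num) (by omega)
    have i3 : 1 ≤ 4 ^ k := Nat.one_le_pow _ _ (by norm_num)
    omega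
  · have : P = C (P.eval 0) + C (b / c * P.eval 0) * X := by
      apply Polynomial.funext
      intro s
      have := h2 0 s
      simp only [eval_add, eval_mul, eval_X, eval_C]
      simp only [add_zero, sub_zero, mul_zero] at this
      field_simp
      linear_combination -this
    rw [this, add_comm]
    exact natDegree_linear_le.trans (by norm_num)

end germ

section chain

variable {V : Type} [AddCommGroup V] [Module ℂ V]

/-- The operators `L s`, `s ∈ ℤ`, satisfy the commutation relations of the Witt algebra, and the
eigenspaces of `L 0` have dimension at most `N`. -/
structure IsCuspidalWitt (L : ℤ → Module.End ℂ V) (N : ℕ) : Prop where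
  comm : ∀ (r s : ℤ) (v : V), L r (L s v) - L s (L r v) = ((s : ℂ) - r) • L (r + s) v
  fin : ∀ x, Module.Finite ℂ (Module.End.eigenspace (L 0) x)
  le : ∀ x, Module.finrank ℂ (Module.End.eigenspace (L 0) x) ≤ N

variable {L : ℤ → Module.End ℂ V} {N : ℕ}

lemma IsCuspidalWitt.weight (h : IsCuspidalWitt L N) {x : ℂ} {v : V} (hv : L 0 v = x • v) (s : ℤ) :
    L 0 (L s v) = (x + s) • L s v := by
  have := h.comm 0 s v
  rw [hv, map_smul, zero_add, Int.cast_zero, sub_zero] at this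
  rw [add_smul, ← this]; abel

lemma IsCuspidalWitt.lower (h : IsCuspidalWitt L N) {x : ℂ} {w : V} (hw0 : w ≠ 0)
    (hw : L 0 w = x • w) (hw1 : L 1 w = 0) (m : ℕ) (hm : m < 2 * x.re) : ∃ u : V, u ≠ 0 ∧
    L 0 u = (x - m) • u ∧ L (-1) (L 1 u) = ((x - m) ^ 2 + (x - m) - (x ^ 2 + x)) • u := by
  induction m with
  | zero => exact ⟨w, hw0, by simpa using hw, by simp [hw1]⟩
  | succ m ih =>
    push_cast at hm
    obtain ⟨u, hu0, hu, hu1⟩ := ih (by linarith)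
    have c := h.comm 1 (-1) u
    rw [hu1, show (1 : ℤ) + -1 = 0 by norm_num, hu] at c
    have c2 : L 1 (L (-1) u) = ((x - m) ^ 2 - (x - m) - (x ^ 2 + x)) • u := by
      rw [sub_eq_iff_eq_add.1 c]; push_cast; module
    refine ⟨L (-1) u, fun h0 => ?_, ?_, ?_⟩
    · rw [h0, map_zero] at c2
      have := (smul_eq_zero.1 c2.symm).resolve_right hu0
      have e : (2 * x - m) * (m + 1) = 0 := by linear_combination -this
      rcases mul_eq_zero.1 e with e | e
      · have := congrArg Complex.re e
        simp at this
        linarith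
      · exact absurd e (by exact_mod_cast (by omega : m + 1 ≠ 0))
    · rw [h.weight hu]; push_cast; congr 1; ring
    · rw [c2, map_smul]; push_cast; congr 1; ring

lemma IsCuspidalWitt.eventually_injective (h : IsCuspidalWitt L N) (x0 : ℂ) :
    ∃ K : ℕ, ∀ k ≥ K, ∀ v, L 0 v = (x0 + (k : ℕ)) • v → L 1 v = 0 → v = 0 := by
  by_contra! hbad
  obtain ⟨K0, hK0⟩ := exists_nat_gt (-x0.re)
  have hinf : {k : ℕ | K0 ≤ k ∧ ∃ v, L 0 v = (x0 + (k : ℕ)) • v ∧ L 1 v = 0 ∧ v ≠ 0}.Infinite := by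
    rw [← Nat.frequently_atTop_iff_infinite, Filter.frequently_atTop]
    intro a
    obtain ⟨k, hk, v, hv⟩ := hbad (max a K0)
    exact ⟨k, le_of_max_le_left hk, le_of_max_le_right hk, v, hv⟩
  let f := hinf.natEmbedding
  have hf := fun i : Fin (N + 1) => (f i).2
  choose hfK w hw hw1 hw0 using hf
  have hu : ∀ i : Fin (N + 1), ∃ u : V, u ≠ 0 ∧ L 0 u = (x0 + K0) • u ∧ (L (-1) * L 1) u =
      ((x0 + K0) ^ 2 + (x0 + K0) - ((x0 + ((f i : ℕ) : ℂ)) ^ 2 + (x0 + ((f i : ℕ) : ℂ)))) • u := by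
    intro i
    have hle : (K0 : ℝ) ≤ ((f i : ℕ) : ℝ) := by exact_mod_cast hfK i
    have := h.lower (hw0 i) (hw i) (hw1 i) ((f i : ℕ) - K0) (by
      rw [Nat.cast_sub (hfK i)]; simp; linarith)
    rwa [show x0 + ((f i : ℕ) : ℂ) - ((((f i : ℕ) - K0 : ℕ)) : ℂ) = x0 + K0 by
      rw [Nat.cast_sub (hfK i)]; ring] at this
  choose u hu0 hu1 hu2 using hu
  have hli : LinearIndependent ℂ u := by
    refine Module.End.eigenvectors_linearIndependent' (L (-1) * L 1) _ ?_ u fun i =>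
      ⟨Module.End.mem_eigenspace_iff.2 (hu2 i), hu0 i⟩
    intro i j hij
    have e : (((f i : ℕ) : ℂ) - ((f j : ℕ) : ℂ)) * (2 * x0 + (f i : ℕ) + (f j : ℕ) + 1) = 0 := by
      simp only at hij
      linear_combination -hij
    rcases mul_eq_zero.1 e with e | e
    · have : (f i : ℕ) = f j := by exact_mod_cast sub_eq_zero.1 e
      exact Fin.ext (f.injective (Subtype.ext this))
    · exfalso
      have e' := congrArg Complex.re e
      simp at e'
      have h1 : (K0 : ℝ) ≤ ((f i : ℕ) : ℝ) := by exact_mod_cast hfK i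
      have h2 : (K0 : ℝ) ≤ ((f j : ℕ) : ℝ) := by exact_mod_cast hfK j
      linarith
  have := h.fin (x0 + K0)
  let u' : Fin (N + 1) → Module.End.eigenspace (L 0) (x0 + K0) :=
    fun i => ⟨u i, Module.End.mem_eigenspace_iff.2 (hu1 i)⟩
  have hli' : LinearIndependent ℂ u' :=
    LinearIndependent.of_comp (Submodule.subtype _) hli
  have := hli'.fintype_card_le_finrank
  have := h.le (x0 + K0)
  simp at *
  omega

lemma IsCuspidalWitt.eventually_bijective (h : IsCuspidalWitt L N) (x0 : ℂ) :
    ∃ K : ℕ, ∀ k ≥ K, (∀ v, L 0 v = (x0 + (k : ℕ)) • v → L 1 v = 0 → v = 0) ∧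
      ∀ w, L 0 w = (x0 + (k + 1 : ℕ)) • w → ∃ v, L 0 v = (x0 + (k : ℕ)) • v ∧ L 1 v = w := by
  obtain ⟨K, hK⟩ := h.eventually_injective x0
  let Vk : ℕ → Submodule ℂ V := fun k => Module.End.eigenspace (L 0) (x0 + (k : ℕ))
  have : ∀ k, Module.Finite ℂ (Vk k) := fun k => h.fin _
  have hmem : ∀ k v, v ∈ Vk k ↔ L 0 v = (x0 + (k : ℕ)) • v := fun k v =>
    Module.End.mem_eigenspace_iff
  have hmap : ∀ k, (Vk k).map (L 1) ≤ Vk (k + 1) := by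
    rintro k _ ⟨v, hv, rfl⟩
    rw [hmem, h.weight ((hmem k v).1 hv)]
    push_cast; congr 1; ring
  have hrk : ∀ k ≥ K, Module.finrank ℂ ((Vk k).map (L 1)) = Module.finrank ℂ (Vk k) := by
    intro k hk
    have hinj : Function.Injective ((L 1).domRestrict (Vk k)) := by
      rw [← LinearMap.ker_eq_bot, LinearMap.ker_eq_bot']
      intro v hv
      exact Subtype.ext (hK k hk v ((hmem _ _).1 v.2) hv)
    rw [← LinearMap.finrank_range_of_inj hinj, LinearMap.range_domRestrict]
  have hmono : ∀ k ≥ K, Module.finrank ℂ (Vk k) ≤ Module.finrank ℂ (Vk (k + 1)) := by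
    intro k hk
    rw [← hrk k hk]
    exact Submodule.finrank_mono (hmap k)
  have hex : ∃ m, ∃ k ≥ K, N - Module.finrank ℂ (Vk k) = m := ⟨_, K, le_rfl, rfl⟩
  classical
  obtain ⟨k1, hk1, hm⟩ := Nat.find_spec hex
  have hmax : ∀ k ≥ K, Module.finrank ℂ (Vk k) ≤ Module.finrank ℂ (Vk k1) := by
    intro k hk
    have h1 := Nat.find_min' hex ⟨k, hk, rfl⟩
    have h2 : Module.finrank ℂ (Vk k) ≤ N := h.le _
    have h3 : Module.finrank ℂ (Vk k1) ≤ N := h.le _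
    omega
  have hge : ∀ k ≥ k1, Module.finrank ℂ (Vk k1) ≤ Module.finrank ℂ (Vk k) := by
    intro k hk
    induction k, hk using Nat.le_induction with
    | base => rfl
    | succ k hk ih => exact ih.trans (hmono k (by omega))
  refine ⟨k1, fun k hk => ⟨hK k (by omega), fun w hw => ?_⟩⟩
  have heq : (Vk k).map (L 1) = Vk (k + 1) := by
    apply Submodule.eq_of_le_of_finrank_eq (hmap k)
    rw [hrk k (by omega)]
    exact le_antisymm (hmono k (by omega)) ((hmax (k + 1) (by omega)).trans (hge k hk))
  obtain ⟨v, hv, rfl⟩ : w ∈ (Vk k).map (L 1) := by rw [heq, hmem]; exact hw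
  exact ⟨v, (hmem k v).1 hv, rfl⟩

/-- A parametrisation, by a fixed space `E`, of the eigenspaces `y0 + k`, `k ∈ ℕ`, of `L 0`,
together with the matrices of the operators `L s` in this parametrisation. -/
structure WittChain (L : ℤ → Module.End ℂ V) (y0 : ℂ) (E : Type) [AddCommGroup E]
    [Module ℂ E] where
  τ : ℕ → E →ₗ[ℂ] V
  T : ℕ → ℕ → Module.End ℂ E
  inj : ∀ k, Function.Injective (τ k)
  zero : ∀ k v, L 0 (τ k v) = (y0 + (k : ℕ)) • τ k v
  one : ∀ k v, L 1 (τ k v) = τ (k + 1) v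
  act : ∀ (l k : ℕ) v, L ((l : ℤ) - k) (τ k v) = τ l (T l k v)
  surj : ∀ k w, L 0 w = (y0 + (k : ℕ)) • w → ∃ c, τ k c = w

lemma IsCuspidalWitt.exists_chain (h : IsCuspidalWitt L N) (x0 : ℂ) :
    ∃ (K : ℕ) (E : Type) (_ : AddCommGroup E) (_ : Module ℂ E), Module.Finite ℂ E ∧
      Module.finrank ℂ E ≤ N ∧ Nonempty (WittChain L (x0 + K) E) := by
  obtain ⟨K, hK⟩ := h.eventually_bijective x0
  let τ : ℕ → Module.End.eigenspace (L 0) (x0 + (K : ℕ)) →ₗ[ℂ] V := fun k =>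
    (L 1 ^ k).comp (Submodule.subtype _)
  have one : ∀ k v, L 1 (τ k v) = τ (k + 1) v := by
    intro k v
    simp only [τ, LinearMap.comp_apply, pow_succ', Module.End.mul_apply]
  have zero : ∀ k v, L 0 (τ k v) = (x0 + K + (k : ℕ)) • τ k v := by
    intro k v
    induction k with
    | zero =>
      simp only [τ, pow_zero, LinearMap.comp_apply, Module.End.one_apply, Submodule.subtype_apply,
        Nat.cast_zero, add_zero]
      exact Module.End.mem_eigenspace_iff.1 v.2
    | succ k ih =>
      rw [← one, h.weight ih]; push_cast; congr 1; ring
  have inj : ∀ k, Function.Injective (τ k) := by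
    intro k
    rw [← LinearMap.ker_eq_bot, LinearMap.ker_eq_bot']
    intro v hv
    induction k with
    | zero => exact Subtype.ext hv
    | succ k ih =>
      apply ih
      rw [← one] at hv
      refine (hK (K + k) (by omega)).1 _ ?_ hv
      rw [zero]; push_cast; congr 1; ring
  have surj : ∀ k w, L 0 w = (x0 + K + (k : ℕ)) • w → ∃ c, τ k c = w := by
    intro k
    induction k with
    | zero =>
      intro w hw
      exact ⟨⟨w, Module.End.mem_eigenspace_iff.2 (by simpa using hw)⟩, rfl⟩
    | succ k ih =>
      intro w hw
      obtain ⟨v, hv, rfl⟩ := (hK (K + k) (by omega)).2 w (by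
        rw [hw]; push_cast; congr 1; ring)
      obtain ⟨c, rfl⟩ := ih v (by rw [hv]; push_cast; congr 1; ring)
      exact ⟨c, (one k c).symm⟩
  choose g hg using fun l => LinearMap.exists_leftInverse_of_injective (τ l)
    (LinearMap.ker_eq_bot.2 (inj l))
  refine ⟨K, _, inferInstance, inferInstance, h.fin _, h.le _, ⟨⟨τ, fun l k =>
    (g l).comp ((L ((l : ℤ) - k)).comp (τ k)), inj, zero, one, fun l k v => ?_, surj⟩⟩⟩
  obtain ⟨c, hc⟩ := surj l (L ((l : ℤ) - k) (τ k v)) (by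
    rw [h.weight (zero k v)]; push_cast; congr 1; ring)
  simp only [LinearMap.comp_apply]
  rw [← hc]
  exact congrArg (τ l) (LinearMap.congr_fun (hg l) c).symm

end chain

section chainRelations

variable {V : Type} [AddCommGroup V] [Module ℂ V] {L : ℤ → Module.End ℂ V} {N : ℕ} {y0 : ℂ}
  {E : Type} [AddCommGroup E] [Module ℂ E]

lemma WittChain.T_comm (h : IsCuspidalWitt L N) (W : WittChain L y0 E) (k l l' m : ℕ)
    (e : l + l' = k + m) (v : E) : W.T m l (W.T l k v) - W.T m l' (W.T l' k v) =
      (((l : ℂ) - k) - (m - l)) • W.T m k v := by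
  apply W.inj m
  have c := h.comm ((m : ℤ) - l) ((l : ℤ) - k) (W.τ k v)
  rw [W.act, W.act, show (m : ℤ) - l + (l - k) = m - k by ring, W.act,
    show (m : ℤ) - l = l' - k by omega, W.act,
    show (l : ℤ) - k = m - l' by omega, W.act] at c
  rw [map_sub, map_smul, c]
  congr 1
  have e' : (l : ℂ) + l' = k + m := by exact_mod_cast e
  push_cast
  linear_combination (-2 : ℂ) * e'

lemma WittChain.T_self (W : WittChain L y0 E) (k : ℕ) (v : E) :
    W.T k k v = (y0 + (k : ℕ)) • v := by
  apply W.inj k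
  rw [← W.act, sub_self, W.zero, map_smul]

lemma WittChain.T_succ (W : WittChain L y0 E) (k : ℕ) (v : E) : W.T (k + 1) k v = v := by
  apply W.inj (k + 1)
  rw [← W.act, ← W.one]
  congr 2
  push_cast; ring

lemma WittChain.exists_casimir (h : IsCuspidalWitt L N) (W : WittChain L y0 E) :
    ∃ K H : Module.End ℂ E,
      (∀ (k : ℕ) (x : ℂ), x = y0 + (k + 1 : ℕ) → W.T k (k + 1) = (x * (x - 1)) • 1 - K) ∧
      (∀ (k : ℕ) (x : ℂ), x = y0 + (k + 2 : ℕ) →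
        W.T k (k + 2) = (x * (x - 1) * (x - 2)) • 1 - (3 * x) • K + H) := by
  have h1 : ∀ (k : ℕ) (x : ℂ), x = y0 + (k + 1 : ℕ) →
      W.T k (k + 1) = (x * (x - 1)) • 1 - (((y0 + 1) * y0) • 1 - W.T 0 1) := by
    intro k
    induction k with
    | zero =>
      rintro x rfl
      simp
    | succ k ih =>
      intro x hx
      have ih := ih (x - 1) (by rw [hx]; push_cast; ring)
      ext v
      have c := W.T_comm h (k + 1) (k + 2) k (k + 1) (by ring) v
      rw [W.T_succ k, W.T_succ (k + 1), W.T_self, ih] at c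
      rw [sub_eq_iff_eq_add.1 c, hx]
      simp only [LinearMap.sub_apply, LinearMap.smul_apply, Module.End.one_apply]
      push_cast
      module
  refine ⟨((y0 + 1) * y0) • 1 - W.T 0 1, W.T 0 2 - (((y0 + 2) * (y0 + 1) * y0) • 1 -
    (3 * (y0 + 2)) • (((y0 + 1) * y0) • 1 - W.T 0 1)), h1, ?_⟩
  intro k
  induction k with
  | zero =>
    rintro x rfl
    ext v
    simp only [LinearMap.sub_apply, LinearMap.add_apply, LinearMap.smul_apply,
      Module.End.one_apply]
    push_cast
    module
  | succ k ih =>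
    intro x hx
    have ih := ih (x - 1) (by rw [hx]; push_cast; ring)
    have h2 := h1 (k + 1) (x - 1) (by rw [hx]; push_cast; ring)
    ext v
    have c := W.T_comm h (k + 2) (k + 3) k (k + 1) (by ring) v
    rw [W.T_succ (k + 2), W.T_succ k, ih, h2] at c
    rw [show k + 1 + 2 = k + 3 by ring, sub_eq_iff_eq_add.1 c]
    simp only [LinearMap.sub_apply, LinearMap.add_apply, LinearMap.smul_apply,
      Module.End.one_apply]
    push_cast
    module

lemma WittChain.first_order (h : IsCuspidalWitt L N) (W : WittChain L y0 E)
    {K : Module.End ℂ E}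
    (hK : ∀ (k : ℕ) (x : ℂ), x = y0 + (k + 1 : ℕ) → W.T k (k + 1) = (x * (x - 1)) • 1 - K)
    (k : ℕ) (x : ℂ) (hx : x = y0 + (k + 1 : ℕ)) :
    ((x + 2) * (x + 1)) • W.T (k + 3) (k + 1) - K * W.T (k + 3) (k + 1)
        - ((x * (x - 1)) • W.T (k + 2) k - W.T (k + 2) k * K) = (3 : ℂ) • 1 := by
  ext v
  have c := W.T_comm h (k + 1) (k + 3) k (k + 2) (by ring) v
  rw [hK (k + 2) (x + 2) (by rw [hx]; push_cast; ring), hK k x hx, W.T_succ (k + 1)] at c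
  simp only [LinearMap.sub_apply, LinearMap.smul_apply, Module.End.one_apply,
    Module.End.mul_apply, map_sub, map_smul] at c ⊢
  rw [show ((x + 2) * (x + 1)) = (x + 2) * (x + 2 - 1) by ring, c]
  congr 1
  push_cast; ring

lemma WittChain.second_order (h : IsCuspidalWitt L N) (W : WittChain L y0 E)
    {K H : Module.End ℂ E}
    (hH : ∀ (k : ℕ) (x : ℂ), x = y0 + (k + 2 : ℕ) →
      W.T k (k + 2) = (x * (x - 1) * (x - 2)) • 1 - (3 * x) • K + H)
    (k : ℕ) (x : ℂ) (hx : x = y0 + (k + 2 : ℕ)) :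
    (((x + 2) * (x + 1) * x) • W.T (k + 4) (k + 2) - (3 * (x + 2)) • (K * W.T (k + 4) (k + 2))
        + H * W.T (k + 4) (k + 2)) -
      ((x * (x - 1) * (x - 2)) • W.T (k + 2) k - (3 * x) • (W.T (k + 2) k * K)
        + W.T (k + 2) k * H) = x • (4 : ℂ) • 1 := by
  ext v
  have c := W.T_comm h (k + 2) (k + 4) k (k + 2) (by ring) v
  rw [hH (k + 2) (x + 2) (by rw [hx]; push_cast; ring), hH k x hx, W.T_self, ← hx] at c
  simp only [LinearMap.sub_apply, LinearMap.add_apply, LinearMap.smul_apply, Module.End.one_apply,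
    Module.End.mul_apply, map_sub, map_add, map_smul] at c ⊢
  rw [show ((x + 2) * (x + 1) * x) = (x + 2) * (x + 2 - 1) * (x + 2 - 2) by ring, c, smul_smul,
    smul_smul]
  congr 1
  push_cast; ring

end chainRelations

section flag

variable {V : Type} [AddCommGroup V] [Module ℂ V] {L : ℤ → Module.End ℂ V} {N : ℕ} {y0 : ℂ}
  {E : Type} [AddCommGroup E] [Module ℂ E]

open Polynomial in
lemma exists_add_natCast_ne_zero (z : ℂ) : ∃ k1 : ℕ, ∀ k ≥ k1, z + (k : ℕ) ≠ 0 := by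
  obtain ⟨k1, hk1⟩ := exists_eval_natCast_ne_zero (p := C z + X) (by
    intro h0
    have e1 := congrArg (eval 0) h0
    have e2 := congrArg (eval 1) h0
    simp at e1 e2
    rw [e1] at e2; simp at e2)
  exact ⟨k1, fun k hk => by simpa using hk1 k hk⟩

open Polynomial in
lemma eventually_scalar {Q S : Type} [AddCommGroup Q] [Module ℂ Q] [FiniteDimensional ℂ Q]
    [AddCommGroup S] [Module ℂ S] [FiniteDimensional ℂ S] (K H : Module.End ℂ Q)
    (G : ℕ → Module.End ℂ Q) (y0 b : ℂ) (ι : S →ₗ[ℂ] Q)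
    (hK : ∀ v, K (ι v) = (b ^ 2 - b) • ι v)
    (hH : ∀ v, H (ι v) = (-2 * b * (b - 1) * (b - 2)) • ι v)
    (h1 : ∀ k : ℕ, ∀ x : ℂ, x = y0 + (k + 1 : ℕ) →
      ((x + 2) * (x + 1)) • G (k + 1) - K * G (k + 1)
        - ((x * (x - 1)) • G k - G k * K) = (3 : ℂ) • 1)
    (h2 : ∀ k : ℕ, ∀ x : ℂ, x = y0 + (k + 2 : ℕ) →
      (((x + 2) * (x + 1) * x) • G (k + 2) - (3 * (x + 2)) • (K * G (k + 2)) + H * G (k + 2)) -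
      ((x * (x - 1) * (x - 2)) • G k - (3 * x) • (G k * K) + G k * H) = x • (4 : ℂ) • 1) :
    ∃ k1 : ℕ, ∀ k ≥ k1, ∀ v, G k (ι v) =
      ((y0 + (k : ℕ) + 2 * b) / ((y0 + (k : ℕ) + b) * (y0 + (k : ℕ) + b + 1))) • ι v := by
  obtain ⟨k2, hk2⟩ := exists_add_natCast_ne_zero (y0 + b)
  let g : ℂ → ℂ := fun x => (x + 2 * b) / ((x + b) * (x + b + 1))
  let u : ℕ → (S →ₗ[ℂ] Q) := fun k => (G k).comp ι - g (y0 + (k : ℕ)) • ι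
  have hne : ∀ k ≥ k2, y0 + (k : ℕ) + b ≠ 0 := fun k hk h0 => hk2 k hk (by
    linear_combination h0)
  obtain ⟨D, hD, hr⟩ := rational_of_difference_eqs (W := S →ₗ[ℂ] Q)
    (LinearMap.llcomp ℂ S Q Q K) (LinearMap.llcomp ℂ S Q Q H)
    ((b ^ 2 - b) • LinearMap.id) ((-2 * b * (b - 1) * (b - 2)) • LinearMap.id) y0 u k2 0 0 (by
      intro k hk x hx
      ext v
      have e := LinearMap.congr_fun (h1 k x hx) (ι v)
      have n1 := hne k hk
      have n2 := hne (k + 1) (by omega)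
      have n3 := hne (k + 2) (by omega)
      have hx1 : y0 + (k : ℕ) = x - 1 := by rw [hx]; push_cast; ring
      have hx2 : y0 + (k + 1 : ℕ) = x := hx.symm
      have hx3 : y0 + (k + 2 : ℕ) = x + 1 := by rw [hx]; push_cast; ring
      rw [hx1] at n1
      rw [hx2] at n2
      rw [hx3] at n3
      simp only [LinearMap.sub_apply, LinearMap.smul_apply, Module.End.one_apply,
        Module.End.mul_apply, hK, _root_.map_smul] at e
      simp only [u, hx1, hx2, LinearMap.sub_apply, LinearMap.smul_apply, LinearMap.comp_apply,
        LinearMap.llcomp_apply, LinearMap.id_apply, hK, map_smul, map_sub, LinearMap.zero_apply]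
      have e2 : (3 : ℂ) - g x * ((x + 2) * (x + 1) - (b ^ 2 - b))
          + g (x - 1) * (x * (x - 1) - (b ^ 2 - b)) = 0 := by
        simp only [g]
        rw [show x - 1 + b + 1 = x + b by ring]
        have n3' : x + b + 1 ≠ 0 := by rwa [add_right_comm] at n3
        field_simp
        ring
      have e3 := congrArg (fun z : ℂ => z • ι v) e2
      simp only [zero_smul] at e3
      linear_combination (norm := module) e + e3) (by
      intro k hk x hx
      ext v
      have e := LinearMap.congr_fun (h2 k x hx) (ι v)
      have n1 := hne k hk
      have n2 := hne (k + 1) (by omega)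
      have n3 := hne (k + 2) (by omega)
      have n4 := hne (k + 3) (by omega)
      have hx1 : y0 + (k : ℕ) = x - 2 := by rw [hx]; push_cast; ring
      have hx2 : y0 + (k + 1 : ℕ) = x - 1 := by rw [hx]; push_cast; ring
      have hx3 : y0 + (k + 2 : ℕ) = x := hx.symm
      have hx4 : y0 + (k + 3 : ℕ) = x + 1 := by rw [hx]; push_cast; ring
      rw [hx1] at n1
      rw [hx2] at n2
      rw [hx3] at n3
      rw [hx4] at n4
      simp only [LinearMap.sub_apply, LinearMap.add_apply, LinearMap.smul_apply,
        Module.End.one_apply, Module.End.mul_apply, hK, hH, map_smul] at e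
      simp only [u, hx1, hx3, LinearMap.sub_apply, LinearMap.add_apply, LinearMap.smul_apply,
        LinearMap.comp_apply, LinearMap.llcomp_apply, LinearMap.id_apply, hK, hH, map_smul,
        map_sub, LinearMap.zero_apply, smul_zero]
      have e2 : x * 4 - g x * ((x + 2) * (x + 1) * x - 3 * (x + 2) * (b ^ 2 - b)
          + (-2 * b * (b - 1) * (b - 2)))
          + g (x - 2) * (x * (x - 1) * (x - 2) - 3 * x * (b ^ 2 - b)
          + (-2 * b * (b - 1) * (b - 2))) = 0 := by
        simp only [g]
        rw [show x - 2 + b + 1 = x - 1 + b by ring]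
        have n4' : x + b + 1 ≠ 0 := by rwa [add_right_comm] at n4
        field_simp
        ring
      have e3 := congrArg (fun z : ℂ => z • ι v) e2
      simp only [zero_smul] at e3
      linear_combination (norm := module) e + e3)
  obtain ⟨k3, hk3⟩ := exists_eval_natCast_ne_zero (p := D.comp (C y0 + X)) (by
    intro h0
    apply hD
    have : D = (D.comp (C y0 + X)).comp (X - C y0) := by
      rw [comp_assoc]; simp
    rw [this, h0, zero_comp])
  refine ⟨k2 + 2 + k3, fun k hk v => ?_⟩
  have hu : u k = 0 := by
    rw [← Module.forall_dual_apply_eq_zero_iff ℂ]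
    intro θ
    obtain ⟨U, hU, hU0⟩ := hr θ
    have e := hU k (by omega)
    rw [hU0 rfl rfl, eval_zero] at e
    have n := hk3 k (by omega)
    simp only [eval_comp, eval_add, eval_C, eval_X] at n
    exact (mul_eq_zero.1 e).resolve_left n
  have := LinearMap.congr_fun hu v
  simp only [u, LinearMap.sub_apply, LinearMap.smul_apply, LinearMap.comp_apply,
    LinearMap.zero_apply] at this
  exact sub_eq_zero.1 this

end flag

section flagstep

variable {V : Type} [AddCommGroup V] [Module ℂ V] {L : ℤ → Module.End ℂ V} {N : ℕ} {y0 : ℂ}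
  {E : Type} [AddCommGroup E] [Module ℂ E]

/-- `F'` is carried into itself by all sufficiently large transition operators of the chain, which
act on `F' / F` like the transition operators of a module of tensor densities of parameter `b`. -/
structure WittChain.IsDensityStep (W : WittChain L y0 E) (F F' : Submodule ℂ E) (b : ℂ)
    (Γ : ℕ → ℂ) (k1 : ℕ) : Prop where
  lt : F < F'
  ne_zero : ∀ k, Γ k ≠ 0
  act : ∀ k ≥ k1, ∀ l ≥ k1, ∀ v ∈ F',
    Γ l • W.T l k v - (Γ k * (y0 + (k : ℕ) + b * ((l : ℂ) - k))) • v ∈ F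

lemma WittChain.IsDensityStep.maps {W : WittChain L y0 E} {F F' : Submodule ℂ E} {b : ℂ}
    {Γ : ℕ → ℂ} {k1 : ℕ} (h : W.IsDensityStep F F' b Γ k1) {k l : ℕ} (hk : k ≥ k1) (hl : l ≥ k1)
    {v : E} (hv : v ∈ F') : W.T l k v ∈ F' := by
  have e := h.lt.le (h.act k hk l hl v hv)
  have e2 := F'.add_mem e (F'.smul_mem (Γ k * (y0 + (k : ℕ) + b * ((l : ℂ) - k))) hv)
  rw [sub_add_cancel] at e2
  exact (F'.smul_mem_iff (h.ne_zero l)).1 e2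

lemma WittChain.exists_densityStep (h : IsCuspidalWitt L N) (W : WittChain L y0 E)
    [Module.Finite ℂ E] (F : Submodule ℂ E) (hF : F ≠ ⊤) (kF : ℕ)
    (hm : ∀ k ≥ kF, ∀ l ≥ kF, ∀ v ∈ F, W.T l k v ∈ F) :
    ∃ F' b Γ k1, W.IsDensityStep F F' b Γ k1 := by
  obtain ⟨K, H, hK, hH⟩ := W.exists_casimir h
  have hKF : F ≤ F.comap K := by
    intro v hv
    have e := LinearMap.congr_fun (hK kF _ rfl) v
    have : K v = ((y0 + (kF + 1 : ℕ)) * (y0 + (kF + 1 : ℕ) - 1)) • v - W.T kF (kF + 1) v := by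
      rw [e]; simp
    rw [Submodule.mem_comap, this]
    exact F.sub_mem (F.smul_mem _ hv) (hm _ (by omega) _ le_rfl _ hv)
  have hHF : F ≤ F.comap H := by
    intro v hv
    obtain ⟨x, hx⟩ : ∃ x, x = y0 + (kF + 2 : ℕ) := ⟨_, rfl⟩
    have e := LinearMap.congr_fun (hH kF x hx) v
    have : H v = W.T kF (kF + 2) v - (x * (x - 1) * (x - 2)) • v + (3 * x) • K v := by
      rw [e]; simp; abel
    rw [Submodule.mem_comap, this]
    exact F.add_mem (F.sub_mem (hm _ (by omega) _ le_rfl _ hv) (F.smul_mem _ hv))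
      (F.smul_mem _ (hKF hv))
  have hGF : ∀ k, F ≤ F.comap (W.T (k + kF + 2) (k + kF)) := fun k v hv =>
    hm _ (by omega) _ (by omega) _ hv
  let Kq := F.mapQ F K hKF
  let Hq := F.mapQ F H hHF
  let G : ℕ → Module.End ℂ (E ⧸ F) := fun k => F.mapQ F _ (hGF k)
  have h1 : ∀ k : ℕ, ∀ x : ℂ, x = y0 + kF + (k + 1 : ℕ) →
      ((x + 2) * (x + 1)) • G (k + 1) - Kq * G (k + 1)
        - ((x * (x - 1)) • G k - G k * Kq) = (3 : ℂ) • 1 := by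
    intro k x hx
    ext v
    have e := congrArg F.mkQ (LinearMap.congr_fun (W.first_order h hK (k + kF) x (by
      rw [hx]; push_cast; ring)) v)
    simp only [LinearMap.sub_apply, LinearMap.smul_apply, Module.End.one_apply,
        Module.End.mul_apply, _root_.map_smul, _root_.map_sub] at e
    simp only [LinearMap.sub_apply, LinearMap.smul_apply, Module.End.one_apply,
        Module.End.mul_apply, LinearMap.comp_apply, Kq, G, F.mkQ_apply, F.mapQ_apply]
    rw [show k + 1 + kF + 2 = k + kF + 3 by ring, show k + 1 + kF = k + kF + 1 by ring]
    exact e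
  have h2 : ∀ k : ℕ, ∀ x : ℂ, x = y0 + kF + (k + 2 : ℕ) →
      (((x + 2) * (x + 1) * x) • G (k + 2) - (3 * (x + 2)) • (Kq * G (k + 2)) + Hq * G (k + 2)) -
      ((x * (x - 1) * (x - 2)) • G k - (3 * x) • (G k * Kq) + G k * Hq) = x • (4 : ℂ) • 1 := by
    intro k x hx
    ext v
    have e := congrArg F.mkQ (LinearMap.congr_fun (W.second_order h hH (k + kF) x (by
      rw [hx]; push_cast; ring)) v)
    simp only [LinearMap.sub_apply, LinearMap.add_apply, LinearMap.smul_apply,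
        Module.End.one_apply,
        Module.End.mul_apply, _root_.map_smul, _root_.map_sub, _root_.map_add] at e
    simp only [LinearMap.sub_apply, LinearMap.add_apply, LinearMap.smul_apply,
        Module.End.one_apply,
        Module.End.mul_apply, LinearMap.comp_apply, Kq, Hq, G, F.mkQ_apply, F.mapQ_apply]
    rw [show k + 2 + kF + 2 = k + kF + 4 by ring, show k + 2 + kF = k + kF + 2 by ring]
    exact e
  have : Nontrivial (E ⧸ F) := Submodule.Quotient.nontrivial_iff.2 hF
  obtain ⟨b, w0, hw0, hKw, hHw⟩ := exists_common_eigenvector Kq Hq G (y0 + kF) 0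
    (fun k _ => h1 k) (fun k _ => h2 k)
  let F' : Submodule ℂ E := (Module.End.eigenspace Kq (b ^ 2 - b) ⊓
    Module.End.eigenspace Hq (-2 * b * (b - 1) * (b - 2))).comap F.mkQ
  have hFF' : F ≤ F' := by
    intro v hv
    have : F.mkQ v = 0 := by simpa using hv
    simp only [F', Submodule.mem_comap, this, Submodule.zero_mem]
  let ι : F' →ₗ[ℂ] E ⧸ F := F.mkQ.comp F'.subtype
  have hKι : ∀ v, Kq (ι v) = (b ^ 2 - b) • ι v := fun v =>
    Module.End.mem_eigenspace_iff.1 (Submodule.mem_comap.1 v.2).1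
  have hHι : ∀ v, Hq (ι v) = (-2 * b * (b - 1) * (b - 2)) • ι v := fun v =>
    Module.End.mem_eigenspace_iff.1 (Submodule.mem_comap.1 v.2).2
  obtain ⟨k1, hk1⟩ := eventually_scalar Kq Hq G (y0 + kF) b ι hKι hHι h1 h2
  obtain ⟨k2, hk2⟩ := exists_add_natCast_ne_zero (y0 + b)
  have hne : ∀ k ≥ k2, y0 + (k : ℕ) + b ≠ 0 := fun k hk h0 => hk2 k hk (by
    linear_combination h0)
  obtain ⟨k3, hk31, hk32, hk33⟩ : ∃ k3, k3 ≥ k1 + kF ∧ k3 ≥ k2 ∧ k3 ≥ kF :=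
    ⟨k1 + kF + k2, by omega, by omega, by omega⟩
  let Γ : ℕ → ℂ := fun k => ∏ i ∈ Finset.Ico k3 k, (y0 + (i : ℕ) + b)
  have hΓ : ∀ k, Γ k ≠ 0 := fun k => Finset.prod_ne_zero_iff.2 fun i hi =>
    hne i (hk32.trans (Finset.mem_Ico.1 hi).1)
  have hΓs : ∀ k ≥ k3, Γ (k + 1) = Γ k * (y0 + (k : ℕ) + b) := fun k hk =>
    Finset.prod_Ico_succ_top hk _
  let R : ℕ → ℕ → Prop := fun l k => ∀ v ∈ F',
    Γ l • F.mkQ (W.T l k v) = (Γ k * (y0 + (k : ℕ) + b * ((l : ℂ) - k))) • F.mkQ v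
  have hRmem : ∀ {l k}, R l k → ∀ {v}, v ∈ F' → W.T l k v ∈ F' := by
    intro l k hR v hv
    have e := hR v hv
    have hv' := Submodule.mem_comap.1 hv
    have e2 := Submodule.smul_mem _ (Γ k * (y0 + (k : ℕ) + b * ((l : ℂ) - k))) hv'
    rw [← e] at e2
    exact Submodule.mem_comap.2 ((Submodule.smul_mem_iff _ (hΓ l)).1 e2)
  have hstep : ∀ k l l' m : ℕ, l + l' = k + m → (((l : ℂ) - k) - (m - l)) ≠ 0 →
      R m l → R l k → R m l' → R l' k → R m k := by
    intro k l l' m hl hc r1 r2 r3 r4 v hv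
    have c := congrArg F.mkQ (W.T_comm h k l l' m hl v)
    simp only [_root_.map_smul, _root_.map_sub] at c
    have s1 := r1 _ (hRmem r2 hv)
    have s2 := r2 _ hv
    have s3 := r3 _ (hRmem r4 hv)
    have s4 := r4 _ hv
    have hl' : (l' : ℂ) = k + m - l := by
      rw [eq_sub_iff_add_eq, add_comm]; exact_mod_cast hl
    rw [hl'] at s3 s4
    apply smul_right_injective _ hc
    change (_ : ℂ) • _ = (_ : ℂ) • _
    linear_combination (norm := module) (-Γ m) • c + s1 + (y0 + (l : ℕ) + b * ((m : ℂ) - l)) • s2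
      - s3 - (y0 + ((k : ℂ) + m - l) + b * ((m : ℂ) - (k + m - l))) • s4
  have R0 : ∀ k ≥ k3, R k k := by
    intro k hk v hv
    rw [W.T_self, _root_.map_smul]
    module
  have R1 : ∀ k ≥ k3, R (k + 1) k := by
    intro k hk v hv
    rw [W.T_succ, hΓs k hk]
    push_cast
    module
  have R1' : ∀ k ≥ k3, R k (k + 1) := by
    intro k hk v hv
    have e := congrArg F.mkQ (LinearMap.congr_fun (hK k _ rfl) v)
    have e2 := hKι ⟨v, hv⟩
    simp only [LinearMap.sub_apply, LinearMap.smul_apply, Module.End.one_apply,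
      _root_.map_smul, _root_.map_sub] at e
    have e3 : F.mkQ (K v) = (b ^ 2 - b) • F.mkQ v := e2
    rw [e, e3, hΓs k hk]
    push_cast
    module
  have R2' : ∀ k ≥ k3, R k (k + 2) := by
    intro k hk v hv
    have e := congrArg F.mkQ (LinearMap.congr_fun (hH k _ rfl) v)
    have e3 : F.mkQ (K v) = (b ^ 2 - b) • F.mkQ v := hKι ⟨v, hv⟩
    have e4 : F.mkQ (H v) = (-2 * b * (b - 1) * (b - 2)) • F.mkQ v := hHι ⟨v, hv⟩
    simp only [LinearMap.sub_apply, LinearMap.add_apply, LinearMap.smul_apply,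
      Module.End.one_apply, _root_.map_smul, _root_.map_sub, _root_.map_add] at e
    rw [e, e3, e4, hΓs (k + 1) (by omega), hΓs k hk]
    push_cast
    module
  have R2 : ∀ k ≥ k3, R (k + 2) k := by
    intro k hk v hv
    obtain ⟨j, rfl⟩ : ∃ j, k = j + kF := ⟨k - kF, by omega⟩
    have e := hk1 j (by omega) ⟨v, hv⟩
    have e3 : F.mkQ (W.T (j + kF + 2) (j + kF) v) = _ • F.mkQ v := e
    have n1 := hne (j + kF) (by omega)
    have n2 := hne (j + kF + 1) (by omega)
    rw [e3, hΓs (j + kF + 1) (by omega), hΓs (j + kF) (by omega), smul_smul]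
    congr 1
    push_cast at n1 n2 ⊢
    have n1' : y0 + kF + j + b ≠ 0 := by convert n1 using 1; ring
    have n2' : y0 + kF + j + b + 1 ≠ 0 := by convert n2 using 1; ring
    field_simp
    ring
  have key : ∀ d, ∀ k ≥ k3, R (k + d) k ∧ R k (k + d) := by
    intro d
    induction d using Nat.strong_induction_on with
    | _ d ih =>
      intro k hk
      match d, ih with
      | 0, _ => exact ⟨R0 k hk, R0 k hk⟩
      | 1, _ => exact ⟨R1 k hk, R1' k hk⟩
      | 2, _ => exact ⟨R2 k hk, R2' k hk⟩
      | d + 3, ih =>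
        have hd : ((d : ℂ) + 1) ≠ 0 := by exact_mod_cast Nat.succ_ne_zero d
        constructor
        · refine hstep k (k + (d + 2)) (k + 1) _ (by ring) ?_ (R1 (k + (d + 2)) (by omega))
            (ih (d + 2) (by omega) k hk).1 ?_ (R1 k hk)
          · push_cast
            intro h0; apply hd; linear_combination h0
          · have := (ih (d + 2) (by omega) (k + 1) (by omega)).1
            rwa [show k + 1 + (d + 2) = k + (d + 3) by ring] at this
        · refine hstep (k + (d + 3)) (k + 1) (k + (d + 2)) k (by ring) ?_ (R1' k hk)
            ?_ (ih (d + 2) (by omega) k hk).2 (R1' (k + (d + 2)) (by omega))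
          · push_cast
            intro h0; apply hd; linear_combination -h0
          · have := (ih (d + 2) (by omega) (k + 1) (by omega)).2
            rwa [show k + 1 + (d + 2) = k + (d + 3) by ring] at this
  refine ⟨F', b, Γ, k3, ⟨lt_of_le_of_ne hFF' ?_, hΓ, ?_⟩⟩
  · intro he
    obtain ⟨v, rfl⟩ := F.mkQ_surjective w0
    have : v ∈ F' := Submodule.mem_comap.2 ⟨Module.End.mem_eigenspace_iff.2 hKw,
      Module.End.mem_eigenspace_iff.2 hHw⟩
    rw [← he] at this
    exact hw0 (by simpa using this)
  · intro k hk l hl v hv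
    have hR : R l k := by
      rcases le_total k l with hkl | hkl
      · obtain ⟨d, rfl⟩ := Nat.exists_eq_add_of_le hkl
        exact (key d k hk).1
      · obtain ⟨d, rfl⟩ := Nat.exists_eq_add_of_le hkl
        exact (key d l hl).2
    have := hR v hv
    rw [← F.ker_mkQ, LinearMap.mem_ker, _root_.map_sub, _root_.map_smul, _root_.map_smul, this,
      sub_self]

end flagstep

section germs
open Polynomial fwdDiff

lemma germ_alternating_sum (X₀ b : ℂ) (D : ℤ → ℂ) (s1 : ℕ)
    (h : ∀ r : ℕ, r ≥ s1 → ∀ s : ℕ, s ≥ s1 → ((s : ℂ) - r) * D ((r : ℤ) + s) =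
      (X₀ + s + b * r) * D s - (X₀ + r + b * s) * D r) (p0 r0 : ℤ) :
    ∃ s0 : ℤ, ∀ s ≥ s0, ∑ i ∈ Finset.range 9, (((-1 : ℤ) ^ (8 - i) * (Nat.choose 8 i : ℤ) : ℤ) : ℂ) *
      ((fun p r : ℤ => (X₀ + r + s + b * p) * (X₀ + s + b * r) * D s
        + ((r : ℂ) - s) * (X₀ + r + s + b * p) * D (s + r)
        + ((p : ℂ) - s) * ((X₀ + s + p + b * r) * D (s + p) + ((r : ℂ) - s - p) * D (s + p + r)))
        (p0 - i) (r0 + i)) = 0 := by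
  obtain ⟨P, k1, hP⟩ := germ_polynomial b X₀ (fun k => D k) s1 (fun r hr s hs => by
    simpa using h r hr s hs)
  have hP' : ∀ s : ℤ, s ≥ k1 → D s = P.eval (s : ℂ) := by
    intro s hs
    obtain ⟨k, rfl⟩ := Int.eq_ofNat_of_zero_le (show 0 ≤ s by omega)
    simpa using hP k (by omega)
  have hdeg : P.natDegree ≤ 5 := by
    apply germ_degree b X₀ P (s1 + k1)
    intro r hr s hs
    have := h r (by omega) s (by omega)
    rw [hP' _ (by omega), hP' _ (by omega), hP' _ (by omega)] at this
    simpa using this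
  refine ⟨k1 + 16 + |p0| + |r0|, fun s hs => ?_⟩
  have ha := neg_abs_le p0
  have hb := neg_abs_le r0
  have ha' := le_abs_self p0
  have hb' := le_abs_self r0
  let n : ℂ := p0 + r0
  let Q : ℂ[X] := (C (X₀ + s + b * n) + C (1 - b) * X) * (C (X₀ + s) + C b * X) * C (P.eval (s : ℂ))
    + (X - C (s : ℂ)) * (C (X₀ + s + b * n) + C (1 - b) * X) * P.comp (X + C (s : ℂ))
    + (C (n - s) - X) * ((C (X₀ + s + n) + C (b - 1) * X) * P.comp (C (s + n) - X)
      + (C 2 * X - C (s + n)) * C (P.eval (s + n)))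
  have hQ : Q.natDegree ≤ 7 := by
    have c1 : (P.comp (X + C (s : ℂ))).natDegree ≤ 5 := by
      rw [natDegree_comp, natDegree_X_add_C, mul_one]; exact hdeg
    have c2 : (P.comp (C ((s : ℂ) + n) - X)).natDegree ≤ 5 := by
      rw [natDegree_comp]
      have c3 : (C ((s : ℂ) + n) - X).natDegree ≤ 1 := by compute_degree
      exact (Nat.mul_le_mul hdeg c3).trans (by norm_num)
    have d1 : (C (X₀ + s + b * n) + C (1 - b) * X).natDegree ≤ 1 := by compute_degree
    have d2 : (C (X₀ + s) + C b * X).natDegree ≤ 1 := by compute_degree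
    have d3 : (X - C (s : ℂ)).natDegree ≤ 1 := by compute_degree
    have d4 : (C (n - s) - X).natDegree ≤ 1 := by compute_degree
    have d5 : (C (X₀ + s + n) + C (b - 1) * X).natDegree ≤ 1 := by compute_degree
    have d6 : (C 2 * X - C (s + n)).natDegree ≤ 1 := by compute_degree
    refine natDegree_add_le_of_degree_le (natDegree_add_le_of_degree_le ?_ ?_) ?_
    · exact (natDegree_mul_le_of_le (natDegree_mul_le_of_le d1 d2) (natDegree_C _).le).trans
        (by norm_num)
    · exact natDegree_mul_le_of_le (natDegree_mul_le_of_le d3 d1) c1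
    · refine (natDegree_mul_le_of_le d4 (natDegree_add_le_of_degree_le (n := 6)
        (natDegree_mul_le_of_le d5 c2) ?_)).trans (by norm_num)
      exact (natDegree_mul_le_of_le d6 (natDegree_C _).le).trans (by norm_num)
  have e := congrFun (Polynomial.fwdDiff_iter_eq_zero_of_degree_lt (P := Q) (n := 8) (by omega))
    (r0 : ℂ)
  rw [fwdDiff_iter_eq_sum_shift, Pi.zero_apply] at e
  rw [← e]
  refine Finset.sum_congr rfl fun i hi => ?_
  have hi' : (i : ℤ) ≤ 8 := by
    have := Finset.mem_range.1 hi; omega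
  rw [zsmul_eq_mul]
  congr 1
  dsimp only
  rw [hP' s (by omega), hP' (s + (r0 + i)) (by omega), hP' (s + (p0 - i)) (by omega),
    hP' (s + (p0 - i) + (r0 + i)) (by omega)]
  simp only [Q, n, eval_add, eval_mul, eval_sub, eval_C, eval_X, eval_comp]
  push_cast
  simp only [nsmul_eq_mul, mul_one]
  rw [show (r0 : ℂ) + i + s = s + (r0 + i) by ring,
    show (s : ℂ) + (p0 + r0) - (r0 + i) = s + (p0 - i) by ring,
    show (s : ℂ) + (p0 - i) + (r0 + i) = s + (p0 + r0) by ring]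
  ring

end germs

section flag_germs

/-- The `m`-th iterated difference, in the direction `(-h, h)`, of the products `e γ * e δ`. -/
noncomputable def altProd {G R : Type} [AddCommGroup G] [Ring R] (e : G → R) (h : G) (m : ℕ)
    (γ δ : G) : R :=
  (fwdDiff ((-h, h) : G × G))^[m] (fun q : G × G => e q.1 * e q.2) (γ, δ)

lemma altProd_eq_sum {G R : Type} [AddCommGroup G] [Ring R] (e : G → R) (h : G) (m : ℕ)
    (γ δ : G) : altProd e h m γ δ = ∑ i ∈ Finset.range (m + 1),
      ((-1 : ℤ) ^ (m - i) * (m.choose i : ℤ)) • (e (γ - i • h) * e (δ + i • h)) := by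
  rw [altProd, fwdDiff_iter_eq_sum_shift]
  simp [sub_eq_add_neg]

variable {V : Type} [AddCommGroup V] [Module ℂ V] {L : ℤ → Module.End ℂ V} {N : ℕ} {y0 : ℂ}
  {E : Type} [AddCommGroup E] [Module ℂ E]

/-- Eventually, `L s w` comes from the subspace `F`, where `w` has weight `y0 + j`. -/
def WittChain.Germ (W : WittChain L y0 E) (F : Submodule ℂ E) (j : ℤ) (w : V) : Prop :=
  ∃ s0 : ℤ, ∀ s ≥ s0, L s w ∈ F.map (W.τ (j + s).toNat)

/-- Graph of the scaled coordinate of the chain, modulo `F`. -/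
def WittChain.graph (W : WittChain L y0 E) (F F' : Submodule ℂ E) (Γ : ℕ → ℂ) (k : ℤ) :
    Submodule ℂ (V × (E ⧸ F)) :=
  F'.map ((W.τ k.toNat).prod (Γ k.toNat • F.mkQ))

lemma WittChain.graph_unique {W : WittChain L y0 E} {F F' : Submodule ℂ E} {Γ : ℕ → ℂ} {k : ℤ}
    {u : V} {q q' : E ⧸ F} (h : (u, q) ∈ W.graph F F' Γ k) (h' : (u, q') ∈ W.graph F F' Γ k) :
    q = q' := by
  obtain ⟨c, -, hc⟩ := h
  obtain ⟨c', -, hc'⟩ := h'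
  have h1 := congrArg Prod.fst hc
  have h1' := congrArg Prod.fst hc'
  have h2 := congrArg Prod.snd hc
  have h2' := congrArg Prod.snd hc'
  exact h2.symm.trans ((congrArg (fun c => Γ k.toNat • F.mkQ c) (W.inj _ (h1.trans h1'.symm))).trans h2')

lemma WittChain.IsDensityStep.graph_act {W : WittChain L y0 E} {F F' : Submodule ℂ E} {b : ℂ}
    {Γ : ℕ → ℂ} {k1 : ℕ} (h : W.IsDensityStep F F' b Γ k1) {k : ℤ} (r : ℤ) (hk : k ≥ k1)
    (hkr : k + r ≥ k1) {u : V} {q : E ⧸ F} (hu : (u, q) ∈ W.graph F F' Γ k) :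
    (L r u, (y0 + k + b * r) • q) ∈ W.graph F F' Γ (k + r) := by
  obtain ⟨m, rfl⟩ := Int.eq_ofNat_of_zero_le (show 0 ≤ k by omega)
  obtain ⟨l, hl⟩ := Int.eq_ofNat_of_zero_le (show 0 ≤ (m : ℤ) + r by omega)
  obtain rfl : r = l - m := by omega
  obtain ⟨c, hcF, hc⟩ := hu
  have h1 := congrArg Prod.fst hc
  have h2 := congrArg Prod.snd hc
  change W.τ m c = u at h1
  change Γ m • F.mkQ c = q at h2
  refine ⟨W.T l m c, h.maps (by omega) (by omega) hcF, ?_⟩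
  have e := h.act m (by omega) l (by omega) c hcF
  rw [← F.ker_mkQ, LinearMap.mem_ker, _root_.map_sub, _root_.map_smul, _root_.map_smul,
    sub_eq_zero] at e
  rw [hl]
  rw [← h1, ← h2]
  refine Prod.ext (W.act l m c).symm ?_
  change Γ l • F.mkQ (W.T l m c) = _ • Γ m • F.mkQ c
  rw [e, smul_smul, mul_comm]
  push_cast
  rfl

lemma WittChain.IsDensityStep.germ_altProd (hL : IsCuspidalWitt L N) [Module.Finite ℂ E]
    {W : WittChain L y0 E} {F F' : Submodule ℂ E} {b : ℂ}
    {Γ : ℕ → ℂ} {k1 : ℕ} (h : W.IsDensityStep F F' b Γ k1) {j : ℤ} {w : V}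
    (hg : W.Germ F' j w) (p0 r0 : ℤ) :
    W.Germ F (j + (p0 + r0)) (altProd L 1 8 p0 r0 w) := by
  obtain ⟨m0, hm0⟩ := hg
  have hD : ∀ s : ℤ, ∃ q : E ⧸ F, s ≥ m0 → (L s w, q) ∈ W.graph F F' Γ (j + s) := by
    intro s
    by_cases hs : s ≥ m0
    · obtain ⟨c, hc, hc2⟩ := hm0 s hs
      exact ⟨_, fun _ => ⟨c, hc, Prod.ext hc2 rfl⟩⟩
    · exact ⟨0, fun h => absurd h hs⟩
  choose D hD using hD
  obtain ⟨s1, hs1, hs1', hs1''⟩ : ∃ s1 : ℕ, (s1 : ℤ) ≥ m0 ∧ (s1 : ℤ) + j ≥ k1 ∧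
      (s1 : ℤ) + j ≥ 0 := ⟨m0.toNat + k1 + j.natAbs, by omega, by omega, by omega⟩
  have hrel : ∀ r : ℕ, r ≥ s1 → ∀ s : ℕ, s ≥ s1 → ((s : ℂ) - r) • D ((r : ℤ) + s) =
      ((y0 + j) + s + b * r) • D s - ((y0 + j) + r + b * s) • D r := by
    intro r hr s hs
    have a1 := h.graph_act r (by omega) (by omega) (hD s (by omega))
    have a2 := h.graph_act s (by omega) (by omega) (hD r (by omega))
    have a3 := hD (r + s) (by omega)
    rw [show j + (s : ℤ) + r = j + (r + s) by ring] at a1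
    rw [show j + (r : ℤ) + s = j + (r + s) by ring] at a2
    have a4 := Submodule.sub_mem _ a1 a2
    have a5 := Submodule.smul_mem _ ((s : ℂ) - r) a3
    rw [Prod.mk_sub_mk, hL.comm] at a4
    rw [Prod.smul_mk] at a5
    have := W.graph_unique a5 (by simpa using a4)
    rw [this]
    module
  let B := Module.finBasis ℂ (E ⧸ F)
  have key := fun i => germ_alternating_sum (y0 + j) b (fun s => B.coord i (D s)) s1
    (fun r hr s hs => by
      have := congrArg (B.coord i) (hrel r hr s hs)
      simpa only [_root_.map_smul, _root_.map_sub, smul_eq_mul] using this) p0 r0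
  choose s0 hs0 using key
  obtain ⟨s2, hs2⟩ := (Set.finite_range s0).bddAbove
  refine ⟨s1 + |p0| + |r0| + |s2| + 16, fun s hs => ?_⟩
  have := neg_abs_le p0
  have := neg_abs_le r0
  have := le_abs_self p0
  have := le_abs_self r0
  have := le_abs_self s2
  have := abs_nonneg s2
  have := abs_nonneg p0
  have := abs_nonneg r0
  have hmem : ∀ p r : ℤ, p + r = p0 + r0 → s + p ≥ s1 → s + r ≥ s1 →
      s + p + r ≥ s1 → s ≥ s1 →
      (L s (L p (L r w)), ((y0 + j) + r + s + b * p) • ((y0 + j) + s + b * r) • D s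
        + (((r : ℂ) - s) * ((y0 + j) + r + s + b * p)) • D (s + r)
        + ((p : ℂ) - s) • (((y0 + j) + s + p + b * r) • D (s + p)
          + ((r : ℂ) - s - p) • D (s + p + r))) ∈
      W.graph F F' Γ (j + (p0 + r0) + s) := by
    intro p r hpr c1 c2 c3 c4
    have b1 := h.graph_act p (by omega) (by omega)
      (h.graph_act r (by omega) (by omega) (hD s (by omega)))
    have b2 := h.graph_act p (by omega) (by omega) (hD (s + r) (by omega))
    have b3 := h.graph_act r (by omega) (by omega) (hD (s + p) (by omega))
    have b4 := hD (s + p + r) (by omega)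
    rw [show j + s + r + p = j + (p0 + r0) + s by rw [← hpr]; ring] at b1
    rw [show j + (s + r) + p = j + (p0 + r0) + s by rw [← hpr]; ring] at b2
    rw [show j + (s + p) + r = j + (p0 + r0) + s by rw [← hpr]; ring] at b3
    rw [show j + (s + p + r) = j + (p0 + r0) + s by rw [← hpr]; ring] at b4
    have b5 := Submodule.add_mem _ (Submodule.add_mem _ b1 (Submodule.smul_mem _ ((r : ℂ) - s) b2))
      (Submodule.smul_mem _ ((p : ℂ) - s) (Submodule.add_mem _ b3
        (Submodule.smul_mem _ ((r : ℂ) - s - p) b4)))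
    convert b5 using 1
    simp only [Prod.smul_mk, Prod.mk_add_mk]
    refine Prod.ext ?_ ?_
    · have e1 := hL.comm s p (L r w)
      have e2 := congrArg (L p) (hL.comm s r w)
      have e3 := hL.comm (s + p) r w
      simp only [_root_.map_smul, _root_.map_sub] at e2
      push_cast at e3
      linear_combination (norm := module) e1 + e2 + ((p : ℂ) - s) • e3
    · push_cast
      module
  have hsum := Submodule.sum_mem (t := Finset.range 9) _ fun i hi => Submodule.smul_mem _
    ((((-1 : ℤ) ^ (8 - i) * (Nat.choose 8 i : ℤ) : ℤ)) : ℂ)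
    (hmem (p0 - i) (r0 + i) (by ring) (by have := Finset.mem_range.1 hi; omega)
      (by have := Finset.mem_range.1 hi; omega) (by have := Finset.mem_range.1 hi; omega) (by omega))
  simp only [Prod.smul_mk, ← prod_mk_sum] at hsum
  have hfst : L s (altProd L 1 8 p0 r0 w) = ∑ i ∈ Finset.range 9,
      ((((-1 : ℤ) ^ (8 - i) * (Nat.choose 8 i : ℤ) : ℤ)) : ℂ) •
        L s (L (p0 - i) (L (r0 + i) w)) := by
    rw [altProd_eq_sum, LinearMap.sum_apply, _root_.map_sum]
    refine Finset.sum_congr rfl fun i _ => ?_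
    simp only [nsmul_eq_mul, mul_one, LinearMap.smul_apply, Module.End.mul_apply, Int.cast_smul_eq_zsmul,
      map_zsmul]
  rw [← hfst] at hsum
  obtain ⟨c, -, hc⟩ := hsum
  have h1 := congrArg Prod.fst hc
  have h2 := congrArg Prod.snd hc
  refine ⟨c, ?_, h1⟩
  have hz : Γ (j + (p0 + r0) + s).toNat • F.mkQ c = 0 := by
    refine h2.trans ?_
    apply B.ext_elem
    intro i
    have hi := hs0 i s (by have : s0 i ≤ s2 := hs2 ⟨i, rfl⟩; omega)
    rw [← Module.Basis.coord_apply, ← Module.Basis.coord_apply, _root_.map_zero, ← hi]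
    simp only [_root_.map_sum, _root_.map_smul, _root_.map_add, smul_eq_mul]
    refine Finset.sum_congr rfl fun i _ => ?_
    ring
  have := (smul_eq_zero.1 hz).resolve_left (h.ne_zero _)
  simpa using this

end flag_germs

section words

variable {V : Type} [AddCommGroup V] [Module ℂ V] {L : ℤ → Module.End ℂ V} {N : ℕ} {y0 : ℂ}
  {E : Type} [AddCommGroup E] [Module ℂ E]

/-- The vectors killed by `L s` for all sufficiently large `s`. -/
def eventuallyKilled (L : ℤ → Module.End ℂ V) : Submodule ℂ V where
  carrier := {w | ∃ s0 : ℤ, ∀ s ≥ s0, L s w = 0}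
  zero_mem' := ⟨0, fun s _ => map_zero _⟩
  add_mem' := by
    rintro v w ⟨s, hs⟩ ⟨t, ht⟩
    exact ⟨max s t, fun r hr => by
      rw [map_add, hs r (le_trans (le_max_left _ _) hr), ht r (le_trans (le_max_right _ _) hr),
        add_zero]⟩
  smul_mem' := by
    rintro c w ⟨s, hs⟩
    exact ⟨s, fun r hr => by rw [map_smul, hs r hr, smul_zero]⟩

lemma IsCuspidalWitt.eventuallyKilled_stable (h : IsCuspidalWitt L N) (r : ℤ) {w : V}
    (hw : w ∈ eventuallyKilled L) : L r w ∈ eventuallyKilled L := by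
  obtain ⟨s0, hs0⟩ := hw
  refine ⟨max s0 (s0 - r), fun s hs => ?_⟩
  have c := h.comm s r w
  rw [hs0 s (le_trans (le_max_left _ _) hs), hs0 (s + r) (by
    have := le_trans (le_max_right s0 (s0 - r)) hs; omega), map_zero, sub_zero, smul_zero] at c
  exact c

lemma altProd_mem {G : Type} [AddCommGroup G] (e : G → Module.End ℂ V) (U : Submodule ℂ V)
    (hU : ∀ g, ∀ w ∈ U, e g w ∈ U) (h : G) (m : ℕ) (γ δ : G) {w : V} (hw : w ∈ U) :
    altProd e h m γ δ w ∈ U := by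
  rw [altProd_eq_sum, LinearMap.sum_apply]
  refine Submodule.sum_mem _ fun i _ => ?_
  rw [LinearMap.smul_apply]
  exact U.toAddSubgroup.zsmul_mem (hU _ _ (hU _ _ hw)) _

lemma list_prod_apply_mem {ι : Type} (f : ι → Module.End ℂ V) (U : Submodule ℂ V)
    (hU : ∀ i, ∀ w ∈ U, f i w ∈ U) (l : List ι) {w : V} (hw : w ∈ U) :
    (l.map f).prod w ∈ U := by
  induction l with
  | nil => simpa using hw
  | cons a l ih => simpa using hU a _ ih

lemma IsCuspidalWitt.weight_altProd (h : IsCuspidalWitt L N) {x : ℂ} {v : V}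
    (hv : L 0 v = x • v) (m : ℕ) (p r : ℤ) :
    L 0 (altProd L 1 m p r v) = (x + (p + r)) • altProd L 1 m p r v := by
  rw [altProd_eq_sum, LinearMap.sum_apply, map_sum, Finset.smul_sum]
  refine Finset.sum_congr rfl fun i _ => ?_
  rw [LinearMap.smul_apply, map_zsmul, Module.End.mul_apply, h.weight (h.weight hv _) _,
    smul_comm]
  congr 1
  simp only [nsmul_eq_mul, mul_one]
  push_cast
  ring

lemma WittChain.word_flag (h : IsCuspidalWitt L N) (W : WittChain L y0 E) [Module.Finite ℂ E]
    (d : ℕ) : ∀ (F : Submodule ℂ E) (t kF : ℕ), Module.finrank ℂ E ≤ Module.finrank ℂ F + d →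
    (∀ k ≥ kF, ∀ l ≥ kF, ∀ v ∈ F, W.T l k v ∈ F) →
    (∀ l : List (ℤ × ℤ), l.length = t → ∀ (j : ℤ) (w : V), L 0 w = (y0 + j) • w → W.Germ F j w →
      (l.map (fun q => altProd L 1 8 q.1 q.2)).prod w ∈ eventuallyKilled L) →
    ∀ l : List (ℤ × ℤ), l.length = t + d → ∀ (j : ℤ) (w : V), L 0 w = (y0 + j) • w →
      (l.map (fun q => altProd L 1 8 q.1 q.2)).prod w ∈ eventuallyKilled L := by
  have htop : ∀ (j : ℤ) (w : V), L 0 w = (y0 + j) • w → W.Germ ⊤ j w := by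
    intro j w hw
    refine ⟨-j, fun s hs => ?_⟩
    obtain ⟨c, hc⟩ := W.surj (j + s).toNat (L s w) (by
      rw [h.weight hw]
      congr 1
      rw [add_assoc]
      congr 1
      have : ((j + s).toNat : ℤ) = j + s := Int.toNat_of_nonneg (by omega)
      exact_mod_cast this.symm)
    exact ⟨c, trivial, hc⟩
  induction d with
  | zero =>
    intro F t kF hF hm ht l hl j w hw
    have : F = ⊤ := Submodule.eq_top_of_finrank_eq (le_antisymm (Submodule.finrank_le F) hF)
    exact ht l hl j w hw (this ▸ htop j w hw)
  | succ d ih =>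
    intro F t kF hF hm ht
    by_cases hFt : F = ⊤
    · intro l hl j w hw
      obtain ⟨a, l', rfl⟩ := List.exists_cons_of_length_eq_add_one (n := t + d) hl
      have hk := ih F t kF (by rw [hFt, finrank_top]; omega) hm ht l' (by
        rw [List.length_cons] at hl; omega) j w hw
      rw [List.map_cons, List.prod_cons, Module.End.mul_apply]
      exact altProd_mem L _ (fun g w hw => h.eventuallyKilled_stable g hw) _ _ _ _ hk
    · obtain ⟨F', b, Γ, k1, hs⟩ := W.exists_densityStep h F hFt kF hm
      have hlt := Submodule.finrank_lt_finrank_of_lt hs.lt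
      have := ih F' (t + 1) k1 (by omega) (fun k hk l hl v hv => hs.maps hk hl hv) (by
        intro l hl j w hw hg
        obtain ⟨l', a, rfl⟩ := l.eq_nil_or_concat.resolve_left (by rintro rfl; simp at hl)
        rw [List.concat_eq_append, List.map_append, List.prod_append, Module.End.mul_apply]
        simp only [List.map_cons, List.map_nil, List.prod_singleton]
        refine ht l' (by simpa using hl) (j + (a.1 + a.2)) _ ?_ (hs.germ_altProd h hg _ _)
        rw [h.weight_altProd hw]
        push_cast
        rw [add_assoc])
      intro l hl
      exact this l (by omega)

lemma IsCuspidalWitt.word_eventuallyKilled (h : IsCuspidalWitt L N) {x : ℂ} {w : V}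
    (hw : L 0 w = x • w) (l : List (ℤ × ℤ)) (hl : l.length = N) :
    (l.map (fun q => altProd L 1 8 q.1 q.2)).prod w ∈ eventuallyKilled L := by
  obtain ⟨K, E, _, _, _, hN, ⟨W⟩⟩ := h.exists_chain x
  refine W.word_flag h N ⊥ 0 0 (by simpa using hN) ?_ ?_ l (by simpa using hl) (-K) w
    (by rw [hw]; congr 1; push_cast; ring)
  · intro k _ l _ v hv
    rw [Submodule.mem_bot] at hv ⊢
    rw [hv, map_zero]
  · rintro l hl j w hw ⟨s0, hs0⟩
    rw [List.eq_nil_of_length_eq_zero hl]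
    refine ⟨s0, fun s hs => ?_⟩
    simpa using hs0 s hs

lemma IsCuspidalWitt.neg (h : IsCuspidalWitt L N) : IsCuspidalWitt (fun s => -L (-s)) N := by
  have he : ∀ x, Module.End.eigenspace ((fun s : ℤ => -L (-s)) 0) x
      = Module.End.eigenspace (L 0) (-x) := by
    intro x
    ext v
    simp only [Module.End.mem_eigenspace_iff, neg_zero, LinearMap.neg_apply, neg_smul]
    constructor
    · intro e; rw [← e, neg_neg]
    · intro e; rw [e, neg_neg]
  refine ⟨fun r s v => ?_, fun x => ?_, fun x => ?_⟩
  · have c := h.comm (-r) (-s) v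
    simp only [LinearMap.neg_apply, map_neg, neg_neg, neg_add]
    rw [c]
    push_cast
    module
  · rw [he]; exact h.fin _
  · rw [he]; exact h.le _

lemma altProd_neg (a b : ℤ) :
    altProd (fun s => -L (-s)) 1 8 a b = altProd L 1 8 (8 - a) (-b - 8) := by
  rw [altProd_eq_sum, altProd_eq_sum, ← Finset.sum_range_reflect]
  refine Finset.sum_congr rfl fun i hi => ?_
  have hi' : i ≤ 8 := by have := Finset.mem_range.1 hi; omega
  rw [show 8 + 1 - 1 - i = 8 - i by omega, Nat.choose_symm hi', Nat.sub_sub_self hi', neg_mul_neg]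
  congr 1
  · congr 1
    interval_cases i <;> norm_num
  · congr 2
    · simp only [nsmul_eq_mul, mul_one]
      push_cast [hi']
      ring
    · simp only [nsmul_eq_mul, mul_one]
      push_cast [hi']
      ring

lemma IsCuspidalWitt.word_eq_zero (h : IsCuspidalWitt L N)
    (htop : (⨆ x : ℂ, Module.End.eigenspace (L 0) x) = ⊤) (l : List (ℤ × ℤ))
    (hl : l.length = 2 * N + 1) :
    (l.map (fun q => altProd L 1 8 q.1 q.2)).prod = 0 := by
  obtain ⟨l1, l2, l3, rfl, h1, h2, h3⟩ : ∃ l1 l2 l3 : List (ℤ × ℤ), l = l1 ++ (l2 ++ l3) ∧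
      l1.length = 1 ∧ l2.length = N ∧ l3.length = N :=
    ⟨l.take 1, (l.drop 1).take N, (l.drop 1).drop N, by
      rw [List.take_append_drop, List.take_append_drop], by simp; omega, by simp; omega,
      by simp; omega⟩
  obtain ⟨a, rfl⟩ := List.length_eq_one_iff.1 h1
  rw [← LinearMap.ker_eq_top, eq_top_iff, ← htop]
  refine iSup_le fun x w hw => ?_
  rw [Module.End.mem_eigenspace_iff] at hw
  rw [LinearMap.mem_ker, List.map_append, List.map_append, List.prod_append, List.prod_append,
    Module.End.mul_apply, Module.End.mul_apply]
  set w3 := (l3.map (fun q => altProd L 1 8 q.1 q.2)).prod w with hw3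
  have m3 : w3 ∈ eventuallyKilled L := h.word_eventuallyKilled hw l3 h3
  have hweight : ∀ l : List (ℤ × ℤ), ∃ y : ℂ, L 0 ((l.map (fun q => altProd L 1 8 q.1 q.2)).prod w)
      = y • (l.map (fun q => altProd L 1 8 q.1 q.2)).prod w := by
    intro l
    induction l with
    | nil => exact ⟨x, by simpa using hw⟩
    | cons a l ih =>
      obtain ⟨y, hy⟩ := ih
      exact ⟨_, by simpa using h.weight_altProd hy 8 a.1 a.2⟩
  obtain ⟨y, hy⟩ := hweight l3
  set w2 := (l2.map (fun q => altProd L 1 8 q.1 q.2)).prod w3 with hw2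
  have m2 : w2 ∈ eventuallyKilled L := list_prod_apply_mem _ _ (fun q w hw =>
    altProd_mem L _ (fun g w hw => h.eventuallyKilled_stable g hw) _ _ _ _ hw) l2 m3
  have m2' : w2 ∈ eventuallyKilled (fun s => -L (-s)) := by
    have := h.neg.word_eventuallyKilled (w := w3) (x := -y) (by
      rw [← hw3] at hy
      simp [hy]) (l2.map fun q => (8 - q.1, -q.2 - 8)) (by simpa using h2)
    rw [List.map_map] at this
    convert this using 4
    funext q
    simp only [Function.comp_apply, altProd_neg]
    congr 1 <;> ring
  have hzero : ∀ t : ℤ, L t w2 = 0 := by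
    intro t
    obtain ⟨s0, hs0⟩ := m2
    obtain ⟨t0, ht0⟩ := m2'
    have c := h.comm (|t| + |s0| + |t0| + 1) (t - (|t| + |s0| + |t0| + 1)) w2
    have := le_abs_self s0
    have := le_abs_self t0
    have := le_abs_self t
    have := abs_nonneg t
    have := abs_nonneg s0
    have := abs_nonneg t0
    have z1 := hs0 (|t| + |s0| + |t0| + 1) (by omega)
    have z2 := ht0 (-(t - (|t| + |s0| + |t0| + 1))) (by omega)
    simp only [neg_neg, LinearMap.neg_apply, neg_eq_zero] at z2
    rw [z1, z2, map_zero, map_zero, sub_zero, add_sub_cancel, eq_comm, smul_eq_zero] at c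
    refine c.resolve_left ?_
    rw [← Int.cast_sub]
    refine Int.cast_ne_zero.2 ?_
    omega
  simp only [List.map_cons, List.map_nil, List.prod_singleton]
  rw [altProd_eq_sum, LinearMap.sum_apply]
  refine Finset.sum_eq_zero fun i _ => ?_
  rw [LinearMap.smul_apply, Module.End.mul_apply, hzero, map_zero, smul_zero]

end words

section differences

variable {G G' M M' : Type} [AddCommGroup G] [AddCommGroup G'] [AddCommGroup M] [Module ℂ M]
  [AddCommGroup M'] [Module ℂ M']

/-- The forward difference operator as an endomorphism. -/
def diffOp (w : G) : Module.End ℂ (G → M) where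
  toFun f := fwdDiff w f
  map_add' f g := by funext x; simp only [fwdDiff, Pi.add_apply]; abel
  map_smul' c f := by funext x; simp only [fwdDiff, Pi.smul_apply, RingHom.id_apply, smul_sub]

lemma diffOp_apply (w : G) (f : G → M) (x : G) : diffOp w f x = f (x + w) - f x := rfl

lemma diffOp_pow (w : G) (f : G → M) (k : ℕ) : (diffOp w ^ k) f = (fwdDiff w)^[k] f :=
  Module.End.pow_apply _ _ _

lemma diffOp_commute (u v : G) : Commute (diffOp u : Module.End ℂ (G → M)) (diffOp v) := by
  ext f x
  simp only [Module.End.mul_apply, diffOp_apply, add_right_comm]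
  abel

lemma diffOp_pow_comp (w : G) (π : G →+ G') (T : G → M →ₗ[ℂ] M') (hT : ∀ x, T (x + w) = T x)
    (f : G' → M) (k : ℕ) : (diffOp w ^ k) (fun x => T x (f (π x))) =
      fun x => T x ((diffOp (π w) ^ k) f (π x)) := by
  induction k generalizing f with
  | zero => rfl
  | succ k ih =>
    rw [pow_succ, pow_succ, Module.End.mul_apply, Module.End.mul_apply, ← ih]
    congr 1
    funext x
    simp only [diffOp_apply, hT, map_add, map_sub]

/-- `f` is a linear form times `Y`, up to a function on the quotient. -/
def IsLinearOver (lam : G →+ ℂ) (π : G →+ G') (Y : G' → M) (f : G → M) : Prop :=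
  ∃ Z : G' → M, ∀ x, f x = lam x • Y (π x) + Z (π x)

variable {lam : G →+ ℂ} {π : G →+ G'} {Y : G' → M} {f : G → M}

lemma IsLinearOver.diffOp_pow (h : IsLinearOver lam π Y f) (w : G) (k : ℕ) :
    IsLinearOver lam π ((diffOp (π w) ^ k) Y) ((diffOp w ^ k) f) := by
  induction k with
  | zero => exact h
  | succ k ih =>
    rw [pow_succ', pow_succ', Module.End.mul_apply, Module.End.mul_apply]
    obtain ⟨Z, hZ⟩ := ih
    refine ⟨fun y => Z (y + π w) - Z y + lam w • ((diffOp (π w) ^ k) Y) (y + π w), fun x => ?_⟩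
    simp only [diffOp_apply, hZ, map_add, smul_sub]
    module

lemma IsLinearOver.diffOp_eq_zero (h : IsLinearOver lam π Y f) {w : G} (hw : π w = 0) {k : ℕ}
    (hk : 2 ≤ k) : (diffOp w ^ k) f = 0 := by
  obtain ⟨j, rfl⟩ := Nat.exists_eq_add_of_le' hk
  obtain ⟨Z, hZ⟩ := h
  rw [pow_add, Module.End.mul_apply]
  have : (diffOp w ^ 2) f = 0 := by
    funext x
    simp only [pow_two, Module.End.mul_apply, diffOp_apply, hZ, map_add, hw, add_zero,
      Pi.zero_apply]
    module
  rw [this, map_zero]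

lemma IsLinearOver.eq_zero (h : IsLinearOver lam π Y 0)
    (hs : ∀ y, ∃ g g', π g = y ∧ π g' = y ∧ lam g ≠ lam g') : Y = 0 := by
  obtain ⟨Z, hZ⟩ := h
  funext y
  obtain ⟨g, g', rfl, hg', hne⟩ := hs y
  have e1 := hZ g
  have e2 := hZ g'
  rw [hg'] at e2
  have : (lam g - lam g') • Y (π g) = 0 := by
    rw [Pi.zero_apply] at e1 e2
    linear_combination (norm := module) e2 - e1
  exact (smul_eq_zero.1 this).resolve_left (sub_ne_zero.2 hne)

end differences

section collapse

variable {R : Type} [Ring R] [Algebra ℂ R] {L : ℤ → R}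

lemma altProd_eq_diffOp {G : Type} [AddCommGroup G] (e : G → R) (h : G) (m : ℕ) (γ δ : G) :
    altProd e h m γ δ = (diffOp ((-h, h) : G × G) ^ m) (fun q : G × G => e q.1 * e q.2) (γ, δ) := by
  rw [diffOp_pow]; rfl

end collapse

section collapse

variable {R : Type} [Ring R] [Algebra ℂ R] {L : ℤ → R}

lemma diffOp_pow_mul {G : Type} [AddCommGroup G] (K : R) (P : ℤ × ℤ → R) (π₁ π₂ : G →+ ℤ × ℤ)
    {u v : G} (hu₂ : π₂ u = 0) (hv₁ : π₁ v = 0) (m : ℕ) :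
    (diffOp u ^ m) ((diffOp v ^ m) (fun x => K * (P (π₁ x) * P (π₂ x)))) =
      fun x => K * ((diffOp (π₁ u) ^ m) P (π₁ x) * (diffOp (π₂ v) ^ m) P (π₂ x)) := by
  have e1 := diffOp_pow_comp v π₂ (fun x => LinearMap.mulLeft ℂ (K * P (π₁ x)))
    (fun x => by rw [map_add, hv₁, add_zero]) P m
  have e2 := diffOp_pow_comp u π₁ (fun x => (LinearMap.mulLeft ℂ K).comp
    (LinearMap.mulRight ℂ ((diffOp (π₂ v) ^ m) P (π₂ x))))
    (fun x => by rw [map_add, hu₂, add_zero]) P m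
  simp only [LinearMap.mulLeft_apply, LinearMap.mulRight_apply, LinearMap.comp_apply,
    mul_assoc] at e1 e2
  rw [e1, e2]

/-- If `K` kills all products of two alternating sums, it kills all longer single ones. -/
lemma altProd_collapse (hL : ∀ r s, L r * L s - L s * L r = ((s : ℂ) - r) • L (r + s)) (K : R)
    {m : ℕ} (hm : 2 ≤ m)
    (hK : ∀ a b c d, K * (altProd L 1 m a b * altProd L 1 m c d) = 0) (x y : ℤ) :
    K * altProd L 1 (4 * m) x y = 0 := by
  let P : ℤ × ℤ → R := fun q => L q.1 * L q.2
  have hP : ∀ q q', K * ((diffOp ((-1, 1) : ℤ × ℤ) ^ m) P q * (diffOp ((-1, 1) : ℤ × ℤ) ^ m) P q')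
      = 0 := by
    intro q q'
    have := hK q.1 q.2 q'.1 q'.2
    rwa [altProd_eq_diffOp, altProd_eq_diffOp] at this
  let p12 : ℤ × ℤ × ℤ × ℤ →+ ℤ × ℤ := AddMonoidHom.mk' (fun x => (x.1, x.2.1)) (fun _ _ => rfl)
  let p34 : ℤ × ℤ × ℤ × ℤ →+ ℤ × ℤ :=
    AddMonoidHom.mk' (fun x => (x.2.2.1, x.2.2.2)) (fun _ _ => rfl)
  let p32 : ℤ × ℤ × ℤ × ℤ →+ ℤ × ℤ := AddMonoidHom.mk' (fun x => (x.2.2.1, x.2.1)) (fun _ _ => rfl)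
  let p14 : ℤ × ℤ × ℤ × ℤ →+ ℤ × ℤ := AddMonoidHom.mk' (fun x => (x.1, x.2.2.2)) (fun _ _ => rfl)
  let w12 : ℤ × ℤ × ℤ × ℤ := (-1, 1, 0, 0)
  let w34 : ℤ × ℤ × ℤ × ℤ := (0, 0, -1, 1)
  let w32 : ℤ × ℤ × ℤ × ℤ := (0, 1, -1, 0)
  let w14 : ℤ × ℤ × ℤ × ℤ := (-1, 0, 0, 1)
  have h1 := diffOp_pow_mul K P p12 p34 (u := w12) (v := w34) rfl rfl m
  have h2 := diffOp_pow_mul K P p32 p14 (u := w32) (v := w14) rfl rfl m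
  have h1' : (diffOp w12 ^ m) ((diffOp w34 ^ m) (fun x => K * (P (p12 x) * P (p34 x)))) = 0 := by
    rw [h1]; funext x; exact hP _ _
  have h2' : (diffOp w32 ^ m) ((diffOp w14 ^ m) (fun x => K * (P (p32 x) * P (p14 x)))) = 0 := by
    rw [h2]; funext x; exact hP _ _
  let ψ₁ : ℤ × ℤ × ℤ × ℤ → R := fun x =>
    ((x.2.2.1 : ℂ) - x.2.1) • (K * (L x.1 * L (x.2.1 + x.2.2.1) * L x.2.2.2))
  let ψ₂ : ℤ × ℤ × ℤ × ℤ → R := fun x =>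
    ((x.2.2.1 : ℂ) - x.1) • (K * (L (x.1 + x.2.2.1) * L x.2.1 * L x.2.2.2))
  let ψ₃ : ℤ × ℤ × ℤ × ℤ → R := fun x =>
    ((x.2.1 : ℂ) - x.1) • (K * (L x.2.2.1 * L (x.1 + x.2.1) * L x.2.2.2))
  have hψ : ψ₂ = (fun x => K * (P (p12 x) * P (p34 x))) - (fun x => K * (P (p32 x) * P (p14 x)))
      - ψ₁ - ψ₃ := by
    funext ⟨a, b, c, d⟩
    change ((c : ℂ) - a) • (K * (L (a + c) * L b * L d)) =
      K * (L a * L b * (L c * L d)) - K * (L c * L b * (L a * L d))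
      - ((c : ℂ) - b) • (K * (L a * L (b + c) * L d)) -
      ((b : ℂ) - a) • (K * (L c * L (a + b) * L d))
    have e1 : ((c : ℂ) - a) • (K * (L (a + c) * L b * L d)) =
      K * ((L a * L c - L c * L a) * L b * L d) := by
      rw [hL]; simp only [smul_mul_assoc, mul_smul_comm]
    have e2 : ((c : ℂ) - b) • (K * (L a * L (b + c) * L d)) =
      K * (L a * (L b * L c - L c * L b) * L d) := by
      rw [hL]; simp only [smul_mul_assoc, mul_smul_comm]
    have e3 : ((b : ℂ) - a) • (K * (L c * L (a + b) * L d)) =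
      K * (L c * (L a * L b - L b * L a) * L d) := by
      rw [hL]; simp only [smul_mul_assoc, mul_smul_comm]
    rw [e1, e2, e3]
    noncomm_ring
  let c32 : ℤ × ℤ × ℤ × ℤ →+ ℂ := AddMonoidHom.mk' (fun x => (x.2.2.1 : ℂ) - x.2.1)
    (fun x y => by simp only [Prod.fst_add, Prod.snd_add]; push_cast; ring)
  let c31 : ℤ × ℤ × ℤ × ℤ →+ ℂ := AddMonoidHom.mk' (fun x => (x.2.2.1 : ℂ) - x.1)
    (fun x y => by simp only [Prod.fst_add, Prod.snd_add]; push_cast; ring)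
  let c21 : ℤ × ℤ × ℤ × ℤ →+ ℂ := AddMonoidHom.mk' (fun x => (x.2.1 : ℂ) - x.1)
    (fun x y => by simp only [Prod.fst_add, Prod.snd_add]; push_cast; ring)
  let q1 : ℤ × ℤ × ℤ × ℤ →+ ℤ × ℤ × ℤ := AddMonoidHom.mk' (fun x => (x.1, x.2.1 + x.2.2.1, x.2.2.2))
    (fun x y => by simp only [Prod.fst_add, Prod.snd_add, Prod.mk_add_mk, add_add_add_comm])
  let q2 : ℤ × ℤ × ℤ × ℤ →+ ℤ × ℤ × ℤ := AddMonoidHom.mk' (fun x => (x.1 + x.2.2.1, x.2.1, x.2.2.2))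
    (fun x y => by simp only [Prod.fst_add, Prod.snd_add, Prod.mk_add_mk, add_add_add_comm])
  let q3 : ℤ × ℤ × ℤ × ℤ →+ ℤ × ℤ × ℤ := AddMonoidHom.mk' (fun x => (x.2.2.1, x.1 + x.2.1, x.2.2.2))
    (fun x y => by simp only [Prod.fst_add, Prod.snd_add, Prod.mk_add_mk, add_add_add_comm])
  let χ : ℤ × ℤ × ℤ → R := fun y => K * (L y.1 * L y.2.1 * L y.2.2)
  have l1 : IsLinearOver c32 q1 χ ψ₁ := ⟨0, fun x => by simp only [Pi.zero_apply, add_zero]; rfl⟩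
  have l2 : IsLinearOver c31 q2 χ ψ₂ := ⟨0, fun x => by simp only [Pi.zero_apply, add_zero]; rfl⟩
  have l3 : IsLinearOver c21 q3 χ ψ₃ := ⟨0, fun x => by simp only [Pi.zero_apply, add_zero]; rfl⟩
  have z1 : (diffOp w32 ^ m) ψ₁ = 0 := l1.diffOp_eq_zero rfl hm
  have z3 : (diffOp w12 ^ m) ψ₃ = 0 := l3.diffOp_eq_zero rfl hm
  have hU : (diffOp w12 ^ m) ((diffOp w34 ^ m) ((diffOp w32 ^ m) ((diffOp w14 ^ m) ψ₂))) = 0 := by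
    have cm : ∀ (u v : ℤ × ℤ × ℤ × ℤ) (f : ℤ × ℤ × ℤ × ℤ → R), (diffOp u ^ m) ((diffOp v ^ m) f) =
        (diffOp v ^ m) ((diffOp u ^ m) f) := fun u v f =>
      LinearMap.congr_fun ((diffOp_commute u v).pow_pow m m).eq f
    rw [hψ]
    simp only [map_sub]
    rw [h2', cm w34 w32, cm w12 w32, cm w34 w14, cm w12 w14, h1', cm w32 w14 ψ₁, z1,
      cm w12 w34 ((diffOp w32 ^ m) ((diffOp w14 ^ m) ψ₃)), cm w12 w32 ((diffOp w14 ^ m) ψ₃),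
      cm w12 w14 ψ₃, z3]
    simp only [map_zero, sub_zero]
  have l4 := (((l2.diffOp_pow w14 m).diffOp_pow w32 m).diffOp_pow w34 m).diffOp_pow w12 m
  rw [hU] at l4
  have hχ := l4.eq_zero (fun y => ⟨(y.1, y.2.1, 0, y.2.2), (y.1 - 1, y.2.1, 1, y.2.2),
    by simp [q2], by simp [q2], by
      simp only [c31, AddMonoidHom.mk'_apply]
      push_cast
      intro h
      have : (2 : ℂ) = 0 := by linear_combination -h
      norm_num at this⟩)
  change (diffOp ((-1, 1, 0) : ℤ × ℤ × ℤ) ^ m) ((diffOp ((-1, 0, 1) : ℤ × ℤ × ℤ) ^ m)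
    ((diffOp ((-1, 1, 0) : ℤ × ℤ × ℤ) ^ m) ((diffOp ((-1, 0, 1) : ℤ × ℤ × ℤ) ^ m) χ))) = 0 at hχ
  set u : ℤ × ℤ × ℤ := (-1, 1, 0) with hu
  set v : ℤ × ℤ × ℤ := (-1, 0, 1) with hv
  let σ : ℤ × ℤ × ℤ →+ ℤ × ℤ × ℤ := AddMonoidHom.mk' (fun x => (x.1, x.2.2, x.2.1)) (fun _ _ => rfl)
  have hσ : ∀ (w : ℤ × ℤ × ℤ) (f : ℤ × ℤ × ℤ → R), (diffOp w ^ m) (fun x => f (σ x)) =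
      fun x => ((diffOp (σ w) ^ m) f) (σ x) := fun w f =>
    diffOp_pow_comp w σ (fun _ => LinearMap.id) (fun _ => rfl) f m
  have hχ' : (diffOp u ^ m) ((diffOp v ^ m) ((diffOp u ^ m) ((diffOp v ^ m)
      (fun x => χ (σ x))))) = 0 := by
    rw [hσ v, show σ v = u from rfl, hσ u, show σ u = v from rfl, hσ v, show σ v = u from rfl,
      hσ u, show σ u = v from rfl]
    have cm : ∀ (f : ℤ × ℤ × ℤ → R), (diffOp v ^ m) ((diffOp u ^ m) f) =
        (diffOp u ^ m) ((diffOp v ^ m) f) := fun f =>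
      LinearMap.congr_fun ((diffOp_commute v u).pow_pow m m).eq f
    rw [cm χ, cm, hχ]
    rfl
  let c : ℤ × ℤ × ℤ →+ ℂ := AddMonoidHom.mk' (fun x => (x.2.2 : ℂ) - x.2.1)
    (fun x y => by simp only [Prod.fst_add, Prod.snd_add]; push_cast; ring)
  let q : ℤ × ℤ × ℤ →+ ℤ × ℤ := AddMonoidHom.mk' (fun x => (x.1, x.2.1 + x.2.2))
    (fun x y => by simp only [Prod.fst_add, Prod.snd_add, Prod.mk_add_mk, add_add_add_comm])
  have l : IsLinearOver c q (fun y => K * (L y.1 * L y.2)) (χ - fun x => χ (σ x)) := by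
    refine ⟨0, fun ⟨a, b, d⟩ => ?_⟩
    change K * (L a * L b * L d) - K * (L a * L d * L b) =
      ((d : ℂ) - b) • (K * (L a * L (b + d))) + 0
    rw [← mul_smul_comm, ← mul_smul_comm, ← hL]
    noncomm_ring
  have l' := (((l.diffOp_pow v m).diffOp_pow u m).diffOp_pow v m).diffOp_pow u m
  simp only [map_sub] at l'
  rw [hχ, hχ', sub_zero] at l'
  have hω := l'.eq_zero (fun y => ⟨(y.1, 0, y.2), (y.1, 1, y.2 - 1), by simp [q], by simp [q], by
    simp only [c, AddMonoidHom.mk'_apply]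
    push_cast
    intro h
    have : (2 : ℂ) = 0 := by linear_combination h
    norm_num at this⟩)
  rw [show q u = (-1, 1) from rfl, show q v = (-1, 1) from rfl] at hω
  simp only [← Module.End.mul_apply, ← pow_add] at hω
  have := diffOp_pow_comp ((-1, 1) : ℤ × ℤ) (AddMonoidHom.id _) (fun _ => LinearMap.mulLeft ℂ K)
    (fun _ => rfl) (fun q : ℤ × ℤ => L q.1 * L q.2) (4 * m)
  rw [altProd_eq_diffOp]
  refine Eq.trans (congrFun this (x, y)).symm ?_
  rw [show 4 * m = m + (m + (m + m)) by ring]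
  exact congrFun hω (x, y)

end collapse

section collapse

variable {R : Type} [Ring R] [Algebra ℂ R] {L : ℤ → R}

lemma altProd_succ {G : Type} [AddCommGroup G] (e : G → R) (h : G) (m : ℕ) (γ δ : G) :
    altProd e h (m + 1) γ δ = altProd e h m (γ - h) (δ + h) - altProd e h m γ δ := by
  simp only [altProd_eq_diffOp, pow_succ', Module.End.mul_apply, diffOp_apply, Prod.mk_add_mk,
    sub_eq_add_neg]

lemma altProd_eq_zero_of_le {G : Type} [AddCommGroup G] {e : G → R} {h : G} {m m' : ℕ}
    (hm : m ≤ m') (h0 : ∀ γ δ, altProd e h m γ δ = 0) (γ δ : G) : altProd e h m' γ δ = 0 := by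
  induction m', hm using Nat.le_induction generalizing γ δ with
  | base => exact h0 γ δ
  | succ k _ ih => rw [altProd_succ, ih, ih, sub_zero]

/-- The span of the alternating sums of order `m`. -/
def altSpan (L : ℤ → R) (m : ℕ) : Submodule ℂ R :=
  Submodule.span ℂ (Set.range fun q : ℤ × ℤ => altProd L 1 m q.1 q.2)

lemma altProd_mem_altSpan (L : ℤ → R) (m : ℕ) (a b : ℤ) : altProd L 1 m a b ∈ altSpan L m :=
  Submodule.subset_span ⟨(a, b), rfl⟩

lemma altSpan_antitone (L : ℤ → R) : Antitone (altSpan L) := by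
  refine antitone_nat_of_succ_le fun m => Submodule.span_le.2 ?_
  rintro _ ⟨⟨a, b⟩, rfl⟩
  change altProd L 1 (m + 1) a b ∈ altSpan L m
  rw [altProd_succ]
  exact sub_mem (altProd_mem_altSpan _ _ _ _) (altProd_mem_altSpan _ _ _ _)

lemma altSpan_pow_collapse (hL : ∀ r s, L r * L s - L s * L r = ((s : ℂ) - r) • L (r + s))
    {m r : ℕ} (hm : 2 ≤ m) (h : altSpan L m ^ (r + 2) = ⊥) : altSpan L (4 * m) ^ (r + 1) = ⊥ := by
  have hmul : altSpan L m ^ r * altSpan L (4 * m) ≤ ⊥ := by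
    refine Submodule.mul_le.2 fun K hK x hx => ?_
    induction hx using Submodule.span_induction with
    | mem x hx =>
      obtain ⟨⟨a, b⟩, rfl⟩ := hx
      refine (Submodule.mem_bot ℂ).2 (altProd_collapse hL K hm (fun a b c d => ?_) a b)
      rw [← Submodule.mem_bot ℂ, ← h, pow_add, pow_two]
      exact Submodule.mul_mem_mul hK
        (Submodule.mul_mem_mul (altProd_mem_altSpan _ _ _ _) (altProd_mem_altSpan _ _ _ _))
    | zero => rw [mul_zero]; exact zero_mem _
    | add x y _ _ hx hy => rw [mul_add]; exact add_mem hx hy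
    | smul c x _ hx => rw [mul_smul_comm]; exact Submodule.smul_mem _ _ hx
  refine le_bot_iff.1 (le_trans ?_ hmul)
  rw [pow_succ]
  exact mul_le_mul' (pow_le_pow_left' (altSpan_antitone L (by omega)) r) le_rfl

lemma exists_altProd_eq_zero (hL : ∀ r s, L r * L s - L s * L r = ((s : ℂ) - r) • L (r + s))
    {m r : ℕ} (hm : 2 ≤ m) (h : altSpan L m ^ (r + 1) = ⊥) :
    ∃ M, ∀ a b, altProd L 1 M a b = 0 := by
  induction r generalizing m with
  | zero =>
    refine ⟨m, fun a b => ?_⟩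
    rw [zero_add, pow_one] at h
    rw [← Submodule.mem_bot ℂ, ← h]
    exact altProd_mem_altSpan _ _ _ _
  | succ r ih => exact ih (by omega) (altSpan_pow_collapse hL hm h)

end collapse

section cuspidal

variable {V : Type} [AddCommGroup V] [Module ℂ V] {L : ℤ → Module.End ℂ V} {N : ℕ}

lemma IsCuspidalWitt.mul_sub_mul (h : IsCuspidalWitt L N) (r s : ℤ) :
    L r * L s - L s * L r = ((s : ℂ) - r) • L (r + s) :=
  LinearMap.ext fun v => h.comm r s v

lemma IsCuspidalWitt.exists_altProd_eq_zero (h : IsCuspidalWitt L N)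
    (htop : (⨆ x : ℂ, Module.End.eigenspace (L 0) x) = ⊤) :
    ∃ M, ∀ a b, altProd L 1 M a b = 0 := by
  refine _root_.exists_altProd_eq_zero h.mul_sub_mul (m := 8) (r := 2 * N) (by omega) ?_
  rw [altSpan, Submodule.span_pow, Submodule.span_eq_bot]
  intro x hx
  obtain ⟨f, rfl⟩ := Set.mem_pow.1 hx
  choose q hq using fun i => (f i).2
  have := h.word_eq_zero htop (List.ofFn q) (by simp)
  rw [List.map_ofFn] at this
  rw [← this]
  congr 2
  funext i
  exact (hq i).symm

end cuspidal

section density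

variable {R G : Type} [Ring R] [Algebra ℂ R] [AddCommGroup G] {e : G → R} {lam : G →+ ℂ}

lemma diffOp_pow_lattice (e : G → R) (h γ δ : G) (m : ℕ) (a b : ℤ) :
    (diffOp ((-1, 1) : ℤ × ℤ) ^ m) (fun q : ℤ × ℤ => e (γ + q.1 • h) * e (δ + q.2 • h)) (a, b) =
      altProd e h m (γ + a • h) (δ + b • h) := by
  induction m generalizing a b with
  | zero => rfl
  | succ m ih =>
    rw [altProd_succ, pow_succ', Module.End.mul_apply, diffOp_apply, ih, Prod.mk_add_mk, ih]
    congr 2 <;> module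

lemma altProd_step (he : ∀ α β, e α * e β - e β * e α = lam (β - α) • e (α + β)) {h : G}
    (hh : lam h ≠ 0) {m : ℕ} {γ : G}
    (hm : (diffOp ((-1, 1) : ℤ × ℤ) ^ m) (fun q : ℤ × ℤ => e (γ + q.1 • h) * e (0 + q.2 • h)) = 0)
    (δ : G) :
    (diffOp ((-1, 1) : ℤ × ℤ) ^ (2 + m))
      (fun q : ℤ × ℤ => e (γ + δ + q.1 • h) * e (0 + q.2 • h)) = 0 ∧
    (diffOp ((-1, 1) : ℤ × ℤ) ^ (2 + m))
      (fun q : ℤ × ℤ => e (γ + q.1 • h) * e (δ + q.2 • h)) = 0 := by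
  let A : ℤ × ℤ × ℤ → R := fun x => lam (γ + x.1 • h - (δ + x.2.2 • h)) •
    (e (γ + δ + (x.1 + x.2.2) • h) * e (0 + x.2.1 • h))
  let B : ℤ × ℤ × ℤ → R := fun x => lam (0 + x.2.1 • h - (δ + x.2.2 • h)) •
    (e (γ + x.1 • h) * e (δ + (x.2.1 + x.2.2) • h))
  let w : ℤ × ℤ × ℤ := (-1, 1, 0)
  let p : ℤ × ℤ × ℤ →+ ℤ × ℤ := AddMonoidHom.mk' (fun x => (x.1, x.2.1)) (fun _ _ => rfl)
  have hAB : (diffOp w ^ m) A + (diffOp w ^ m) B = 0 := by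
    have := diffOp_pow_comp w p (fun x => LinearMap.mulLeft ℂ (e (δ + x.2.2 • h)) -
      LinearMap.mulRight ℂ (e (δ + x.2.2 • h))) (fun x => by simp [w])
      (fun q : ℤ × ℤ => e (γ + q.1 • h) * e (0 + q.2 • h)) m
    rw [show p w = (-1, 1) from rfl, hm] at this
    rw [← map_add]
    refine Eq.trans (congrArg _ ?_) (this.trans ?_)
    · funext ⟨a, b, c⟩
      change lam (γ + a • h - (δ + c • h)) • (e (γ + δ + (a + c) • h) * e (0 + b • h)) +
        lam (0 + b • h - (δ + c • h)) • (e (γ + a • h) * e (δ + (b + c) • h)) =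
        e (δ + c • h) * (e (γ + a • h) * e (0 + b • h)) -
        e (γ + a • h) * e (0 + b • h) * e (δ + c • h)
      rw [show γ + δ + (a + c) • h = (δ + c • h) + (γ + a • h) by module,
        show δ + (b + c) • h = (δ + c • h) + (0 + b • h) by module, ← smul_mul_assoc,
        ← mul_smul_comm, ← he, ← he]
      noncomm_ring
    · funext x
      exact map_zero _
  let lA : ℤ × ℤ × ℤ →+ ℂ := AddMonoidHom.mk' (fun x => ((x.1 : ℂ) - x.2.2) * lam h)
    (fun x y => by simp only [Prod.fst_add, Prod.snd_add]; push_cast; ring)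
  let lB : ℤ × ℤ × ℤ →+ ℂ := AddMonoidHom.mk' (fun x => ((x.2.1 : ℂ) - x.2.2) * lam h)
    (fun x y => by simp only [Prod.fst_add, Prod.snd_add]; push_cast; ring)
  let qA : ℤ × ℤ × ℤ →+ ℤ × ℤ := AddMonoidHom.mk' (fun x => (x.1 + x.2.2, x.2.1))
    (fun x y => by simp only [Prod.fst_add, Prod.snd_add, Prod.mk_add_mk, add_add_add_comm])
  let qB : ℤ × ℤ × ℤ →+ ℤ × ℤ := AddMonoidHom.mk' (fun x => (x.1, x.2.1 + x.2.2))
    (fun x y => by simp only [Prod.fst_add, Prod.snd_add, Prod.mk_add_mk, add_add_add_comm])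
  have hA : IsLinearOver lA qA (fun q : ℤ × ℤ => e (γ + δ + q.1 • h) * e (0 + q.2 • h)) A := by
    refine ⟨fun q => lam (γ - δ) • (e (γ + δ + q.1 • h) * e (0 + q.2 • h)), fun x => ?_⟩
    rw [← add_smul]
    change lam (γ + x.1 • h - (δ + x.2.2 • h)) • _ = ((((x.1 : ℂ) - x.2.2) * lam h) + _) • _
    congr 1
    simp only [map_add, map_sub, map_zsmul, zsmul_eq_mul]
    ring
  have hB : IsLinearOver lB qB (fun q : ℤ × ℤ => e (γ + q.1 • h) * e (δ + q.2 • h)) B := by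
    refine ⟨fun q => lam (-δ) • (e (γ + q.1 • h) * e (δ + q.2 • h)), fun x => ?_⟩
    rw [← add_smul]
    change lam (0 + x.2.1 • h - (δ + x.2.2 • h)) • _ = ((((x.2.1 : ℂ) - x.2.2) * lam h) + _) • _
    congr 1
    simp only [map_add, map_sub, map_zsmul, zsmul_eq_mul, map_neg, map_zero]
    ring
  have cm : ∀ (u v : ℤ × ℤ × ℤ) (k l : ℕ) (f : ℤ × ℤ × ℤ → R),
      (diffOp u ^ k) ((diffOp v ^ l) f) = (diffOp v ^ l) ((diffOp u ^ k) f) := fun u v k l f =>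
    LinearMap.congr_fun ((diffOp_commute u v).pow_pow k l).eq f
  constructor
  · let u : ℤ × ℤ × ℤ := (0, 1, -1)
    have h1 := (hA.diffOp_pow w m).diffOp_pow u 2
    have h2 := congrArg (fun f => (diffOp u ^ 2) f) hAB
    simp only [map_add, map_zero] at h2
    rw [cm u w 2 m B, hB.diffOp_eq_zero (w := u) rfl le_rfl, map_zero, add_zero] at h2
    rw [h2] at h1
    have := h1.eq_zero (fun y => ⟨(y.1, y.2, 0), (y.1 - 1, y.2, 1), by simp [qA], by simp [qA], by
      simp only [lA, AddMonoidHom.mk'_apply]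
      push_cast
      intro h'
      have : 2 * lam h = 0 := by linear_combination h'
      simp [hh] at this⟩)
    rw [pow_add]
    exact this
  · let u : ℤ × ℤ × ℤ := (-1, 0, 1)
    have h1 := (hB.diffOp_pow w m).diffOp_pow u 2
    have h2 := congrArg (fun f => (diffOp u ^ 2) f) hAB
    simp only [map_add, map_zero] at h2
    rw [cm u w 2 m A, hA.diffOp_eq_zero (w := u) rfl le_rfl, map_zero, zero_add] at h2
    rw [h2] at h1
    have := h1.eq_zero (fun y => ⟨(y.1, y.2, 0), (y.1, y.2 - 1, 1), by simp [qB], by simp [qB], by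
      simp only [lB, AddMonoidHom.mk'_apply]
      push_cast
      intro h'
      have : 2 * lam h = 0 := by linear_combination h'
      simp [hh] at this⟩)
    rw [pow_add]
    exact this

/-- Alternating sums vanishing along a rank-one direction vanish on the whole lattice. -/
lemma altProd_extend (he : ∀ α β, e α * e β - e β * e α = lam (β - α) • e (α + β)) {h : G}
    (hh : lam h ≠ 0) {M : ℕ} (hM : ∀ a b : ℤ, altProd (fun k : ℤ => e (k • h)) 1 M a b = 0)
    (γ δ : G) : altProd e h (2 + (2 + M)) γ δ = 0 := by
  have h0 : (diffOp ((-1, 1) : ℤ × ℤ) ^ M)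
      (fun q : ℤ × ℤ => e ((0 : G) + q.1 • h) * e (0 + q.2 • h)) = 0 := by
    funext ⟨a, b⟩
    have := hM a b
    rw [altProd_eq_diffOp] at this
    simpa only [zero_add, Pi.zero_apply] using this
  have h1 := (altProd_step he hh h0 γ).1
  rw [zero_add] at h1
  have h2 := congrFun (altProd_step he hh h1 δ).2 (0, 0)
  rwa [diffOp_pow_lattice, zero_smul, add_zero, add_zero] at h2

end density

section lieTheorem

attribute [local instance] LieRing.ofAssociativeRing

variable {A : Type} [CommRing A] [Algebra ℂ A] {E : Type} [AddCommGroup E] [Module ℂ E]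

/-- Lie's theorem for a space of derivations `f ∂`, `f ∈ 𝔪`, acting nilpotently. -/
lemma exists_common_eigenvector_of_pow [FiniteDimensional ℂ E] [Nontrivial E]
    (d : Derivation ℂ A A) (𝔪 : Ideal A) (Φ : A →ₗ[ℂ] Module.End ℂ E)
    (hΦ : ∀ f ∈ 𝔪, ∀ g ∈ 𝔪, Φ f * Φ g - Φ g * Φ f = Φ (f * d g - g * d f)) {k : ℕ}
    (hk : ∀ f ∈ 𝔪 ^ k, Φ f = 0) :
    ∃ v : E, v ≠ 0 ∧ ∀ f ∈ 𝔪, ∃ c : ℂ, Φ f v = c • v := by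
  have hmem : ∀ f ∈ 𝔪, ∀ g ∈ 𝔪, f * d g - g * d f ∈ 𝔪 := fun f hf g hg =>
    sub_mem (𝔪.mul_mem_right _ hf) (𝔪.mul_mem_right _ hg)
  have hd : ∀ f ∈ 𝔪, ∀ g ∈ 𝔪, d (f * d g - g * d f) ∈ 𝔪 := by
    intro f hf g hg
    have : d (f * d g - g * d f) = f * d (d g) - g * d (d f) := by
      simp only [map_sub, Derivation.leibniz, smul_eq_mul]
      ring
    rw [this]
    exact sub_mem (𝔪.mul_mem_right _ hf) (𝔪.mul_mem_right _ hg)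
  let 𝔤 : LieSubalgebra ℂ (Module.End ℂ E) :=
    { (𝔪.restrictScalars ℂ).map Φ with
      lie_mem' := by
        rintro _ _ ⟨f, hf, rfl⟩ ⟨g, hg, rfl⟩
        rw [LieRing.of_associative_ring_bracket]
        exact ⟨_, hmem f hf g hg, (hΦ f hf g hg).symm⟩ }
  have hder : ∀ j, ∀ x ∈ LieAlgebra.derivedSeries ℂ 𝔤 (j + 1),
      ∃ f ∈ 𝔪 ^ (j + 1), f ∈ 𝔪 ∧ d f ∈ 𝔪 ∧ Φ f = (x : Module.End ℂ E) := by
    have key : ∀ (j : ℕ) (I : LieIdeal ℂ 𝔤), (∀ x ∈ ⁅I, I⁆, ∃ f ∈ 𝔪 ^ (j + 1), f ∈ 𝔪 ∧ d f ∈ 𝔪 ∧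
        Φ f = (x : Module.End ℂ E)) ↔ ∀ x ∈ I, ∀ y ∈ I, ∃ f ∈ 𝔪 ^ (j + 1), f ∈ 𝔪 ∧ d f ∈ 𝔪 ∧
        Φ f = ((⁅x, y⁆ : 𝔤) : Module.End ℂ E) := by
      intro j I
      refine ⟨fun h x hx y hy => h _ (LieSubmodule.lie_mem_lie hx hy), fun h x hx => ?_⟩
      rw [← LieSubmodule.mem_toSubmodule, LieSubmodule.lieIdeal_oper_eq_linear_span'] at hx
      induction hx using Submodule.span_induction with
      | mem x hx =>
        obtain ⟨y, hy, z, hz, rfl⟩ := hx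
        exact h y hy z hz
      | zero => exact ⟨0, zero_mem _, zero_mem _, by rw [map_zero]; exact zero_mem _, map_zero _⟩
      | add x y _ _ hx hy =>
        obtain ⟨f, h1, h2, h3, h4⟩ := hx
        obtain ⟨g, h1', h2', h3', h4'⟩ := hy
        exact ⟨f + g, add_mem h1 h1', add_mem h2 h2', by rw [map_add]; exact add_mem h3 h3',
          by rw [map_add, h4, h4']; rfl⟩
      | smul c x _ hx =>
        obtain ⟨f, h1, h2, h3, h4⟩ := hx
        have sm : ∀ (I : Ideal A) (g : A), g ∈ I → c • g ∈ I := fun I g hg =>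
          (I.restrictScalars ℂ).smul_mem c hg
        exact ⟨c • f, sm _ _ h1, sm _ _ h2, by rw [Derivation.map_smul]; exact sm _ _ h3,
          by rw [map_smul, h4]; rfl⟩
    intro j
    induction j with
    | zero =>
      refine (key 0 ⊤).2 ?_
      rintro ⟨_, f, hf, rfl⟩ - ⟨_, g, hg, rfl⟩ -
      refine ⟨_, ?_, hmem f hf g hg, hd f hf g hg, (hΦ f hf g hg).symm⟩
      rw [zero_add, pow_one]
      exact hmem f hf g hg
    | succ j ih =>
      rw [LieAlgebra.derivedSeries_def, LieAlgebra.derivedSeriesOfIdeal_succ]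
      refine (key (j + 1) _).2 ?_
      intro x hx y hy
      obtain ⟨f, h1, h2, h3, h4⟩ := ih x hx
      obtain ⟨g, h1', h2', h3', h4'⟩ := ih y hy
      refine ⟨_, ?_, hmem f h2 g h2', hd f h2 g h2', (hΦ f h2 g h2').symm.trans ?_⟩
      · rw [pow_succ]
        exact sub_mem (Ideal.mul_mem_mul h1 h3') (Ideal.mul_mem_mul h1' h3)
      · rw [h4, h4']; rfl
  have hsolv : LieAlgebra.IsSolvable 𝔤 := by
    refine LieAlgebra.IsSolvable.mk (R := ℂ) (k := k + 1) ?_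
    rw [LieSubmodule.eq_bot_iff]
    intro x hx
    obtain ⟨f, h1, -, -, h4⟩ := hder k x hx
    rw [hk f (Ideal.pow_le_pow_right (Nat.le_succ k) h1)] at h4
    exact Subtype.ext h4.symm
  obtain ⟨χ, hχ⟩ := LieModule.exists_nontrivial_weightSpace_of_isSolvable ℂ 𝔤 E
  obtain ⟨⟨v, hv⟩, hv0⟩ := exists_ne (0 : LieModule.weightSpace E χ)
  rw [LieModule.mem_weightSpace] at hv
  exact ⟨v, fun h => hv0 (Subtype.ext h), fun f hf => ⟨_, hv ⟨Φ f, f, hf, rfl⟩⟩⟩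

end lieTheorem

section densityEigenvector

variable {G : Type} [AddCommGroup G] {lam : G →+ ℂ}

/-- Solutions of the cocycle-type equation are multiples of `lam`. -/
lemma exists_eq_mul_of_witt (hlam : ∀ α, α ≠ 0 → lam α ≠ 0) {χ : G → ℂ} (h0 : χ 0 = 0)
    (h : ∀ α β, lam (β - α) * χ (α + β) = lam β * χ β - lam α * χ α) :
    ∃ b, ∀ α, χ α = b * lam α := by
  by_cases hG : ∃ α : G, α ≠ 0
  · obtain ⟨α, hα⟩ := hG
    have hα' := hlam α hα
    refine ⟨χ α / lam α, fun γ => ?_⟩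
    obtain ⟨β, rfl⟩ : ∃ β, γ = α + β := ⟨γ - α, by abel⟩
    by_cases hβ : β = 0
    · subst hβ; rw [add_zero]; field_simp
    have hneg : χ (-β) = -χ β := by
      have e := h β (-β)
      rw [add_neg_cancel, h0, map_neg] at e
      have := hlam β hβ
      have e' : lam β * (χ (-β) + χ β) = 0 := by linear_combination e
      linear_combination (mul_eq_zero.1 e').resolve_left this
    have e1 := h α β
    have e2 := h (α + β) (-β)
    rw [add_neg_cancel_right, hneg] at e2
    simp only [map_sub, map_add, map_neg] at e1 e2 ⊢
    have : 2 * lam α * χ (α + β) = 2 * (lam α + lam β) * χ α := by linear_combination e2 - e1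
    field_simp
    linear_combination this / 2
  · push Not at hG
    exact ⟨0, fun α => by rw [hG α, h0, map_zero, mul_zero]⟩

set_option maxHeartbeats 1000000 in
/-- A finite-dimensional space with operators `D α` satisfying the twisted Witt relations and
vanishing higher differences has a vector on which `D α` acts by an affine function of `α`. -/
lemma exists_density_eigenvector {n : ℕ} {lam : Zn n →+ ℂ} (hlam : ∀ α, α ≠ 0 → lam α ≠ 0)
    {E : Type} [AddCommGroup E] [Module ℂ E] [FiniteDimensional ℂ E] [Nontrivial E]
    (D : Zn n → Module.End ℂ E) {a : ℂ} (h0 : D 0 = a • 1)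
    (hD : ∀ α β, D α * D β - D β * D α = lam (β - α) • D (α + β) - lam β • D β + lam α • D α)
    {m : ℕ} (hdiff : ∀ i α, ∑ k ∈ Finset.range (m + 1), ((-1 : ℤ) ^ (m - k) * (m.choose k : ℤ)) •
      D (α + k • Pi.single i 1) = 0) :
    ∃ v : E, v ≠ 0 ∧ ∃ b : ℂ, ∀ α, D α v = (a + b * lam α) • v := by
  let A := AddMonoidAlgebra ℂ (Zn n)
  let t : Zn n → A := fun α => AddMonoidAlgebra.single α 1
  have ht : ∀ α β, t α * t β = t (α + β) := fun α β => by
    rw [AddMonoidAlgebra.single_mul_single, one_mul]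
  have ht0 : t 0 = 1 := AddMonoidAlgebra.one_def.symm
  have htp : ∀ α (k : ℕ), t α ^ k = t (k • α) := fun α k => by
    rw [AddMonoidAlgebra.single_pow, one_pow]
  have ind : ∀ (p : A → Prop) (h1 : ∀ α, p (t α)) (h2 : ∀ x y, p x → p y → p (x + y))
      (h3 : ∀ (c : ℂ) x, p x → p (c • x)) x, p x := fun p h1 h2 h3 x =>
    AddMonoidAlgebra.induction_on x h1 h2 h3
  let lin : ∀ {M : Type} [AddCommGroup M] [Module ℂ M], (Zn n → M) → A →ₗ[ℂ] M := fun f =>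
    (Finsupp.linearCombination ℂ f).comp (AddMonoidAlgebra.coeffLinearEquiv ℂ).toLinearMap
  have lin_t : ∀ {M : Type} [AddCommGroup M] [Module ℂ M] (f : Zn n → M) (α), lin f (t α) = f α := by
    intro M _ _ f α
    change Finsupp.linearCombination ℂ f (Finsupp.single α 1) = f α
    rw [Finsupp.linearCombination_single, one_smul]
  let Φ : A →ₗ[ℂ] Module.End ℂ E := lin D
  have hΦt : ∀ α, Φ (t α) = D α := lin_t D
  let ε : A →ₐ[ℂ] ℂ := AddMonoidAlgebra.lift ℂ ℂ (Zn n) 1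
  have hε : ∀ α, ε (t α) = 1 := fun α => by
    rw [AddMonoidAlgebra.lift_single, one_smul]; rfl
  let d₀ : A →ₗ[ℂ] A := lin fun α => lam α • t α
  have hd₀ : ∀ α, d₀ (t α) = lam α • t α := lin_t _
  let d : Derivation ℂ A A := Derivation.mk' d₀ (by
    intro x y
    induction x using ind with
    | h1 α =>
      induction y using ind with
      | h1 β =>
        rw [ht, hd₀, hd₀, hd₀, smul_eq_mul, smul_eq_mul, mul_smul_comm, mul_smul_comm, ht, ht,
          add_comm β α, map_add, add_smul, add_comm]
      | h2 y z hy hz => rw [mul_add, map_add, hy, hz, map_add, smul_add, add_smul]; abel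
      | h3 c y hy => rw [mul_smul_comm, map_smul, hy, map_smul, smul_add, smul_comm c, smul_assoc]
    | h2 x z hx hz => rw [add_mul, map_add, hx, hz, map_add, smul_add, add_smul]; abel
    | h3 c x hx => rw [smul_mul_assoc, map_smul, hx, map_smul, smul_add, smul_comm c y, smul_assoc])
  have hd : ∀ α, d (t α) = lam α • t α := hd₀
  have hbr : ∀ f g, Φ f * Φ g - Φ g * Φ f = Φ (f * d g - g * d f) - ε f • Φ (d g) +
      ε g • Φ (d f) := by
    intro f g
    induction f using ind with
    | h1 α =>
      induction g using ind with
      | h1 β =>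
        rw [hd, hd, hε, hε, mul_smul_comm, mul_smul_comm, ht, ht, add_comm β α, ← sub_smul,
          ← map_sub, map_smul, map_smul, map_smul, hΦt, hΦt, hΦt, hD, one_smul, one_smul]
      | h2 y z hy hz =>
        simp only [map_add, mul_add, add_mul, add_smul, smul_add, map_sub] at hy hz ⊢
        linear_combination (norm := module) hy + hz
      | h3 c y hy =>
        simp only [map_smul, mul_smul_comm, smul_mul_assoc, map_sub, smul_eq_mul,
          Derivation.map_smul] at hy ⊢
        linear_combination (norm := module) c • hy
    | h2 y z hy hz =>
      simp only [map_add, mul_add, add_mul, add_smul, smul_add, map_sub] at hy hz ⊢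
      linear_combination (norm := module) hy + hz
    | h3 c y hy =>
      simp only [map_smul, mul_smul_comm, smul_mul_assoc, map_sub, smul_eq_mul,
        Derivation.map_smul] at hy ⊢
      linear_combination (norm := module) c • hy
  let s : Fin n → A := fun i => t (Pi.single i 1) - 1
  let 𝔪 : Ideal A := Ideal.span (Set.range s)
  have hε𝔪 : ∀ f ∈ 𝔪, ε f = 0 := by
    intro f hf
    have : 𝔪 ≤ RingHom.ker ε := by
      refine Ideal.span_le.2 ?_
      rintro _ ⟨i, rfl⟩
      change ε (t _ - 1) = 0
      rw [map_sub, hε, map_one, sub_self]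
    exact this hf
  have ht𝔪 : ∀ α, t α - 1 ∈ 𝔪 := by
    let S : AddSubgroup (Zn n) :=
      { carrier := {α | t α - 1 ∈ 𝔪}
        zero_mem' := by change t 0 - 1 ∈ 𝔪; rw [ht0, sub_self]; exact zero_mem _
        add_mem' := by
          intro α β (hα : t α - 1 ∈ 𝔪) (hβ : t β - 1 ∈ 𝔪)
          change t (α + β) - 1 ∈ 𝔪
          rw [show t (α + β) - 1 = t β * (t α - 1) + (t β - 1) by rw [← ht]; ring]
          exact add_mem (𝔪.mul_mem_left _ hα) hβ
        neg_mem' := by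
          intro α (hα : t α - 1 ∈ 𝔪)
          change t (-α) - 1 ∈ 𝔪
          rw [show t (-α) - 1 = -t (-α) * (t α - 1) by
            rw [mul_sub, neg_mul, ht, neg_add_cancel, ht0]; ring]
          exact 𝔪.mul_mem_left _ hα }
    intro α
    have : α ∈ S := by
      rw [pi_eq_sum_univ' α]
      refine sum_mem fun i _ => zsmul_mem ?_ _
      exact Ideal.subset_span ⟨i, by simp only [s]⟩
    exact this
  let I : Ideal A := Ideal.span (Set.range fun i => s i ^ m)
  have hI : ∀ x ∈ I, ∀ y, Φ (y * x) = 0 := by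
    intro x hx
    induction hx using Submodule.span_induction with
    | mem x hx =>
      obtain ⟨i, rfl⟩ := hx
      intro y
      induction y using ind with
      | h1 α =>
        rw [← hdiff i α]
        simp only [s, sub_eq_add_neg (t _) (1 : A)]
        rw [add_pow, Finset.mul_sum, map_sum]
        refine Finset.sum_congr rfl fun k _ => ?_
        rw [← hΦt, ← map_zsmul, ← ht, ← htp, zsmul_eq_mul]
        push_cast
        congr 1
        ring
      | h2 y z hy hz => rw [add_mul, map_add, hy, hz, add_zero]
      | h3 c y hy => rw [smul_mul_assoc, map_smul, hy, smul_zero]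
    | zero => intro y; rw [mul_zero, map_zero]
    | add x z _ _ hx hz => intro y; rw [mul_add, map_add, hx, hz, add_zero]
    | smul c x _ hx => intro y; rw [smul_eq_mul, ← mul_assoc, hx]
  obtain ⟨k, hk⟩ : ∃ k, 𝔪 ^ k ≤ I := by
    refine Ideal.exists_pow_le_of_le_radical_of_fg (Ideal.span_le.2 ?_)
      (Submodule.fg_span (Set.finite_range _))
    rintro _ ⟨i, rfl⟩
    exact ⟨m, Ideal.subset_span ⟨i, rfl⟩⟩
  obtain ⟨v, hv0, hv⟩ := exists_common_eigenvector_of_pow d 𝔪 Φ (fun f hf g hg => by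
    rw [hbr, hε𝔪 f hf, hε𝔪 g hg, zero_smul, zero_smul, sub_zero, add_zero])
    (fun f hf => by rw [← one_mul f]; exact hI f (hk hf) 1)
  choose χ hχ using fun α => hv _ (ht𝔪 α)
  have hDv : ∀ α, D α v = (a + χ α) • v := by
    intro α
    rw [add_smul, ← hχ, map_sub, hΦt, ← ht0, hΦt, h0]
    simp
  have inj : ∀ {x y : ℂ}, x • v = y • v → x = y := fun h => smul_left_injective ℂ hv0 h
  obtain ⟨b, hb⟩ := exists_eq_mul_of_witt hlam (χ := χ) (inj (by
    rw [← hχ, ht0, sub_self, map_zero, zero_smul]; rfl)) (fun α β => by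
    have := LinearMap.congr_fun (hD α β) v
    simp only [LinearMap.sub_apply, LinearMap.add_apply, LinearMap.smul_apply,
      Module.End.mul_apply, hDv, map_smul, smul_smul, ← sub_smul, ← add_smul] at this
    have := inj this
    rw [map_sub] at this ⊢
    linear_combination -this)
  exact ⟨v, hv0, b, fun α => by rw [hDv, hb]⟩

end densityEigenvector

section finiteSup

variable {α : Type*} [CompleteLattice α]

/-- A family indexed by `ℤ` satisfying recurrences of order `m` in both directions is controlled
by `m` consecutive members. -/
lemma le_iSup_range_of_recurrence {f : ℤ → α} {m : ℕ}
    (hu : ∀ k, f k ≤ ⨆ i ∈ Finset.Icc 1 m, f (k + i))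
    (hd : ∀ k, f k ≤ ⨆ i ∈ Finset.Icc 1 m, f (k - i)) (k : ℤ) :
    f k ≤ ⨆ j ∈ Finset.range m, f j := by
  have h1 : ∀ s : ℕ, f s ≤ ⨆ j ∈ Finset.range m, f j := by
    intro s
    induction s using Nat.strong_induction_on with
    | _ s ih =>
      by_cases hs : s < m
      · exact le_iSup₂_of_le s (Finset.mem_range.2 hs) le_rfl
      · refine (hd s).trans (iSup₂_le fun i hi => ?_)
        rw [Finset.mem_Icc] at hi
        have := ih (s - i) (by omega)
        rwa [Nat.cast_sub (by omega)] at this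
  have h2 : ∀ s : ℕ, f (-s) ≤ ⨆ j ∈ Finset.range m, f j := by
    intro s
    induction s using Nat.strong_induction_on with
    | _ s ih =>
      refine (hu _).trans (iSup₂_le fun i hi => ?_)
      rw [Finset.mem_Icc] at hi
      by_cases hs : i ≤ s
      · have := ih (s - i) (by omega)
        rwa [Nat.cast_sub hs, neg_sub, sub_eq_add_neg, add_comm] at this
      · have := h1 (i - s)
        rwa [Nat.cast_sub (by omega), sub_eq_add_neg, add_comm] at this
  obtain ⟨s, rfl | rfl⟩ := k.eq_nat_or_neg
  exacts [h1 s, h2 s]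

/-- Multi-dimensional version of `le_iSup_range_of_recurrence`. -/
lemma le_iSup_box_of_recurrence {n : ℕ} {X : (Fin n → ℤ) → α} {m : ℕ}
    (hu : ∀ i β, X β ≤ ⨆ k ∈ Finset.Icc 1 m, X (β + k • Pi.single i 1))
    (hd : ∀ i β, X β ≤ ⨆ k ∈ Finset.Icc 1 m, X (β - k • Pi.single i 1)) (β : Fin n → ℤ) :
    X β ≤ ⨆ γ : Set.pi Set.univ (fun _ : Fin n => Set.Ico (0 : ℤ) m), X γ := by
  have key : ∀ s : Finset (Fin n), ∀ β,
      X β ≤ ⨆ γ, ⨆ (_ : ∀ i ∈ s, γ i ∈ Set.Ico (0 : ℤ) m), X γ := by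
    intro s
    induction s using Finset.induction_on with
    | empty => exact fun β => le_iSup₂_of_le β (by simp) le_rfl
    | insert i s hi ih =>
      refine fun β => (ih β).trans (iSup₂_le fun γ hγ => ?_)
      have hup : ∀ (k : ℤ) (l : ℕ), Function.update γ i k + l • Pi.single i 1 =
          Function.update γ i (k + l) := by
        intro k l; funext j
        by_cases hj : j = i
        · subst hj; simp
        · simp [hj]
      have hup' : ∀ (k : ℤ) (l : ℕ), Function.update γ i k - l • Pi.single i 1 =
          Function.update γ i (k - l) := by
        intro k l; funext j
        by_cases hj : j = i
        · subst hj; simp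
        · simp [hj]
      have := le_iSup_range_of_recurrence (f := fun k => X (Function.update γ i k)) (m := m)
        (fun k => by simpa only [hup] using hu i (Function.update γ i k))
        (fun k => by simpa only [hup'] using hd i (Function.update γ i k)) (γ i)
      simp only [Function.update_eq_self] at this
      refine this.trans (iSup₂_le fun j hj => le_iSup₂_of_le (Function.update γ i j) ?_ le_rfl)
      intro k hk
      by_cases hki : k = i
      · subst hki
        simp only [Function.update_self, Set.mem_Ico]
        have := Finset.mem_range.1 hj
        omega
      · rw [Function.update_of_ne hki]
        exact hγ k ((Finset.mem_insert.1 hk).resolve_left hki)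
  refine (key Finset.univ β).trans (iSup₂_le fun γ hγ => ?_)
  exact le_iSup_of_le (⟨γ, fun i _ => hγ i (Finset.mem_univ i)⟩ :
    Set.pi Set.univ (fun _ : Fin n => Set.Ico (0 : ℤ) m)) le_rfl

end finiteSup

section alternating

/-- Higher differences of an affine function vanish. -/
lemma sum_choose_mul_affine_eq_zero {G : Type} [AddCommGroup G] (lam : G →+ ℂ) (γ h : G) {m : ℕ}
    (hm : 2 ≤ m) :
    ∑ k ∈ Finset.range (m + 1), ((-1 : ℤ) ^ (m - k) * (m.choose k : ℤ)) • lam (γ + k • h) = 0 := by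
  rw [← fwdDiff_iter_eq_sum_shift]
  obtain ⟨m, rfl⟩ := Nat.exists_eq_add_of_le' hm
  have h2 : (fwdDiff h)^[2] (lam : G → ℂ) = 0 := by
    funext x
    simp [fwdDiff]
  rw [Function.iterate_add_apply, h2]
  have : ∀ m : ℕ, (fwdDiff h)^[m] (0 : G → ℂ) = 0 := by
    intro m
    induction m with
    | zero => rfl
    | succ m ih =>
      rw [Function.iterate_succ_apply', ih]
      funext x
      simp [fwdDiff]
  rw [this]
  rfl

variable {G R : Type} [AddCommGroup G] [Ring R] {e : G → R} {h : G} {m : ℕ}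

lemma exists_mul_eq_sum_shift (h0 : ∀ γ δ, altProd e h m γ δ = 0) :
    ∃ c : ℕ → ℤ, ∀ γ δ, e γ * e δ =
      ∑ k ∈ Finset.Icc 1 m, c k • (e (γ - k • h) * e (δ + k • h)) := by
  refine ⟨fun k => -((-1) ^ m * ((-1 : ℤ) ^ (m - k) * (m.choose k : ℤ))), fun γ δ => ?_⟩
  have := h0 γ δ
  rw [altProd_eq_sum, Finset.range_eq_Ico, Finset.sum_eq_sum_Ico_succ_bot (by omega)] at this
  have hs : (-1 : ℤ) ^ m * (-1) ^ m = 1 := by rw [← mul_pow]; simp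
  have h1 := congrArg (fun x => ((-1 : ℤ) ^ m) • x) this
  simp only [smul_add, Finset.smul_sum, smul_smul, Nat.sub_zero, Nat.choose_zero_right,
    Nat.cast_one, mul_one, zero_smul, sub_zero, add_zero, smul_zero, hs, one_smul] at h1
  rw [eq_neg_of_add_eq_zero_left h1, ← Finset.sum_neg_distrib]
  refine Finset.sum_congr ?_ fun k _ => by rw [← neg_smul]
  ext k; simp

lemma exists_mul_eq_sum_shift_neg (h0 : ∀ γ δ, altProd e h m γ δ = 0) :
    ∃ c : ℕ → ℤ, ∀ γ δ, e γ * e δ =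
      ∑ k ∈ Finset.Icc 1 m, c k • (e (γ + k • h) * e (δ - k • h)) := by
  refine ⟨fun k => -((-1 : ℤ) ^ k * (m.choose k : ℤ)), fun γ δ => ?_⟩
  have := h0 (γ + m • h) (δ - m • h)
  rw [altProd_eq_sum, ← Finset.sum_range_reflect, Finset.range_eq_Ico,
    Finset.sum_eq_sum_Ico_succ_bot (by omega)] at this
  have hkey : ∀ k ∈ Finset.Icc 1 m,
      ((-1 : ℤ) ^ (m - (m + 1 - 1 - k)) * (m.choose (m + 1 - 1 - k) : ℤ)) •
        (e (γ + m • h - (m + 1 - 1 - k) • h) * e (δ - m • h + (m + 1 - 1 - k) • h)) =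
      ((-1 : ℤ) ^ k * (m.choose k : ℤ)) • (e (γ + k • h) * e (δ - k • h)) := by
    intro k hk
    obtain ⟨l, rfl⟩ := Nat.exists_eq_add_of_le (Finset.mem_Icc.1 hk).2
    rw [show k + l + 1 - 1 - k = l by omega, show k + l - l = k by omega,
      Nat.choose_symm_add]
    congr 3 <;> · rw [add_smul]; abel_nf
  have hIco : Finset.Ico (0 + 1) (m + 1) = Finset.Icc 1 m := by
    ext k; simp
  rw [hIco, Finset.sum_congr rfl hkey] at this
  simp only [Nat.add_sub_cancel, Nat.sub_zero, Nat.sub_self, pow_zero, Nat.choose_self, one_mul,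
    Nat.cast_one, one_smul, add_sub_cancel_right, sub_add_cancel] at this
  rw [eq_neg_of_add_eq_zero_left this, ← Finset.sum_neg_distrib]
  exact Finset.sum_congr rfl fun k _ => by rw [← neg_smul]

end alternating

section tensorVector

variable {n : ℕ} {lam : Zn n →+ ℂ} {V : Type} [AddCommGroup V] [Module ℂ V]
  {e : Zn n → Module.End ℂ V}

/-- The matrix coefficients `κ ↦ e (κ - β) w` of a vector. -/
def orbitMap (e : Zn n → Module.End ℂ V) (β : Zn n) : V →ₗ[ℂ] Zn n → V :=
  LinearMap.pi fun κ => e (κ - β)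

/-- The weight space of weight `a + lam κ`. -/
abbrev wtSpace (lam : Zn n →+ ℂ) (e : Zn n → Module.End ℂ V) (a : ℂ) (κ : Zn n) : Submodule ℂ V :=
  Module.End.eigenspace (e 0) (a + lam κ)

/-- Span of the functions `orbitMap e β (e δ w)` with `w` of weight `a + lam (β - δ)`. -/
def orbitSpan (lam : Zn n →+ ℂ) (e : Zn n → Module.End ℂ V) (a : ℂ) (β : Zn n) :
    Submodule ℂ (Zn n → V) :=
  (⨆ δ, (wtSpace lam e a (β - δ)).map (e δ)).map (orbitMap e β)

/-- Twisted action of the Witt algebra on functions. -/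
def twistedOp (lam : Zn n →+ ℂ) (e : Zn n → Module.End ℂ V) (α : Zn n) :
    Module.End ℂ (Zn n → V) where
  toFun f κ := e α (f (κ - α)) - lam (κ - α) • f κ
  map_add' f g := by funext κ; simp only [Pi.add_apply, map_add, smul_add]; abel
  map_smul' c f := by
    funext κ
    simp only [Pi.smul_apply, _root_.map_smul, RingHom.id_apply, smul_sub, smul_comm c]

lemma twistedOp_apply (α : Zn n) (f : Zn n → V) (κ : Zn n) :
    twistedOp lam e α f κ = e α (f (κ - α)) - lam (κ - α) • f κ := rfl

lemma orbitMap_apply (β : Zn n) (w : V) (κ : Zn n) : orbitMap e β w κ = e (κ - β) w := rfl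

lemma witt_mem_wtSpace (he : ∀ α β, e α * e β - e β * e α = lam (β - α) • e (α + β)) {a : ℂ}
    {α κ : Zn n} {w : V} (hw : w ∈ wtSpace lam e a κ) : e α w ∈ wtSpace lam e a (κ + α) := by
  rw [Module.End.mem_eigenspace_iff] at hw ⊢
  have h1 := LinearMap.congr_fun (he 0 α) w
  simp only [LinearMap.sub_apply, Module.End.mul_apply, LinearMap.smul_apply, sub_zero,
    zero_add, hw, _root_.map_smul] at h1
  rw [map_add]
  linear_combination (norm := module) h1

lemma twistedOp_witt (he : ∀ α β, e α * e β - e β * e α = lam (β - α) • e (α + β))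
    (α β : Zn n) :
    twistedOp lam e α * twistedOp lam e β - twistedOp lam e β * twistedOp lam e α =
      lam (β - α) • twistedOp lam e (α + β) - lam β • twistedOp lam e β +
        lam α • twistedOp lam e α := by
  refine LinearMap.ext fun f => funext fun κ => ?_
  have h1 := LinearMap.congr_fun (he α β) (f (κ - (α + β)))
  simp only [LinearMap.sub_apply, Module.End.mul_apply, LinearMap.smul_apply] at h1
  simp only [LinearMap.sub_apply, LinearMap.add_apply, Module.End.mul_apply,
    LinearMap.smul_apply, Pi.sub_apply, Pi.add_apply, Pi.smul_apply, twistedOp_apply,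
    _root_.map_sub, _root_.map_smul]
  rw [show κ - α - β = κ - (α + β) by abel, show κ - β - α = κ - (α + β) by abel]
  simp only [map_sub, map_add] at h1 ⊢
  linear_combination (norm := module) h1

lemma twistedOp_orbitMap (he : ∀ α β, e α * e β - e β * e α = lam (β - α) • e (α + β))
    (α β : Zn n) (w : V) :
    twistedOp lam e α (orbitMap e β w) =
      orbitMap e (α + β) (e α w) - lam (α + β) • orbitMap e β w := by
  funext κ
  have h1 := LinearMap.congr_fun (he α (κ - α - β)) w
  simp only [LinearMap.sub_apply, Module.End.mul_apply, LinearMap.smul_apply] at h1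
  rw [show α + (κ - α - β) = κ - β by abel] at h1
  simp only [twistedOp_apply, orbitMap_apply, Pi.sub_apply, Pi.smul_apply]
  rw [show κ - (α + β) = κ - α - β by abel]
  simp only [map_sub, map_add] at h1 ⊢
  linear_combination (norm := module) h1

lemma orbitSpan_le {a : ℂ} {β : Zn n} {U : Submodule ℂ (Zn n → V)}
    (h : ∀ δ, ∀ w ∈ wtSpace lam e a (β - δ), orbitMap e β (e δ w) ∈ U) :
    orbitSpan lam e a β ≤ U := by
  rw [orbitSpan, Submodule.map_le_iff_le_comap]
  refine iSup_le fun δ => ?_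
  rw [Submodule.map_le_iff_le_comap]
  exact h δ

lemma orbitMap_mem_orbitSpan {a : ℂ} {β δ : Zn n} {w : V} (hw : w ∈ wtSpace lam e a (β - δ)) :
    orbitMap e β (e δ w) ∈ orbitSpan lam e a β :=
  Submodule.mem_map_of_mem
    (Submodule.mem_iSup_of_mem δ (Submodule.mem_map_of_mem hw))

/-- Linear span of all matrix coefficients of vectors in the derived part of the module. -/
def fullOrbitSpan (lam : Zn n →+ ℂ) (e : Zn n → Module.End ℂ V) (a : ℂ) :
    Submodule ℂ (Zn n → V) :=
  ⨆ β, orbitSpan lam e a β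

lemma fullOrbitSpan_le {a : ℂ} {U : Submodule ℂ (Zn n → V)}
    (h : ∀ β δ, ∀ w ∈ wtSpace lam e a (β - δ), orbitMap e β (e δ w) ∈ U) :
    fullOrbitSpan lam e a ≤ U :=
  iSup_le fun β => orbitSpan_le (h β)

lemma finite_fullOrbitSpan (he : ∀ α β, e α * e β - e β * e α = lam (β - α) • e (α + β))
    {a : ℂ} (hfin : ∀ κ, Module.Finite ℂ (wtSpace lam e a κ)) {m : ℕ}
    (halt : ∀ i γ δ, altProd e (Pi.single i 1) m γ δ = 0) :
    Module.Finite ℂ (fullOrbitSpan lam e a) := by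
  have hX : ∀ β, Module.Finite ℂ (orbitSpan lam e a β) := by
    intro β
    have hle : (⨆ δ, (wtSpace lam e a (β - δ)).map (e δ)) ≤ wtSpace lam e a β := by
      refine iSup_le fun δ => ?_
      rw [Submodule.map_le_iff_le_comap]
      intro w hw
      have := witt_mem_wtSpace he (α := δ) hw
      rwa [sub_add_cancel] at this
    have := hfin β
    have := Submodule.finiteDimensional_of_le hle
    exact Module.Finite.map _ _
  have hbox := le_iSup_box_of_recurrence (X := orbitSpan lam e a) (m := m)
    (fun i β => by
      obtain ⟨c, hc⟩ := exists_mul_eq_sum_shift (halt i)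
      refine orbitSpan_le fun δ w hw => ?_
      have : orbitMap e β (e δ w) = ∑ k ∈ Finset.Icc 1 m,
          c k • orbitMap e (β + k • Pi.single i 1) (e (δ + k • Pi.single i 1) w) := by
        funext κ
        have := LinearMap.congr_fun (hc (κ - β) δ) w
        simp only [LinearMap.sum_apply, LinearMap.smul_apply, Module.End.mul_apply] at this
        simp only [orbitMap_apply, Finset.sum_apply, Pi.smul_apply, this, sub_sub]
      rw [this]
      refine sum_mem fun k hk => zsmul_mem ?_ _
      refine Submodule.mem_iSup_of_mem k (Submodule.mem_iSup_of_mem hk ?_)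
      exact orbitMap_mem_orbitSpan (by rwa [add_sub_add_right_eq_sub]))
    (fun i β => by
      obtain ⟨c, hc⟩ := exists_mul_eq_sum_shift_neg (halt i)
      refine orbitSpan_le fun δ w hw => ?_
      have : orbitMap e β (e δ w) = ∑ k ∈ Finset.Icc 1 m,
          c k • orbitMap e (β - k • Pi.single i 1) (e (δ - k • Pi.single i 1) w) := by
        funext κ
        have := LinearMap.congr_fun (hc (κ - β) δ) w
        simp only [LinearMap.sum_apply, LinearMap.smul_apply, Module.End.mul_apply] at this
        simp only [orbitMap_apply, Finset.sum_apply, Pi.smul_apply, this, sub_add]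
      rw [this]
      refine sum_mem fun k hk => zsmul_mem ?_ _
      refine Submodule.mem_iSup_of_mem k (Submodule.mem_iSup_of_mem hk ?_)
      exact orbitMap_mem_orbitSpan (by rwa [sub_sub_sub_cancel_right]))
  have : Finite (Set.pi Set.univ (fun _ : Fin n => Set.Ico (0 : ℤ) m)) :=
    (Set.Finite.pi' fun _ => Set.finite_Ico _ _).subset (by intro x hx i; exact hx i trivial)
  exact Submodule.finiteDimensional_of_le (iSup_le hbox)

/-- A module whose weight spaces are finite-dimensional and on which high alternating sums vanish
receives a nonzero homomorphism from a tensor field module. -/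
theorem exists_tensor_family (hlam : ∀ α, α ≠ 0 → lam α ≠ 0)
    (he : ∀ α β, e α * e β - e β * e α = lam (β - α) • e (α + β))
    {a : ℂ} (hfin : ∀ κ, Module.Finite ℂ (wtSpace lam e a κ)) {m : ℕ} (hm : 2 ≤ m)
    (halt : ∀ i γ δ, altProd e (Pi.single i 1) m γ δ = 0)
    (hirr : ∀ U : Submodule ℂ V, (∀ α, ∀ w ∈ U, e α w ∈ U) → U = ⊥ ∨ U = ⊤)
    {δ : Zn n} {w : V} (hw : w ∈ wtSpace lam e a 0) (hne : e δ w ≠ 0) :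
    ∃ (b : ℂ) (f : Zn n → V), f ≠ 0 ∧ (∀ κ, f κ ∈ wtSpace lam e a κ) ∧
      ∀ α κ, e α (f κ) = (a + lam κ + b * lam α) • f (κ + α) := by
  have hwt : fullOrbitSpan lam e a ≤ Submodule.pi Set.univ (wtSpace lam e a) := by
    refine fullOrbitSpan_le fun β δ w hw κ _ => ?_
    have := witt_mem_wtSpace he (α := κ - β) (witt_mem_wtSpace he (α := δ) hw)
    rwa [sub_add_cancel, add_sub_cancel] at this
  have hmaps : ∀ α, ∀ f ∈ fullOrbitSpan lam e a, twistedOp lam e α f ∈ fullOrbitSpan lam e a := by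
    intro α
    change fullOrbitSpan lam e a ≤ (fullOrbitSpan lam e a).comap (twistedOp lam e α)
    refine fullOrbitSpan_le fun β δ w hw => ?_
    rw [Submodule.mem_comap, twistedOp_orbitMap he]
    refine sub_mem ?_ (Submodule.smul_mem _ _ ?_)
    · refine Submodule.mem_iSup_of_mem (α + β) (orbitMap_mem_orbitSpan ?_)
      rw [add_sub_cancel_left]
      have := witt_mem_wtSpace he (α := δ) hw
      rwa [sub_add_cancel] at this
    · exact Submodule.mem_iSup_of_mem β (orbitMap_mem_orbitSpan hw)
  have hX := finite_fullOrbitSpan he hfin halt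
  let D : Zn n → Module.End ℂ (fullOrbitSpan lam e a) := fun α =>
    (twistedOp lam e α).restrict (hmaps α)
  have hD0 : D 0 = a • 1 := by
    refine LinearMap.ext fun f => Subtype.ext (funext fun κ => ?_)
    have : f.1 κ ∈ wtSpace lam e a κ := hwt f.2 κ trivial
    rw [Module.End.mem_eigenspace_iff] at this
    change e 0 (f.1 (κ - 0)) - lam (κ - 0) • f.1 κ = a • f.1 κ
    rw [sub_zero, this]
    module
  have hD : ∀ α β, D α * D β - D β * D α = lam (β - α) • D (α + β) - lam β • D β + lam α • D α :=
    fun α β => LinearMap.ext fun f => Subtype.ext (LinearMap.congr_fun (twistedOp_witt he α β) f.1)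
  have hdiff : ∀ i α, ∑ k ∈ Finset.range (m + 1),
      ((-1 : ℤ) ^ (m - k) * (m.choose k : ℤ)) • D (α + k • Pi.single i 1) = 0 := by
    intro i α
    have hker : fullOrbitSpan lam e a ≤ LinearMap.ker (∑ k ∈ Finset.range (m + 1),
        ((-1 : ℤ) ^ (m - k) * (m.choose k : ℤ)) • twistedOp lam e (α + k • Pi.single i 1)) := by
      refine fullOrbitSpan_le fun β δ w hw => ?_
      rw [LinearMap.mem_ker]
      funext κ
      have h1 := LinearMap.congr_fun (halt i (κ - α - β) α) (e δ w)
      rw [altProd_eq_sum] at h1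
      have h2 := sum_choose_mul_affine_eq_zero lam (α + β) (Pi.single i 1) hm
      simp only [LinearMap.sum_apply, LinearMap.smul_apply, Module.End.mul_apply,
        LinearMap.zero_apply] at h1
      simp only [LinearMap.sum_apply, LinearMap.smul_apply, twistedOp_orbitMap he,
        Finset.sum_apply, Pi.smul_apply, Pi.sub_apply, orbitMap_apply, smul_sub,
        Finset.sum_sub_distrib, Pi.zero_apply]
      have h3 := congrArg (fun c : ℂ => c • e (κ - β) (e δ w)) h2
      simp only [Finset.sum_smul, zero_smul, smul_assoc] at h3
      rw [sub_eq_zero]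
      refine Eq.trans ?_ (h1.trans (h3.symm.trans ?_))
      · refine Finset.sum_congr rfl fun k _ => ?_
        congr 2
        congr 1
        abel
      · refine Finset.sum_congr rfl fun k _ => ?_
        rw [add_right_comm]
    refine LinearMap.ext fun f => Subtype.ext ?_
    have := LinearMap.mem_ker.1 (hker f.2)
    simp only [LinearMap.sum_apply, LinearMap.smul_apply] at this ⊢
    rw [AddSubmonoidClass.coe_finsetSum]
    exact this
  have hnt : Nontrivial (fullOrbitSpan lam e a) := by
    rw [Submodule.nontrivial_iff_ne_bot]
    intro hbot
    have hz : orbitMap e δ (e δ w) = 0 := by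
      rw [← Submodule.mem_bot ℂ, ← hbot]
      exact Submodule.mem_iSup_of_mem δ (orbitMap_mem_orbitSpan (by rwa [sub_self]))
    have hz' : ∀ γ, e γ (e δ w) = 0 := fun γ => by
      have := congrFun hz (γ + δ)
      rwa [orbitMap_apply, add_sub_cancel_right] at this
    have hU : Submodule.span ℂ {e δ w} = ⊤ := by
      refine (hirr _ fun α u hu => ?_).resolve_left fun h => hne ?_
      · obtain ⟨c, rfl⟩ := Submodule.mem_span_singleton.1 hu
        rw [_root_.map_smul, hz', smul_zero]
        exact zero_mem _
      · rwa [Submodule.span_singleton_eq_bot] at h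
    obtain ⟨c, hc⟩ := Submodule.mem_span_singleton.1 (hU ▸ Submodule.mem_top : w ∈ _)
    apply hne
    rw [← hc, _root_.map_smul, hz', smul_zero]
  obtain ⟨f, hf, b, hb⟩ := exists_density_eigenvector hlam D hD0 hD hdiff
  refine ⟨b, f.1, fun h => hf (Subtype.ext h), fun κ => hwt f.2 κ trivial, fun α κ => ?_⟩
  have := congrFun (congrArg Subtype.val (hb α)) (κ + α)
  change e α (f.1 (κ + α - α)) - lam (κ + α - α) • f.1 (κ + α) =
    (a + b * lam α) • f.1 (κ + α) at this
  rw [add_sub_cancel_right] at this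
  linear_combination (norm := module) this

end tensorVector

section structureTheorem

variable {n : ℕ} {lam : Zn n →+ ℂ} {V : Type} [AddCommGroup V] [Module ℂ V]
  {e : Zn n → Module.End ℂ V}

lemma smul_eq_zero_of_linearCombination (hlam : ∀ α, α ≠ 0 → lam α ≠ 0) {a : ℂ} {f : Zn n → V}
    (hf : ∀ κ, f κ ∈ wtSpace lam e a κ) {t : Zn n →₀ ℂ}
    (ht : Finsupp.linearCombination ℂ f t = 0) (κ : Zn n) : t κ • f κ = 0 := by
  have hinj : Function.Injective fun κ => a + lam κ := by
    intro x y hxy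
    by_contra hne
    refine hlam (x - y) (sub_ne_zero.2 hne) ?_
    rw [map_sub]
    linear_combination hxy
  have := (iSupIndep_iff_finsetSum_eq_zero_imp_eq_zero _).1
    ((e 0).eigenspaces_iSupIndep.comp hinj) t.support (fun κ => t κ • f κ)
    (fun κ _ => Submodule.smul_mem _ _ (hf κ)) ht
  by_cases hκ : κ ∈ t.support
  · exact this κ hκ
  · rw [Finsupp.notMem_support_iff.1 hκ, zero_smul]

lemma exists_altProd_eq_zero_of_cuspidal
    (he : ∀ α β, e α * e β - e β * e α = lam (β - α) • e (α + β))
    (hfin : ∀ x, Module.Finite ℂ (Module.End.eigenspace (e 0) x)) {N : ℕ}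
    (hle : ∀ x, Module.finrank ℂ (Module.End.eigenspace (e 0) x) ≤ N)
    (htop : (⨆ x : ℂ, Module.End.eigenspace (e 0) x) = ⊤) {h : Zn n} (hh : lam h ≠ 0) :
    ∃ M, ∀ γ δ, altProd e h M γ δ = 0 := by
  let L : ℤ → Module.End ℂ V := fun k => (lam h)⁻¹ • e (k • h)
  have heig : ∀ x, Module.End.eigenspace (L 0) x = Module.End.eigenspace (e 0) (lam h * x) := by
    intro x
    ext v
    rw [Module.End.mem_eigenspace_iff, Module.End.mem_eigenspace_iff]
    change (lam h)⁻¹ • e ((0 : ℤ) • h) v = x • v ↔ _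
    rw [zero_smul, inv_smul_eq_iff₀ hh, mul_smul]
  have hL : IsCuspidalWitt L N := by
    refine ⟨fun r s v => ?_, fun x => by rw [heig]; exact hfin _, fun x => by rw [heig]; exact hle _⟩
    have := LinearMap.congr_fun (he (r • h) (s • h)) v
    rw [← sub_smul, ← add_smul] at this
    simp only [LinearMap.sub_apply, Module.End.mul_apply, LinearMap.smul_apply, map_zsmul] at this
    rw [← Int.cast_smul_eq_zsmul ℂ (s - r), smul_eq_mul] at this
    simp only [L, LinearMap.smul_apply, _root_.map_smul, smul_smul]
    rw [← smul_sub, this, smul_smul]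
    congr 1
    field_simp
    push_cast
    ring
  have hLtop : (⨆ x : ℂ, Module.End.eigenspace (L 0) x) = ⊤ := by
    rw [eq_top_iff, ← htop]
    refine iSup_le fun x => le_iSup_of_le ((lam h)⁻¹ * x) ?_
    rw [heig, mul_inv_cancel_left₀ hh]
  obtain ⟨M, hM⟩ := hL.exists_altProd_eq_zero hLtop
  refine ⟨_, fun γ δ => altProd_extend he hh (M := M) (fun c d => ?_) γ δ⟩
  have h1 := hM c d
  rw [altProd_eq_sum] at h1 ⊢
  have h2 := congrArg (fun x => (lam h * lam h) • x) h1
  simp only [Finset.smul_sum, smul_zero] at h2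
  rw [← h2]
  refine Finset.sum_congr rfl fun i _ => ?_
  simp only [L]
  rw [smul_mul_smul_comm, smul_comm (lam h * lam h), smul_smul (lam h * lam h), show lam h * lam h * ((lam h)⁻¹ * (lam h)⁻¹) = 1 by field_simp, one_smul]

/-- Irreducible cuspidal modules are trivial or spanned by a tensor field family of vectors. -/
theorem exists_spanning_tensor_family [Nontrivial V] (hlam : ∀ α, α ≠ 0 → lam α ≠ 0)
    (he : ∀ α β, e α * e β - e β * e α = lam (β - α) • e (α + β))
    (hfin : ∀ x, Module.Finite ℂ (Module.End.eigenspace (e 0) x)) {N : ℕ}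
    (hle : ∀ x, Module.finrank ℂ (Module.End.eigenspace (e 0) x) ≤ N)
    (htop : (⨆ x : ℂ, Module.End.eigenspace (e 0) x) = ⊤)
    (hirr : ∀ U : Submodule ℂ V, (∀ α, ∀ w ∈ U, e α w ∈ U) → U = ⊥ ∨ U = ⊤)
    (hnt : ∃ α, e α ≠ 0) :
    ∃ (a b : ℂ) (f : Zn n → V), f ≠ 0 ∧ Submodule.span ℂ (Set.range f) = ⊤ ∧
      (∀ κ, f κ ∈ wtSpace lam e a κ) ∧
      ∀ α κ, e α (f κ) = (a + lam κ + b * lam α) • f (κ + α) := by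
  obtain ⟨δ, hδ⟩ := hnt
  obtain ⟨x, hx⟩ : ∃ x, ¬ Module.End.eigenspace (e 0) x ≤ LinearMap.ker (e δ) := by
    by_contra! hcon
    apply hδ
    rw [← LinearMap.ker_eq_top, eq_top_iff, ← htop]
    exact iSup_le hcon
  obtain ⟨w, hw, hwδ⟩ := SetLike.not_le_iff_exists.1 hx
  choose M hM using fun i : Fin n => exists_altProd_eq_zero_of_cuspidal he hfin hle htop
    (h := Pi.single i 1) (hlam _ (by simp))
  obtain ⟨b, f, hf, hfw, hfe⟩ := exists_tensor_family hlam he (a := x) (fun κ => hfin _)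
    (m := 2 + ∑ i, M i) (by omega)
    (fun i => altProd_eq_zero_of_le
      ((Finset.single_le_sum (fun _ _ => Nat.zero_le _) (Finset.mem_univ i)).trans
        (Nat.le_add_left _ _)) (hM i))
    hirr (δ := δ) (w := w) (by simpa using hw) hwδ
  refine ⟨x, b, f, hf, (hirr _ fun α => ?_).resolve_left fun h => ?_, hfw, hfe⟩
  · change _ ≤ Submodule.comap (e α) (Submodule.span ℂ (Set.range f))
    rw [Submodule.span_le]
    rintro _ ⟨κ, rfl⟩
    change e α (f κ) ∈ Submodule.span ℂ (Set.range f)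
    rw [hfe]
    exact Submodule.smul_mem _ _ (Submodule.subset_span ⟨_, rfl⟩)
  · apply hf
    funext κ
    rw [Pi.zero_apply, ← Submodule.mem_bot ℂ, ← h]
    exact Submodule.subset_span ⟨κ, rfl⟩

/-- Normal form of the spanning family of `exists_spanning_tensor_family`. -/
theorem exists_tensor_family_normalForm [Nonempty (Fin n)] (hlam : ∀ α, α ≠ 0 → lam α ≠ 0)
    (hirr : ∀ U : Submodule ℂ V, (∀ α, ∀ w ∈ U, e α w ∈ U) → U = ⊥ ∨ U = ⊤)
    (hnt : ∃ α, e α ≠ 0) {a b : ℂ} {f : Zn n → V} (hf : f ≠ 0)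
    (hspan : Submodule.span ℂ (Set.range f) = ⊤) (hfw : ∀ κ, f κ ∈ wtSpace lam e a κ)
    (hfe : ∀ α κ, e α (f κ) = (a + lam κ + b * lam α) • f (κ + α)) :
    ((∀ κ, f κ ≠ 0) ∧ (a ∉ Set.range lam ∨ b ≠ 0 ∧ b ≠ 1)) ∨
      ∃ g : Zn n → V, Submodule.span ℂ (Set.range g) = ⊤ ∧ (∀ κ, g κ ∈ wtSpace lam e 0 κ) ∧
        (∀ α κ, e α (g κ) = lam κ • g (κ + α)) ∧ g 0 = 0 ∧ ∀ κ, κ ≠ 0 → g κ ≠ 0 := by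
  have hinj : ∀ {x y}, lam x = lam y → x = y := by
    intro x y hxy
    by_contra hne
    exact hlam (x - y) (sub_ne_zero.2 hne) (by rw [map_sub, hxy, sub_self])
  have hlc := fun {t : Zn n →₀ ℂ} => smul_eq_zero_of_linearCombination hlam hfw (t := t)
  by_cases hZ : ∀ κ, f κ ≠ 0
  · refine .inl ⟨hZ, ?_⟩
    by_contra! hcon
    obtain ⟨⟨κ0, hκ0⟩, hb⟩ := hcon
    obtain ⟨κ0, rfl⟩ : ∃ κ, κ0 = -κ := ⟨-κ0, by simp⟩
    rw [map_neg] at hκ0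
    by_cases hb0 : b = 0
    · subst hb0
      have hU : Submodule.span ℂ {f κ0} = ⊤ := by
        refine (hirr _ fun α u hu => ?_).resolve_left fun h => hZ κ0 ?_
        · obtain ⟨c, rfl⟩ := Submodule.mem_span_singleton.1 hu
          rw [_root_.map_smul, hfe, ← hκ0]
          simp
        · rwa [Submodule.span_singleton_eq_bot] at h
      obtain ⟨κ, hκ⟩ := exists_ne κ0
      obtain ⟨c, hc⟩ := Submodule.mem_span_singleton.1 (hU ▸ Submodule.mem_top : f κ ∈ _)
      have := hlc (t := Finsupp.single κ 1 - Finsupp.single κ0 c) (by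
        simp [hc]) κ
      simp [hκ.symm, hZ] at this
    · obtain rfl := hb hb0
      have hU : Submodule.span ℂ (f '' {κ0}ᶜ) = ⊤ := by
        refine (hirr _ fun α => ?_).resolve_left fun h => ?_
        · change _ ≤ Submodule.comap (e α) (Submodule.span ℂ (f '' {κ0}ᶜ))
          rw [Submodule.span_le]
          rintro _ ⟨κ, hκ, rfl⟩
          change e α (f κ) ∈ Submodule.span ℂ (f '' {κ0}ᶜ)
          rw [hfe]
          by_cases h0 : κ + α = κ0
          · have hc : a + lam κ + 1 * lam α = 0 := by
              rw [← hκ0, ← h0, map_add]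
              ring
            rw [hc, zero_smul]
            exact zero_mem _
          · exact Submodule.smul_mem _ _ (Submodule.subset_span ⟨_, h0, rfl⟩)
        · obtain ⟨κ, hκ⟩ := exists_ne κ0
          apply hZ κ
          rw [← Submodule.mem_bot ℂ, ← h]
          exact Submodule.subset_span ⟨κ, hκ, rfl⟩
      obtain ⟨t, ht, ht'⟩ := (Finsupp.mem_span_image_iff_linearCombination ℂ).1
        (hU ▸ Submodule.mem_top : f κ0 ∈ _)
      have h0 : t κ0 = 0 := by
        by_contra hne
        exact (Finsupp.mem_supported ℂ t).1 ht (Finsupp.mem_support_iff.2 hne) rfl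
      have := hlc (t := t - Finsupp.single κ0 1) (by simp [ht']) κ0
      simp [h0, hZ] at this
  · right
    push Not at hZ
    obtain ⟨κ0, hκ0⟩ := hZ
    have hrel : ∀ κ κ', f κ = 0 → f κ' ≠ 0 → a + lam κ + b * (lam κ' - lam κ) = 0 := by
      intro κ κ' h h'
      have := hfe (κ' - κ) κ
      rw [h, map_zero, add_sub_cancel, map_sub] at this
      exact (smul_eq_zero.1 this.symm).resolve_right h'
    obtain ⟨κ1, hκ1⟩ := Function.ne_iff.1 hf
    rw [Pi.zero_apply] at hκ1
    have hb1 : b ≠ 1 := by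
      rintro rfl
      have hz : ∀ κ, f κ ≠ 0 → a + lam κ = 0 := fun κ hκ => by
        linear_combination hrel κ0 κ hκ0 hκ
      obtain ⟨α, hα⟩ := hnt
      apply hα
      rw [← LinearMap.ker_eq_top, eq_top_iff, ← hspan, Submodule.span_le]
      rintro _ ⟨κ, rfl⟩
      rw [SetLike.mem_coe, LinearMap.mem_ker, hfe]
      by_cases h0 : f (κ + α) = 0
      · rw [h0, smul_zero]
      · have := hz _ h0
        rw [map_add] at this
        rw [show a + lam κ + 1 * lam α = 0 by linear_combination this, zero_smul]
    have hone : ∀ κ, f κ = 0 → κ = κ0 := by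
      intro κ hκ
      have h1 := hrel κ κ1 hκ hκ1
      have h2 := hrel κ0 κ1 hκ0 hκ1
      have h3 : (1 - b) * (lam κ - lam κ0) = 0 := by linear_combination h1 - h2
      exact hinj (sub_eq_zero.1 ((mul_eq_zero.1 h3).resolve_left (sub_ne_zero.2 hb1.symm)))
    have hb0 : b = 0 := by
      by_contra hb0
      obtain ⟨κ, hκ⟩ := Infinite.exists_notMem_finset ({κ0, κ1} : Finset (Zn n))
      simp only [Finset.mem_insert, Finset.mem_singleton, not_or] at hκ
      have h1 := hrel κ0 κ hκ0 fun h => hκ.1 (hone κ h)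
      have h2 := hrel κ0 κ1 hκ0 hκ1
      have h3 : b * (lam κ - lam κ1) = 0 := by linear_combination h1 - h2
      exact hκ.2 (hinj (sub_eq_zero.1 ((mul_eq_zero.1 h3).resolve_left hb0)))
    subst hb0
    have ha : a + lam κ0 = 0 := by linear_combination hrel κ0 κ1 hκ0 hκ1
    refine ⟨fun κ => f (κ + κ0), ?_, fun κ => ?_, fun α κ => ?_, by simpa using hκ0,
      fun κ hκ h => hκ (by simpa using hone _ h)⟩
    · rw [← hspan]
      congr 1
      exact (Equiv.addRight κ0).surjective.range_comp f
    · have := hfw (κ + κ0)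
      rw [wtSpace, map_add] at this
      rw [wtSpace, show 0 + lam κ = a + (lam κ + lam κ0) by linear_combination -ha]
      exact this
    · simp only [hfe]
      rw [map_add, add_right_comm κ, show a + (lam κ + lam κ0) + 0 * lam α = lam κ by
        linear_combination ha]

end structureTheorem

section assembly

variable {n : ℕ} {V : Type} [AddCommGroup V] [Module ℂ V]

/-- Pairing with `μ` as an additive map. -/
noncomputable def mdotHom (μ : Fin n → ℂ) : Zn n →+ ℂ :=
  AddMonoidHom.mk' (mdot μ) fun α β => by
    simp [mdot, mul_add, Finset.sum_add_distrib]

/-- Two actions of `Wn n` related by a linear map on basis vectors are intertwined by it. -/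
lemma intertwine_of_basis {W : Type} [AddCommGroup W] [Module ℂ W]
    {ρ : Wn n →ₗ[ℂ] V →ₗ[ℂ] V} {σ : Wn n →ₗ[ℂ] W →ₗ[ℂ] W} {ψ : V →ₗ[ℂ] W} {s : Set V}
    (hs : Submodule.span ℂ s = ⊤)
    (h : ∀ α, ∀ v ∈ s, ψ (ρ (ew α) v) = σ (ew α) (ψ v)) (x : Wn n) (v : V) :
    ψ (ρ x v) = σ x (ψ v) := by
  have h1 : ∀ α, ψ ∘ₗ ρ (ew α) = σ (ew α) ∘ₗ ψ := fun α =>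
    LinearMap.ext_on hs fun v hv => h α v hv
  induction x using Finsupp.induction_linear with
  | zero => simp
  | add f g hf hg => simp only [map_add, LinearMap.add_apply, hf, hg]
  | single α c =>
    have : (Finsupp.single α c : Wn n) = c • ew α := by simp [ew]
    rw [this]
    simp only [_root_.map_smul, LinearMap.smul_apply]
    rw [show ψ (ρ (ew α) v) = σ (ew α) (ψ v) from LinearMap.congr_fun (h1 α) v]

lemma span_range_vv : Submodule.span ℂ (Set.range (vv : Zn n → Tn n)) = ⊤ := by
  rw [eq_top_iff]
  intro x _
  induction x using Finsupp.induction_linear with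
  | zero => exact zero_mem _
  | add f g hf hg => exact add_mem (hf trivial) (hg trivial)
  | single α c =>
    have : (Finsupp.single α c : Tn n) = c • vv α := by simp [vv]
    rw [this]
    exact Submodule.smul_mem _ _ (Submodule.subset_span ⟨α, rfl⟩)

/-- The zero mode acts diagonally on a tensor field module. -/
lemma zero_mode_apply {μ : Fin n → ℂ} {σ : Wn n →ₗ[ℂ] Tn n →ₗ[ℂ] Tn n} {a : ℂ}
    (hσ : ∀ β, σ (ew 0) (vv β) = (a + mdot μ β) • vv β) (t : Tn n) (β : Zn n) :
    σ (ew 0) t β = (a + mdot μ β) * t β := by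
  induction t using Finsupp.induction_linear with
  | zero => simp
  | add f g hf hg => rw [map_add, Finsupp.add_apply, hf, hg, Finsupp.add_apply, mul_add]
  | single γ c =>
    have : (Finsupp.single γ c : Tn n) = c • vv γ := by simp [vv]
    rw [this, _root_.map_smul, hσ]
    by_cases h : β = γ
    · subst h; simp [vv]; ring
    · simp [vv, h]

lemma mem_span_vv_zero {t : Tn n} :
    t ∈ Submodule.span ℂ {vv (0 : Zn n)} ↔ ∀ β, β ≠ 0 → t β = 0 := by
  rw [Submodule.mem_span_singleton]
  constructor
  · rintro ⟨c, rfl⟩ β hβ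
    simp [vv, hβ]
  · intro h
    refine ⟨t 0, ?_⟩
    ext β
    by_cases hβ : β = 0
    · subst hβ; simp [vv]
    · simp [vv, hβ, h β hβ]

end assembly

lemma exactly_one_of_or {A B C : Prop} (hAB : ¬(A ∧ B)) (hAC : ¬(A ∧ C)) (hBC : ¬(B ∧ C))
    (h : A ∨ B ∨ C) : (A ∧ ¬B ∧ ¬C) ∨ (¬A ∧ B ∧ ¬C) ∨ (¬A ∧ ¬B ∧ C) := by
  tauto

/-- Classification of nonzero irreducible cuspidal `W(n)_μ`-modules: such a module is
isomorphic to exactly one of (1) a tensor module `T_μ(a,b)` with `a ∉ Γ_μ` or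
`b ∉ {0,1}`; (2) the quotient `T̄_μ(0,0) = T_μ(0,0)/ℂv_0`; (3) the one-dimensional
trivial module.  Here `B` is the bracket of `W(n)_μ`, `ρT a b` the action of
`T_μ(a,b)`, `ρQ` the induced action on the quotient `T̄_μ(0,0)`, and `ρ` the action
on `V`; cuspidality says `V` is the sum of the eigenspaces of `e_0`, all of dimension
at most `N`. -/
theorem stmt13 (n : ℕ) (hn : 1 ≤ n) (μ : Fin n → ℂ) (hμ : Generic μ)
    (B : Wn n →ₗ[ℂ] Wn n →ₗ[ℂ] Wn n)
    (hB : ∀ α β : Zn n, B (ew α) (ew β) = Finsupp.single (α + β) (mdot μ (β - α)))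
    (ρT : ℂ → ℂ → (Wn n →ₗ[ℂ] Tn n →ₗ[ℂ] Tn n))
    (hρT : ∀ (a b : ℂ) (α β : Zn n),
      ρT a b (ew α) (vv β) = (a + mdot μ β + b * mdot μ α) • vv (α + β))
    (L : Submodule ℂ (Tn n)) (hL : L = Submodule.span ℂ {vv (0 : Zn n)})
    (ρQ : Wn n →ₗ[ℂ] (Tn n ⧸ L) →ₗ[ℂ] (Tn n ⧸ L))
    (hρQ : ∀ (x : Wn n) (w : Tn n), ρQ x (L.mkQ w) = L.mkQ (ρT 0 0 x w))
    (V : Type) [AddCommGroup V] [Module ℂ V] [Nontrivial V]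
    (ρ : Wn n →ₗ[ℂ] V →ₗ[ℂ] V)
    (hLie : ∀ (x y : Wn n) (w : V), ρ (B x y) w = ρ x (ρ y w) - ρ y (ρ x w))
    (hirr : ∀ U : Submodule ℂ V, (∀ (x : Wn n), ∀ w ∈ U, ρ x w ∈ U) → U = ⊥ ∨ U = ⊤)
    (hwt : (⨆ lam : ℂ, Module.End.eigenspace (ρ (ew 0)) lam) = ⊤)
    (N : ℕ)
    (hcusp : ∀ lam : ℂ, Module.Finite ℂ (Module.End.eigenspace (ρ (ew 0)) lam) ∧
      Module.finrank ℂ (Module.End.eigenspace (ρ (ew 0)) lam) ≤ N) :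
    (  ((∃ a b : ℂ, (a ∉ Set.range (mdot μ) ∨ (b ≠ 0 ∧ b ≠ 1)) ∧
          ∃ φ : V ≃ₗ[ℂ] Tn n, ∀ (x : Wn n) (w : V), φ (ρ x w) = ρT a b x (φ w)) ∧
        ¬(∃ φ : V ≃ₗ[ℂ] (Tn n ⧸ L), ∀ (x : Wn n) (w : V), φ (ρ x w) = ρQ x (φ w)) ∧
        ¬(Module.finrank ℂ V = 1 ∧ ∀ (x : Wn n) (w : V), ρ x w = 0))
    ∨ (¬(∃ a b : ℂ, (a ∉ Set.range (mdot μ) ∨ (b ≠ 0 ∧ b ≠ 1)) ∧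
          ∃ φ : V ≃ₗ[ℂ] Tn n, ∀ (x : Wn n) (w : V), φ (ρ x w) = ρT a b x (φ w)) ∧
        (∃ φ : V ≃ₗ[ℂ] (Tn n ⧸ L), ∀ (x : Wn n) (w : V), φ (ρ x w) = ρQ x (φ w)) ∧
        ¬(Module.finrank ℂ V = 1 ∧ ∀ (x : Wn n) (w : V), ρ x w = 0))
    ∨ (¬(∃ a b : ℂ, (a ∉ Set.range (mdot μ) ∨ (b ≠ 0 ∧ b ≠ 1)) ∧
          ∃ φ : V ≃ₗ[ℂ] Tn n, ∀ (x : Wn n) (w : V), φ (ρ x w) = ρT a b x (φ w)) ∧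
        ¬(∃ φ : V ≃ₗ[ℂ] (Tn n ⧸ L), ∀ (x : Wn n) (w : V), φ (ρ x w) = ρQ x (φ w)) ∧
        (Module.finrank ℂ V = 1 ∧ ∀ (x : Wn n) (w : V), ρ x w = 0)) ) := by
  have : Nonempty (Fin n) := ⟨⟨0, hn⟩⟩
  subst hL
  have hlam : ∀ α, α ≠ 0 → mdotHom μ α ≠ 0 := hμ
  obtain ⟨α₀, hα₀⟩ := exists_ne (0 : Zn n)
  have m0 : mdot μ 0 = 0 := (mdotHom μ).map_zero
  have hAC : ¬((∃ a b : ℂ, (a ∉ Set.range (mdot μ) ∨ (b ≠ 0 ∧ b ≠ 1)) ∧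
      ∃ φ : V ≃ₗ[ℂ] Tn n, ∀ (x : Wn n) (w : V), φ (ρ x w) = ρT a b x (φ w)) ∧
      (Module.finrank ℂ V = 1 ∧ ∀ (x : Wn n) (w : V), ρ x w = 0)) := by
    rintro ⟨⟨a, b, -, φ, hφ⟩, -, hz⟩
    have h1 : ∀ β, a + mdot μ β = 0 := fun β => by
      have := hφ (ew 0) (φ.symm (vv β))
      rw [hz, map_zero, φ.apply_symm_apply, hρT, m0, mul_zero, add_zero, zero_add] at this
      simpa [vv] using DFunLike.congr_fun this.symm β
    have h2 := h1 0
    rw [m0] at h2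
    exact hμ α₀ hα₀ (by linear_combination h1 α₀ - h2)
  have hmk : ∀ t : Tn n, (Submodule.span ℂ {vv (0 : Zn n)}).mkQ t = 0 ↔ ∀ β, β ≠ 0 → t β = 0 :=
    fun t => by
      rw [← LinearMap.mem_ker, Submodule.ker_mkQ]
      exact mem_span_vv_zero
  have hT0 : ∀ (a b : ℂ) (β : Zn n), ρT a b (ew 0) (vv β) = (a + mdot μ β) • vv β := fun a b β => by
    rw [hρT, m0, mul_zero, add_zero, zero_add]
  have hBC : ¬((∃ φ : V ≃ₗ[ℂ] (Tn n ⧸ Submodule.span ℂ {vv (0 : Zn n)}),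
      ∀ (x : Wn n) (w : V), φ (ρ x w) = ρQ x (φ w)) ∧
      (Module.finrank ℂ V = 1 ∧ ∀ (x : Wn n) (w : V), ρ x w = 0)) := by
    rintro ⟨⟨φ, hφ⟩, -, hz⟩
    have := hφ (ew 0) (φ.symm (Submodule.mkQ _ (vv α₀)))
    rw [hz, map_zero, φ.apply_symm_apply, hρQ, eq_comm, hmk] at this
    have := this α₀ hα₀
    rw [zero_mode_apply (hT0 0 0)] at this
    exact hμ α₀ hα₀ (by simpa [vv] using this)
  have hAB : ¬((∃ a b : ℂ, (a ∉ Set.range (mdot μ) ∨ (b ≠ 0 ∧ b ≠ 1)) ∧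
      ∃ φ : V ≃ₗ[ℂ] Tn n, ∀ (x : Wn n) (w : V), φ (ρ x w) = ρT a b x (φ w)) ∧
      (∃ φ : V ≃ₗ[ℂ] (Tn n ⧸ Submodule.span ℂ {vv (0 : Zn n)}),
        ∀ (x : Wn n) (w : V), φ (ρ x w) = ρQ x (φ w))) := by
    rintro ⟨⟨a, b, -, φ, hφ⟩, φ', hφ'⟩
    have key : ∀ κ, ∃ β, β ≠ 0 ∧ a + mdot μ κ = mdot μ β := by
      intro κ
      have h1 := hφ (ew 0) (φ.symm (vv κ))
      rw [φ.apply_symm_apply, hT0] at h1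
      have h2 : ρ (ew 0) (φ.symm (vv κ)) = (a + mdot μ κ) • φ.symm (vv κ) := by
        apply φ.injective
        rw [h1, _root_.map_smul, φ.apply_symm_apply]
      have h3 := hφ' (ew 0) (φ.symm (vv κ))
      obtain ⟨t, ht⟩ := Submodule.mkQ_surjective _ (φ' (φ.symm (vv κ)))
      rw [h2, _root_.map_smul, ← ht, hρQ, ← _root_.map_smul, ← sub_eq_zero, ← map_sub, hmk] at h3
      have h4 : ¬ ∀ β, β ≠ 0 → t β = 0 := by
        rw [← hmk, ht, φ'.map_eq_zero_iff, φ.symm.map_eq_zero_iff]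
        simp [vv]
      push Not at h4
      obtain ⟨β, hβ, htβ⟩ := h4
      have h5 := h3 β hβ
      rw [Finsupp.sub_apply, zero_mode_apply (hT0 0 0), Finsupp.smul_apply, smul_eq_mul,
        ← sub_mul, zero_add] at h5
      exact ⟨β, hβ, sub_eq_zero.1 ((mul_eq_zero.1 h5).resolve_right htβ)⟩
    obtain ⟨β, hβ, h1⟩ := key 0
    obtain ⟨β', hβ', h2⟩ := key (-β)
    have hneg : mdot μ (-β) = -mdot μ β := (mdotHom μ).map_neg β
    exact hμ β' hβ' (by rw [m0] at h1; linear_combination h1 - h2 + hneg)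
  refine exactly_one_of_or hAB hAC hBC ?_
  let e : Zn n → Module.End ℂ V := fun α => ρ (ew α)
  have hew : ∀ (α : Zn n) (c : ℂ), (Finsupp.single α c : Wn n) = c • ew α := fun α c => by
    simp [ew]
  have he : ∀ α β, e α * e β - e β * e α = mdotHom μ (β - α) • e (α + β) := by
    intro α β
    refine LinearMap.ext fun w => ?_
    have := hLie (ew α) (ew β) w
    rw [hB, hew, _root_.map_smul] at this
    exact this.symm
  have hirr' : ∀ U : Submodule ℂ V, (∀ α, ∀ w ∈ U, e α w ∈ U) → U = ⊥ ∨ U = ⊤ := by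
    refine fun U hU => hirr U fun x w hw => ?_
    induction x using Finsupp.induction_linear with
    | zero => simp
    | add f g hf hg => rw [map_add]; exact add_mem hf hg
    | single α c => rw [hew, _root_.map_smul]; exact Submodule.smul_mem _ _ (hU α w hw)
  by_cases hnt : ∃ α, e α ≠ 0
  · obtain ⟨a, b, f, hf, hspan, hfw, hfe⟩ := exists_spanning_tensor_family hlam he
      (fun x => (hcusp x).1) (fun x => (hcusp x).2) hwt hirr' hnt
    have hlc : ∀ {a : ℂ} {g : Zn n → V}, (∀ κ, g κ ∈ wtSpace (mdotHom μ) e a κ) →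
        ∀ t : Tn n, Finsupp.linearCombination ℂ g t = 0 → ∀ κ, t κ • g κ = 0 :=
      fun hg t ht => smul_eq_zero_of_linearCombination hlam hg ht
    have hsurj : ∀ g : Zn n → V, Submodule.span ℂ (Set.range g) = ⊤ →
        Function.Surjective (Finsupp.linearCombination ℂ g) := fun g hg => by
      rw [← LinearMap.range_eq_top, Finsupp.range_linearCombination, hg]
    have h_intertwine : ∀ {a b : ℂ} {g : Zn n → V},
        (∀ α κ, e α (g κ) = (a + mdotHom μ κ + b * mdotHom μ α) • g (κ + α)) → ∀ x t,
        Finsupp.linearCombination ℂ g (ρT a b x t) = ρ x (Finsupp.linearCombination ℂ g t) := by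
      intro a b g hg
      refine intertwine_of_basis span_range_vv ?_
      rintro α _ ⟨κ, rfl⟩
      rw [hρT, _root_.map_smul]
      simp only [vv, Finsupp.linearCombination_single, one_smul]
      rw [add_comm α κ]
      exact (hg α κ).symm
    rcases exists_tensor_family_normalForm hlam hirr' hnt hf hspan hfw hfe with
      ⟨hne, hab⟩ | ⟨g, hgs, hgw, hge, hg0, hgne⟩
    · refine .inl ⟨a, b, hab, ?_⟩
      have hinj : Function.Injective (Finsupp.linearCombination ℂ f) := by
        rw [← LinearMap.ker_eq_bot, LinearMap.ker_eq_bot']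
        intro t ht
        ext κ
        exact (smul_eq_zero.1 (hlc hfw t ht κ)).resolve_right (hne κ)
      let ψ := LinearEquiv.ofBijective _ ⟨hinj, hsurj f hspan⟩
      refine ⟨ψ.symm, fun x w => ?_⟩
      rw [LinearEquiv.symm_apply_eq]
      have := h_intertwine hfe x (ψ.symm w)
      change _ = ρ x (ψ (ψ.symm w)) at this
      rw [ψ.apply_symm_apply] at this
      exact this.symm
    · refine .inr (.inl ?_)
      have hker : Submodule.span ℂ {vv (0 : Zn n)} =
          LinearMap.ker (Finsupp.linearCombination ℂ g) := by
        apply le_antisymm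
        · rw [Submodule.span_singleton_le_iff_mem, LinearMap.mem_ker]
          simp [vv, hg0]
        · intro t ht
          rw [mem_span_vv_zero]
          exact fun κ hκ => (smul_eq_zero.1 (hlc hgw t ht κ)).resolve_right (hgne κ hκ)
      let ψ := (Submodule.quotEquivOfEq _ _ hker).trans
        ((Finsupp.linearCombination ℂ g).quotKerEquivOfSurjective (hsurj g hgs))
      have hψ : ∀ t, ψ (Submodule.mkQ _ t) = Finsupp.linearCombination ℂ g t := fun t => rfl
      refine ⟨ψ.symm, fun x w => ?_⟩
      rw [LinearEquiv.symm_apply_eq]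
      obtain ⟨t, ht⟩ := Submodule.mkQ_surjective _ (ψ.symm w)
      rw [← ht, hρQ, hψ, h_intertwine (fun α κ => by rw [hge]; simp), ← hψ, ht, ψ.apply_symm_apply]
  · push Not at hnt
    have hz : ∀ (x : Wn n) (w : V), ρ x w = 0 := by
      intro x w
      induction x using Finsupp.induction_linear with
      | zero => simp
      | add f g hf hg => rw [map_add, LinearMap.add_apply, hf, hg, add_zero]
      | single α c =>
        rw [hew, _root_.map_smul, LinearMap.smul_apply,
          show ρ (ew α) w = 0 from LinearMap.congr_fun (hnt α) w, smul_zero]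
    refine .inr (.inr ⟨?_, hz⟩)
    obtain ⟨v, hv⟩ := exists_ne (0 : V)
    have hU : Submodule.span ℂ {v} = ⊤ := by
      refine (hirr _ fun x w _ => by rw [hz]; exact zero_mem _).resolve_left ?_
      rwa [Submodule.span_singleton_eq_bot]
    rw [← finrank_top ℂ V, ← hU, finrank_span_singleton hv]
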